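/- For every ρ ∈ (0,1) there is a constant Q > 1, depending only on ρ, with the following property: for every 0 < R < ∞ and every (0,1)-form f of class C¹ on B(R) ⊆ l¹ which is ∂̄-closed and Lipschitz continuous on B(R), there exists a continuously (real Fréchet) differentiable function u on B(ρR) with ∂̄u = f there and |u(z)| ≤ 2RQ·Δ(Q, z/(ρR))·(|f|₀ + R|f|₁) for all z ∈ B(ρR). -/

import Mathlib

open Set
open scoped ENNReal NNReal

noncomputable section

/-- `l¹`: the space of absolutely summable sequences of complex numbers. -/
abbrev L1 : Type := lp (fun _ : ℕ => ℂ) 1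

/-- `ℂ^N` equipped with the `l¹` norm. -/
abbrev EN (N : ℕ) : Type := PiLp 1 (fun _ : Fin N => ℂ)

/-- The `(0,1)`-part of the real Fréchet derivative of `u` at `z`, applied to `ξ`:
`∂̄u(z)(ξ) = (Du(z)(ξ) + i·Du(z)(iξ))/2`. -/
noncomputable def dbar {V : Type*} [NormedAddCommGroup V] [NormedSpace ℂ V]
    (u : V → ℂ) (z ξ : V) : ℂ :=
  (fderiv ℝ u z ξ + Complex.I * fderiv ℝ u z (Complex.I • ξ)) / 2

/-- `f` is a `(0,1)`-form of class `C^m` on `Ω`: each `f z` is (continuous) conjugate-linear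
and `(z,ξ) ↦ f z ξ` is `m` times continuously differentiable in the real sense on `Ω × V`. -/
def IsForm01 {V : Type*} [NormedAddCommGroup V] [NormedSpace ℂ V]
    (m : ℕ) (Ω : Set V) (f : V → V → ℂ) : Prop :=
  (∀ z ∈ Ω, ∀ ξ η : V, f z (ξ + η) = f z ξ + f z η) ∧
  (∀ z ∈ Ω, ∀ (a : ℂ) (ξ : V), f z (a • ξ) = (starRingEnd ℂ) a * f z ξ) ∧
  ContDiffOn ℝ m (fun p : V × V => f p.1 p.2) (Ω ×ˢ (univ : Set V))

/-- A `(0,1)`-form `f` is `∂̄`-closed on `Ω`. -/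
def DbarClosed {V : Type*} [NormedAddCommGroup V] [NormedSpace ℂ V]
    (Ω : Set V) (f : V → V → ℂ) : Prop :=
  ∀ z ∈ Ω, ∀ ξ η : V, dbar (fun w => f w ξ) z η = dbar (fun w => f w η) z ξ

/-- The set of values `‖f z ξ‖`, `z ∈ A`, `‖ξ‖ ≤ 1`; its sup is `|f|_{0,A}`. -/
def formSet0 {V : Type*} [NormedAddCommGroup V]
    (f : V → V → ℂ) (A : Set V) : Set ℝ :=
  {x | ∃ z ∈ A, ∃ ξ : V, ‖ξ‖ ≤ 1 ∧ x = ‖f z ξ‖}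

/-- The set of difference quotients `‖f z ξ - f w ξ‖/‖z-w‖`; its sup is `|f|_{1,A}`. -/
def formSet1 {V : Type*} [NormedAddCommGroup V]
    (f : V → V → ℂ) (A : Set V) : Set ℝ :=
  {x | ∃ z ∈ A, ∃ w ∈ A, z ≠ w ∧ ∃ ξ : V, ‖ξ‖ ≤ 1 ∧ x = ‖f z ξ - f w ξ‖ / ‖z - w‖}

/-- `|f|_{0,A}`. -/
noncomputable def formNorm0 {V : Type*} [NormedAddCommGroup V]
    (f : V → V → ℂ) (A : Set V) : ℝ := sSup (formSet0 f A)

/-- `|f|_{1,A}`. -/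
noncomputable def formNorm1 {V : Type*} [NormedAddCommGroup V]
    (f : V → V → ℂ) (A : Set V) : ℝ := sSup (formSet1 f A)

/-- `f` is Lipschitz continuous on `A`: `|f|_{0,A} < ∞` and `|f|_{1,A} < ∞`. -/
def LipschitzForm {V : Type*} [NormedAddCommGroup V]
    (f : V → V → ℂ) (A : Set V) : Prop :=
  BddAbove (formSet0 f A) ∧ BddAbove (formSet1 f A)

/-- `‖k‖ = ∑_ν k_ν` for a multiindex `k`. -/
def knormN (k : ℕ →₀ ℕ) : ℕ := k.sum fun _ m => m

/-- `k^k = ∏_ν k_ν^{k_ν}` (with `0^0 = 1`). -/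
noncomputable def kk (k : ℕ →₀ ℕ) : ℝ := ∏ ν ∈ k.support, (k ν : ℝ) ^ k ν

/-- `‖k‖^{‖k‖}` (with `0^0 = 1`). -/
noncomputable def nn (k : ℕ →₀ ℕ) : ℝ := ((knormN k : ℝ)) ^ knormN k

/-- The monomial `z^k = ∏_ν z_ν^{k_ν}` (with `0^0 = 1`). -/
noncomputable def monom (k : ℕ →₀ ℕ) (z : ℕ → ℂ) : ℂ := ∏ ν ∈ k.support, z ν ^ k ν

/-- The term of the series defining `Δ(q,z)` corresponding to the multiindex `k`:
`(‖k‖^{‖k‖}/k^k)·|q|^{#k}·|z^k|`. -/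
noncomputable def DeltaTerm (q : ℂ) (z : ℕ → ℂ) (k : ℕ →₀ ℕ) : ℝ :=
  (nn k / kk k) * ‖q‖ ^ k.support.card * ∏ ν ∈ k.support, ‖z ν‖ ^ k ν

/-- `Δ(q,z) = ∑_k (‖k‖^{‖k‖}/k^k)·|q|^{#k}·|z^k|`. -/
noncomputable def Delta (q : ℂ) (z : ℕ → ℂ) : ℝ := ∑' k, DeltaTerm q z k

set_option linter.all false

local notation "cj" => starRingEnd ℂ
local notation "rx" => Real.exp
local notation "rl" => Real.log
local notation "pπ" => Real.pi
local notation "pis" => Pi.single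
local notation "cx" => Complex.exp
local notation:max "Cv" ι:max => (ι → ℂ)

section Rec

variable {ι : Type} [Fintype ι] [DecidableEq ι]

def n1 (z : ι → ℂ) : ℝ := ∑ i, ‖z i‖

def sg (S : Finset ι) (k : ι → ℤ) : ℤ := ∑ i ∈ S, k i

def rot (S : Finset ι) (θ : ℝ) (z : ι → ℂ) : ι → ℂ :=
  fun i => if i ∈ S then cx (θ * Complex.I) * z i else z i

def sh (S : Finset ι) (x : ℝ) (ζ : ι → ℂ) : ι → ℂ :=
  fun i => if i ∈ S then ζ i + x else ζ i

def ex (ζ : ι → ℂ) : ι → ℂ := fun i => cx (ζ i)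

def pS (S : Finset ι) (ζ : ι → ℂ) : ℝ := ∑ i ∈ S, rx (ζ i).re

lemma n1_ex (ζ : ι → ℂ) : n1 (ex ζ) = pS Finset.univ ζ := by
  simp [n1, ex, pS, Complex.norm_exp]

def Bd (h : (ι → ℤ) → ι → Cv ι → ℂ) (K L : ℝ) (G : Finset (ι → ℤ)) : Prop :=
  (∀ z, n1 z < 1 → ∀ ν, ‖∑ k ∈ G, h k ν z‖ ≤ K) ∧
  (∀ z z', n1 z < 1 → n1 z' < 1 → ∀ ν,
    ‖∑ k ∈ G, h k ν z - ∑ k ∈ G, h k ν z'‖ ≤ L * n1 (z - z'))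

structure Sys (h : (ι → ℤ) → ι → Cv ι → ℂ) (U : (ι → ℤ) → Cv ι → ℂ) (K L : ℝ) : Prop where
  K0 : 0 ≤ K
  L0 : 0 ≤ L
  hom : ∀ k ν S (θ : ℝ) z, n1 z < 1 → h k ν (rot S θ z) =
    cx (((sg S k + if ν ∈ S then 1 else 0 : ℤ) : ℂ) * θ * Complex.I) * h k ν z
  der : ∀ k S (ζ : ι → ℂ) (x : ℝ), n1 (ex (sh S x ζ)) < 1 →
    HasDerivAt (fun x : ℝ => cx (-(sg S k : ℂ) * x) * U k (sh S x ζ))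
      (2 * cx (-(sg S k : ℂ) * x) *
        ∑ ν ∈ S, h k ν (ex (sh S x ζ)) * cj (cx (ζ ν + x))) x
  bU : ∀ k ζ, n1 (ex ζ) < 1 → ‖U k ζ‖ ≤ 4 * K

lemma norm_exp_I' (a : ℤ) (θ : ℝ) : ‖cx ((a : ℂ) * θ * Complex.I)‖ = 1 := by
  have : ((a : ℂ) * θ * Complex.I) = ((a * θ : ℝ) : ℂ) * Complex.I := by push_cast; ring
  rw [this, Complex.norm_exp_ofReal_mul_I]

lemma n1_rot (S : Finset ι) (θ : ℝ) (z : ι → ℂ) : n1 (rot S θ z) = n1 z := by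
  unfold n1 rot
  refine Finset.sum_congr rfl fun i _ => ?_
  split_ifs
  · rw [norm_mul, Complex.norm_exp_ofReal_mul_I, one_mul]
  · rfl

lemma rot_sub (S : Finset ι) (θ : ℝ) (z w : ι → ℂ) : rot S θ z - rot S θ w = rot S θ (z - w) := by
  funext i; simp only [rot, Pi.sub_apply]; split_ifs <;> ring

lemma avg_bound {α : Type} (G : Finset α) (s : α → ℤ) (v : α → ℂ) (C : ℝ) (j : ℤ)
    (hC : ∀ θ : ℝ, ‖∑ k ∈ G, cx ((s k : ℂ) * θ * Complex.I) * v k‖ ≤ C) :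
    ‖∑ k ∈ G with s k = j, v k‖ ≤ C := by
  obtain ⟨M, hM⟩ : ∃ M : ℕ, ∀ k ∈ G, |s k - j| < M := by
    refine ⟨(∑ k ∈ G, (s k - j).natAbs) + 1, fun k hk => ?_⟩
    have := Finset.single_le_sum (f := fun k => (s k - j).natAbs) (fun _ _ => Nat.zero_le _) hk
    rw [Int.abs_eq_natAbs]
    omega
  by_cases hG : G = ∅
  · subst hG; simpa using hC 0
  have hMpos : 0 < M := by
    obtain ⟨k, hk⟩ := Finset.nonempty_of_ne_empty hG
    have := hM k hk
    have := abs_nonneg (s k - j)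
    omega
  have hM0 : (M : ℂ) ≠ 0 := by exact_mod_cast hMpos.ne'
  have key : ∀ a : ℤ, |a| < M →
      ∑ r ∈ Finset.range M, cx ((a : ℂ) * ((2 * pπ * r / M : ℝ) : ℂ) * Complex.I)
        = if a = 0 then (M : ℂ) else 0 := by
    intro a ha
    split_ifs with h0
    · subst h0; simp
    · have hr : IsPrimitiveRoot (cx (2 * pπ * Complex.I / M)) M :=
        Complex.isPrimitiveRoot_exp M hMpos.ne'
      set w := cx (2 * pπ * Complex.I / M) with hw
      have h1 : ∀ r ∈ Finset.range M,
          cx ((a : ℂ) * ((2 * pπ * r / M : ℝ) : ℂ) * Complex.I) = (w ^ a) ^ r := by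
        intro r _
        rw [hw, ← Complex.exp_int_mul, ← Complex.exp_nat_mul]
        congr 1; push_cast; ring
      rw [Finset.sum_congr rfl h1]
      have hne : w ^ a ≠ 1 := by
        rw [Ne, hr.zpow_eq_one_iff_dvd]
        intro hd
        have := Int.le_of_dvd (abs_pos.mpr h0) ((dvd_abs _ _).mpr hd)
        omega
      rw [geom_sum_eq hne]
      have : (w ^ a) ^ M = 1 := by
        rw [← zpow_natCast, ← zpow_mul, mul_comm, zpow_mul, zpow_natCast, hr.pow_eq_one, one_zpow]
      simp [this]
  have h2 : (M : ℂ) * ∑ k ∈ G with s k = j, v k = ∑ r ∈ Finset.range M,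
      cx (((-j : ℤ) : ℂ) * ((2 * pπ * r / M : ℝ) : ℂ) * Complex.I) *
      ∑ k ∈ G, cx ((s k : ℂ) * ((2 * pπ * r / M : ℝ) : ℂ) * Complex.I) * v k := by
    simp_rw [Finset.mul_sum]
    rw [Finset.sum_comm, Finset.sum_filter]
    refine Finset.sum_congr rfl fun k hk => ?_
    have := key (s k - j) (hM k hk)
    have h3 : ∀ r ∈ Finset.range M,
        cx (((-j : ℤ) : ℂ) * ((2 * pπ * r / M : ℝ) : ℂ) * Complex.I) *
        (cx ((s k : ℂ) * ((2 * pπ * r / M : ℝ) : ℂ) * Complex.I) * v k) =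
        cx (((s k - j : ℤ) : ℂ) * ((2 * pπ * r / M : ℝ) : ℂ) * Complex.I) * v k := by
      intro r _
      rw [← mul_assoc, ← Complex.exp_add]
      congr 2; push_cast; ring
    rw [Finset.sum_congr rfl h3, ← Finset.sum_mul, this]
    by_cases h : s k = j
    · simp [h]
    · simp [h, sub_eq_zero]
  have h4 : (M : ℝ) * ‖∑ k ∈ G with s k = j, v k‖ ≤ M * C := by
    have : (M : ℝ) * ‖∑ k ∈ G with s k = j, v k‖ = ‖(M : ℂ) * ∑ k ∈ G with s k = j, v k‖ := by
      rw [norm_mul]; simp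
    rw [this, h2]
    refine (norm_sum_le _ _).trans ?_
    refine (Finset.sum_le_sum (g := fun _ => C) fun r _ => ?_).trans (by simp)
    rw [norm_mul, norm_exp_I', one_mul]
    exact hC _
  exact le_of_mul_le_mul_left h4 (by exact_mod_cast hMpos)

variable {h : (ι → ℤ) → ι → Cv ι → ℂ} {U : (ι → ℤ) → Cv ι → ℂ} {K L : ℝ}

lemma Sys.hom_sum (hS : Sys h U K L) (G : Finset (ι → ℤ)) (S : Finset ι) (ν : ι) (θ : ℝ)
    (z : ι → ℂ) (hz : n1 z < 1) :
    ∑ k ∈ G, cx ((sg S k : ℂ) * θ * Complex.I) * h k ν z =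
    cx (((-(if ν ∈ S then 1 else 0) : ℤ) : ℂ) * θ * Complex.I) *
      ∑ k ∈ G, h k ν (rot S θ z) := by
  rw [Finset.mul_sum]
  refine Finset.sum_congr rfl fun k _ => ?_
  rw [hS.hom k ν S θ z hz, ← mul_assoc, ← Complex.exp_add]
  congr 2; push_cast; ring

lemma Sys.bd_fiber (hS : Sys h U K L) {G : Finset (ι → ℤ)} (hG : Bd h K L G) (S : Finset ι)
    (j : ℤ) : Bd h K L (G.filter fun k => sg S k = j) := by
  refine ⟨fun z hz ν => ?_, fun z z' hz hz' ν => ?_⟩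
  · apply avg_bound
    intro θ
    rw [hS.hom_sum G S ν θ z hz, norm_mul, norm_exp_I', one_mul]
    exact hG.1 _ (by rwa [n1_rot]) _
  · rw [← Finset.sum_sub_distrib]
    apply avg_bound
    intro θ
    simp_rw [mul_sub]
    rw [Finset.sum_sub_distrib, hS.hom_sum G S ν θ z hz, hS.hom_sum G S ν θ z' hz', ← mul_sub,
      norm_mul, norm_exp_I', one_mul]
    have := hG.2 (rot S θ z) (rot S θ z') (by rwa [n1_rot]) (by rwa [n1_rot]) ν
    rwa [rot_sub, n1_rot] at this

lemma Sys.decay (hS : Sys h U K L) {G : Finset (ι → ℤ)} (hG : Bd h K L G) (S : Finset ι)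
    (j : ℤ) (hj : ∀ k ∈ G, sg S k = j) (hj1 : j ≠ -1) (ν : ι) (hν : ν ∈ S) (ζ : ι → ℂ)
    (hz : n1 (ex ζ) < 1) :
    ‖∑ k ∈ G, h k ν (ex ζ)‖ ≤ 2 * L * pS S ζ / |(j : ℝ) + 1| := by
  have hj0 : (j : ℝ) + 1 ≠ 0 := by
    intro h; apply hj1
    have : ((j + 1 : ℤ) : ℝ) = 0 := by push_cast; exact h
    have := Int.cast_eq_zero.mp this
    omega
  set α : ℝ := pπ / (j + 1) with hα
  have h1 : ∑ k ∈ G, h k ν (rot S α (ex ζ)) = - ∑ k ∈ G, h k ν (ex ζ) := by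
    rw [← Finset.sum_neg_distrib]
    refine Finset.sum_congr rfl fun k hk => ?_
    rw [hS.hom k ν S α _ hz, hj k hk, if_pos hν]
    have : ((j + 1 : ℤ) : ℂ) * α * Complex.I = pπ * Complex.I := by
      rw [hα]; push_cast
      have : (j : ℂ) + 1 ≠ 0 := by exact_mod_cast hj0
      field_simp
    rw [this, Complex.exp_pi_mul_I]; ring
  have h2 := hG.2 (rot S α (ex ζ)) (ex ζ) (by rwa [n1_rot]) hz ν
  rw [h1] at h2
  have h3 : n1 (rot S α (ex ζ) - ex ζ) ≤ |α| * pS S ζ := by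
    unfold n1 pS
    rw [Finset.mul_sum, ← Finset.sum_subset (Finset.subset_univ S)]
    · refine Finset.sum_le_sum fun i hi => ?_
      have : (rot S α (ex ζ) - ex ζ) i = (cx (α * Complex.I) - 1) * cx (ζ i) := by
        simp [rot, hi, ex]; ring
      rw [this, norm_mul, Complex.norm_exp (ζ i)]
      gcongr
      have := Real.norm_exp_I_mul_ofReal_sub_one_le (x := α)
      rw [mul_comm] at this
      simpa using this
    · intro i _ hi; simp [rot, hi]
  have h4 : ‖-∑ k ∈ G, h k ν (ex ζ) - ∑ k ∈ G, h k ν (ex ζ)‖ = 2 * ‖∑ k ∈ G, h k ν (ex ζ)‖ := by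
    rw [← neg_add', norm_neg, ← two_mul, norm_mul]; simp
  rw [h4] at h2
  have h5 : |α| = pπ / |(j : ℝ) + 1| := by rw [hα, abs_div, abs_of_pos Real.pi_pos]
  have hp : 0 ≤ pS S ζ := Finset.sum_nonneg fun i _ => (Real.exp_pos _).le
  have h6 : L * n1 (rot S α (ex ζ) - ex ζ) ≤ L * (|α| * pS S ζ) := by
    have := hS.L0; gcongr
  have h7 : |α| ≤ 4 / |(j : ℝ) + 1| := by rw [h5]; gcongr; exact Real.pi_le_four
  have h8 : L * (|α| * pS S ζ) ≤ L * (4 / |(j : ℝ) + 1| * pS S ζ) := by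
    have := hS.L0; gcongr
  have : 2 * L * pS S ζ / |(j : ℝ) + 1| = (L * (4 / |(j : ℝ) + 1| * pS S ζ)) / 2 := by ring
  rw [this]; linarith

end Rec

section Rec2

variable {ι : Type} [Fintype ι] [DecidableEq ι]
variable {h : (ι → ℤ) → ι → Cv ι → ℂ} {U : (ι → ℤ) → Cv ι → ℂ} {K L : ℝ}

lemma cmp_deriv {ψ ψ' : ℝ → ℂ} {Φ Φ' : ℝ → ℝ} {a b : ℝ} (hab : a ≤ b)
    (h1 : ∀ x ∈ Icc a b, HasDerivAt ψ (ψ' x) x) (h2 : ∀ x ∈ Icc a b, HasDerivAt Φ (Φ' x) x)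
    (h3 : ∀ x ∈ Icc a b, ‖ψ' x‖ ≤ Φ' x) : ‖ψ b - ψ a‖ ≤ Φ b - Φ a := by
  have := image_norm_le_of_norm_deriv_right_le_deriv_boundary' (f := fun x => ψ x - ψ a)
    (f' := ψ') (a := a) (b := b) (B := fun x => Φ x - Φ a) (B' := Φ')
    (fun x hx => ((h1 x hx).continuousAt.continuousWithinAt).sub continuousWithinAt_const)
    (fun x hx => ((h1 x (Ico_subset_Icc_self hx)).sub_const _).hasDerivWithinAt)
    (by simp)
    (fun x hx => ((h2 x hx).continuousAt.continuousWithinAt).sub continuousWithinAt_const)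
    (fun x hx => ((h2 x (Ico_subset_Icc_self hx)).sub_const _).hasDerivWithinAt)
    (fun x hx => h3 x (Ico_subset_Icc_self hx))
  exact this (right_mem_Icc.mpr hab)

lemma pS_nonneg (S : Finset ι) (ζ : ι → ℂ) : 0 ≤ pS S ζ :=
  Finset.sum_nonneg fun _ _ => (Real.exp_pos _).le

lemma pS_mono {S T : Finset ι} (hST : S ⊆ T) (ζ : ι → ℂ) : pS S ζ ≤ pS T ζ :=
  Finset.sum_le_sum_of_subset_of_nonneg hST fun _ _ _ => (Real.exp_pos _).le

lemma pS_le_n1 (S : Finset ι) (ζ : ι → ℂ) : pS S ζ ≤ n1 (ex ζ) := by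
  rw [n1_ex]; exact pS_mono (Finset.subset_univ _) _

lemma pS_sh (S : Finset ι) (x : ℝ) (ζ : ι → ℂ) : pS S (sh S x ζ) = rx x * pS S ζ := by
  unfold pS; rw [Finset.mul_sum]
  refine Finset.sum_congr rfl fun i hi => ?_
  simp [sh, hi, Real.exp_add]; ring

lemma pS_sh_disj {S T : Finset ι} (hd : Disjoint S T) (x : ℝ) (ζ : ι → ℂ) :
    pS T (sh S x ζ) = pS T ζ := by
  unfold pS
  refine Finset.sum_congr rfl fun i hi => ?_
  simp [sh, Finset.disjoint_right.mp hd hi]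

lemma n1_split (S : Finset ι) (ζ : ι → ℂ) : n1 (ex ζ) = pS S ζ + pS Sᶜ ζ := by
  rw [n1_ex]; unfold pS; exact (Finset.sum_add_sum_compl S _).symm

lemma n1_sh (S : Finset ι) (x : ℝ) (ζ : ι → ℂ) :
    n1 (ex (sh S x ζ)) = rx x * pS S ζ + pS Sᶜ ζ := by
  rw [n1_split S, pS_sh, pS_sh_disj disjoint_compl_right]

lemma n1_sh_mono (S : Finset ι) {x y : ℝ} (hxy : x ≤ y) (ζ : ι → ℂ) :
    n1 (ex (sh S x ζ)) ≤ n1 (ex (sh S y ζ)) := by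
  rw [n1_sh, n1_sh]
  have := pS_nonneg S ζ
  gcongr

lemma sh_zero (S : Finset ι) (ζ : ι → ℂ) : sh S 0 ζ = ζ := by
  funext i; simp [sh]

lemma Sys.flow (hS : Sys h U K L) {G : Finset (ι → ℤ)} (S : Finset ι) (j : ℤ)
    (hj : ∀ k ∈ G, sg S k = j) (ζ : ι → ℂ) {a b : ℝ} (hab : a ≤ b)
    (hb : n1 (ex (sh S b ζ)) < 1) (Hf Φ : ℝ → ℝ)
    (hH : ∀ x ∈ Icc a b, ∀ ν ∈ S, ‖∑ k ∈ G, h k ν (ex (sh S x ζ))‖ ≤ Hf x)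
    (hΦ : ∀ x ∈ Icc a b, HasDerivAt Φ (2 * Hf x * pS S ζ * rx ((1 - j) * x)) x) :
    ‖cx (-(j : ℂ) * b) * ∑ k ∈ G, U k (sh S b ζ) -
      cx (-(j : ℂ) * a) * ∑ k ∈ G, U k (sh S a ζ)‖ ≤ Φ b - Φ a := by
  refine cmp_deriv (ψ := fun x : ℝ => cx (-(j : ℂ) * x) * ∑ k ∈ G, U k (sh S x ζ))
    (ψ' := fun x : ℝ => ∑ k ∈ G, (2 * cx (-(j : ℂ) * x) *
        ∑ ν ∈ S, h k ν (ex (sh S x ζ)) * cj (cx (ζ ν + x)))) hab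
    (fun x hx => ?_) hΦ (fun x hx => ?_)
  · simp_rw [Finset.mul_sum G]
    refine HasDerivAt.fun_sum fun k hk => ?_
    have := hS.der k S ζ x ((n1_sh_mono S hx.2 ζ).trans_lt hb)
    rwa [hj k hk] at this
  · have e1 : ∑ k ∈ G, (2 * cx (-(j : ℂ) * x) *
        ∑ ν ∈ S, h k ν (ex (sh S x ζ)) * cj (cx (ζ ν + x))) =
        2 * cx (-(j : ℂ) * x) * ∑ ν ∈ S, (∑ k ∈ G, h k ν (ex (sh S x ζ))) *
          cj (cx (ζ ν + x)) := by
      rw [← Finset.mul_sum, Finset.sum_comm]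
      simp_rw [Finset.sum_mul]
    rw [e1, norm_mul, norm_mul, Complex.norm_exp]
    have e2 : ‖∑ ν ∈ S, (∑ k ∈ G, h k ν (ex (sh S x ζ))) *
          cj (cx (ζ ν + x))‖ ≤ Hf x * (rx x * pS S ζ) := by
      refine (norm_sum_le _ _).trans ?_
      unfold pS
      rw [Finset.mul_sum, Finset.mul_sum]
      refine Finset.sum_le_sum fun ν hν => ?_
      rw [norm_mul, RCLike.norm_conj, Complex.norm_exp]
      have e3 : rx (ζ ν + x).re = rx x * rx (ζ ν).re := by
        rw [← Real.exp_add]; simp; ring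
      rw [e3]
      exact mul_le_mul_of_nonneg_right (hH x hx ν hν) (by positivity)
    have e4 : (-(j : ℂ) * x).re = -j * x := by simp
    rw [e4]
    have e5 : rx ((1 - j) * x) = rx (-j * x) * rx x := by
      rw [← Real.exp_add]; congr 1; ring
    rw [e5]
    calc ‖(2:ℂ)‖ * rx (-j * x) * _ ≤ 2 * rx (-j * x) * (Hf x * (rx x * pS S ζ)) := by
          simp only [Complex.norm_ofNat]; gcongr
      _ = _ := by ring

lemma Sys.Dminus (hS : Sys h U K L) {G : Finset (ι → ℤ)} (hG : Bd h K L G) (S : Finset ι) (j : ℤ)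
    (hj : ∀ k ∈ G, sg S k = j) (hj1 : j ≤ -1) (ζ : ι → ℂ) (hz : n1 (ex ζ) < 1) :
    ‖∑ k ∈ G, U k ζ‖ ≤ 8 * (K + L) * pS S ζ / (j : ℝ) ^ 2 := by
  have hK := hS.K0
  have hL := hS.L0
  have hp := pS_nonneg S ζ
  have hjr : (j : ℝ) ≤ -1 := by exact_mod_cast hj1
  have main : ∀ H : ℝ, (∀ x ≤ (0:ℝ), ∀ ν ∈ S, ‖∑ k ∈ G, h k ν (ex (sh S x ζ))‖ ≤ H) → 0 ≤ H →
      ‖∑ k ∈ G, U k ζ‖ ≤ 2 * H * pS S ζ / (1 - j) := by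
    intro H hH hH0
    have h1 : ∀ a ≤ (0:ℝ), ‖∑ k ∈ G, U k ζ‖ ≤
        rx (-j * a) * (G.card * (4 * K)) + 2 * H * pS S ζ / (1 - j) := by
      intro a ha
      have := hS.flow S j hj ζ ha (by rwa [sh_zero]) (fun _ => H)
        (fun x => 2 * H * pS S ζ / (1 - j) * rx ((1 - j) * x))
        (fun x hx => hH x hx.2) (fun x _ => by
          have h2 : HasDerivAt (fun x : ℝ => (1 - (j:ℝ)) * x) (1 - j) x := by
            simpa using (hasDerivAt_id x).const_mul (1 - (j : ℝ))
          have h3 := h2.exp.const_mul (2 * H * pS S ζ / (1 - j))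
          refine h3.congr_deriv ?_
          have : (1 - (j : ℝ)) ≠ 0 := by linarith
          field_simp)
      rw [sh_zero] at this
      simp only [Complex.ofReal_zero, mul_zero, Complex.exp_zero, one_mul, Real.exp_zero, mul_one]
        at this
      have h4 : ‖cx (-(j : ℂ) * a) * ∑ k ∈ G, U k (sh S a ζ)‖ ≤
          rx (-j * a) * (G.card * (4 * K)) := by
        rw [norm_mul, Complex.norm_exp]
        have e4 : (-(j : ℂ) * a).re = -j * a := by simp
        rw [e4]
        gcongr
        refine (norm_sum_le _ _).trans ?_
        refine (Finset.sum_le_sum (g := fun _ => 4 * K) fun k _ => ?_).trans (by simp)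
        apply hS.bU
        have := n1_sh_mono S ha ζ
        rw [sh_zero] at this
        linarith
      have h5 := norm_sub_norm_le (∑ k ∈ G, U k ζ) (cx (-(j : ℂ) * a) * ∑ k ∈ G, U k (sh S a ζ))
      have h6 : 0 ≤ 2 * H * pS S ζ / (1 - j) * rx ((1 - j) * a) := by
        have : 0 ≤ 1 - (j:ℝ) := by linarith
        positivity
      linarith
    have h2 : Filter.Tendsto (fun a : ℝ => rx (-j * a) * (G.card * (4 * K)) + 2 * H * pS S ζ / (1 - j))
        Filter.atBot (nhds (0 * (G.card * (4 * K)) + 2 * H * pS S ζ / (1 - j))) := by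
      refine (Filter.Tendsto.mul_const _ ?_).add_const _
      refine Real.tendsto_exp_atBot.comp ?_
      exact Filter.Tendsto.const_mul_atBot (by linarith) Filter.tendsto_id
    have h3 := ge_of_tendsto h2 (Filter.eventually_atBot.mpr ⟨0, fun a ha => h1 a ha⟩)
    simpa using h3
  have hn : ∀ x ≤ (0:ℝ), n1 (ex (sh S x ζ)) < 1 := fun x hx => by
    have := n1_sh_mono S hx ζ
    rw [sh_zero] at this
    linarith
  by_cases hj2 : j = -1
  · have := main K (fun x hx ν _ => hG.1 _ (hn x hx) ν) hK
    refine this.trans ?_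
    subst hj2
    push_cast
    have : 0 ≤ L * pS S ζ := by positivity
    have : 0 ≤ K * pS S ζ := by positivity
    norm_num
    nlinarith
  · have hj3 : (j : ℝ) ≤ -2 := by
      have : j ≤ -2 := by omega
      exact_mod_cast this
    have habs : |(j : ℝ) + 1| = -j - 1 := by rw [abs_of_neg (by linarith)]; ring
    have := main (2 * L / (-j - 1)) (fun x hx ν hν => by
      have := hS.decay hG S j hj hj2 ν hν _ (hn x hx)
      rw [habs] at this
      refine this.trans ?_
      have h1 : pS S (sh S x ζ) ≤ 1 := (pS_le_n1 _ _).trans (hn x hx).le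
      have : 0 < -(j:ℝ) - 1 := by linarith
      rw [div_le_div_iff_of_pos_right this]
      nlinarith [pS_nonneg S (sh S x ζ)]) (by
        have : 0 < -(j:ℝ) - 1 := by linarith
        positivity)
    refine this.trans ?_
    have e : 2 * (2 * L / (-(j:ℝ) - 1)) * pS S ζ / (1 - j) = (L * pS S ζ) * (4 / ((-(j:ℝ) - 1) * (1 - j))) := by
      have : (-(j:ℝ) - 1) ≠ 0 := by linarith
      have : (1 - (j:ℝ)) ≠ 0 := by linarith
      field_simp; ring
    have e2 : 4 / ((-(j:ℝ) - 1) * (1 - j)) ≤ 8 / (j:ℝ) ^ 2 := by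
      rw [div_le_div_iff₀ (by nlinarith) (by nlinarith)]
      nlinarith
    calc _ ≤ (L * pS S ζ) * (8 / (j:ℝ) ^ 2) := by rw [e]; gcongr
      _ ≤ ((K + L) * pS S ζ) * (8 / (j:ℝ) ^ 2) := by gcongr; linarith
      _ = _ := by ring

lemma Sys.Dplus (hS : Sys h U K L) {G : Finset (ι → ℤ)} (hG : Bd h K L G) (S : Finset ι) (j : ℤ)
    (hj : ∀ k ∈ G, sg S k = j) (hj1 : 1 ≤ j) (ζ : ι → ℂ) (hz : n1 (ex ζ) < 1) (y : ℝ)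
    (hy : n1 (ex (sh S y ζ)) < 1) :
    ‖∑ k ∈ G, U k ζ‖ ≤ rx (-j * y) * (‖∑ k ∈ G, U k (sh S y ζ)‖ + 2 * (K + L) * pS S ζ)
      + 12 * (K + L) * pS S ζ / (j : ℝ) ^ 2 := by
  have hK := hS.K0
  have hL := hS.L0
  have hp := pS_nonneg S ζ
  have hjr : (1:ℝ) ≤ j := by exact_mod_cast hj1
  have hj0 : (0:ℝ) < j := by linarith
  have red : ∀ X : ℝ, ‖cx (-(j : ℂ) * y) * ∑ k ∈ G, U k (sh S y ζ) -
      ∑ k ∈ G, U k ζ‖ ≤ X → X ≤ rx (-j * y) * (2 * (K + L) * pS S ζ)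
      + 12 * (K + L) * pS S ζ / (j : ℝ) ^ 2 → ‖∑ k ∈ G, U k ζ‖ ≤ rx (-j * y) * (‖∑ k ∈ G, U k (sh S y ζ)‖ + 2 * (K + L) * pS S ζ)
      + 12 * (K + L) * pS S ζ / (j : ℝ) ^ 2 := by
    intro X h1 h2
    rw [norm_sub_rev] at h1
    have h3 := norm_sub_norm_le (∑ k ∈ G, U k ζ) (cx (-(j : ℂ) * y) * ∑ k ∈ G, U k (sh S y ζ))
    have e4 : (-(j : ℂ) * y).re = -j * y := by simp
    rw [norm_mul, Complex.norm_exp, e4] at h3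
    linarith
  have hexp : ∀ (c d x : ℝ), c ≠ 0 → HasDerivAt (fun x : ℝ => d / c * rx (c * x)) (d * rx (c * x)) x := by
    intro c d x hc
    have h2 : HasDerivAt (fun x : ℝ => c * x) c x := by
      simpa using (hasDerivAt_id x).const_mul c
    have h3 := h2.exp.const_mul (d / c)
    refine h3.congr_deriv ?_
    field_simp
  have hn : ∀ x ≤ y, n1 (ex (sh S x ζ)) < 1 := fun x hx => (n1_sh_mono S hx ζ).trans_lt hy
  have habs : |(j : ℝ) + 1| = j + 1 := abs_of_pos (by linarith)
  rcases le_total y 0 with hy0 | hy0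
  · -- downward
    have hn : ∀ x ≤ (0:ℝ), n1 (ex (sh S x ζ)) < 1 := fun x hx => by
      have := n1_sh_mono S hx ζ
      rw [sh_zero] at this
      linarith
    have := hS.flow S j hj ζ hy0 (by rwa [sh_zero]) (fun x => K * rx (-x))
      (fun x => (2 * K * pS S ζ) / (-j) * rx (-j * x)) (fun x hx ν _ => by
        refine (hG.1 _ (hn x hx.2) ν).trans ?_
        have : 1 ≤ rx (-x) := Real.one_le_exp (by linarith [hx.2])
        nlinarith) (fun x _ => by
        convert hexp (-j) (2 * K * pS S ζ) x (by linarith) using 1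
        have : rx (-j * x) = rx (-x) * rx ((1 - j) * x) := by
          rw [← Real.exp_add]; congr 1; ring
        rw [this]; ring)
    rw [sh_zero, norm_sub_rev] at this
    simp only [Complex.ofReal_zero, mul_zero, Complex.exp_zero, one_mul, Real.exp_zero, mul_one]
      at this
    refine red _ this ?_
    have e1 : 2 * K * pS S ζ / -(j:ℝ) - 2 * K * pS S ζ / -j * rx (-j * y) =
      (2 * K * pS S ζ) / j * (rx (-j * y) - 1) := by ring
    have e2 : (2 * K * pS S ζ) / j ≤ 2 * (K + L) * pS S ζ := by
      refine (div_le_self (by positivity) hjr).trans ?_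
      gcongr; linarith
    rw [e1]
    have e3 : 1 ≤ rx (-j * y) := Real.one_le_exp (by nlinarith)
    have e4 : (0:ℝ) ≤ (2 * K * pS S ζ) / j := by positivity
    have e5 : 0 ≤ 12 * (K + L) * pS S ζ / (j : ℝ) ^ 2 := by positivity
    nlinarith
  · rcases eq_or_lt_of_le hj1 with hj2 | hj2
    · subst hj2
      have := hS.flow S 1 hj ζ hy0 hy (fun x => L * pS S ζ * rx x)
        (fun x => (2 * L * pS S ζ ^ 2) / 1 * rx (1 * x)) (fun x hx ν hν => by
          have := hS.decay hG S 1 hj (by norm_num) ν hν _ (hn x hx.2)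
          rw [habs, pS_sh] at this
          push_cast at this
          norm_num at this
          linarith) (fun x _ => by
          convert hexp 1 (2 * L * pS S ζ ^ 2) x one_ne_zero using 1
          push_cast
          simp only [sub_self, zero_mul, Real.exp_zero, one_mul]; ring)
      rw [sh_zero] at this
      simp only [Complex.ofReal_zero, mul_zero, Complex.exp_zero, one_mul, Real.exp_zero, mul_one]
        at this
      refine red _ this ?_
      have e1 : rx y * pS S ζ ≤ 1 := by
        rw [← pS_sh]; exact (pS_le_n1 _ _).trans hy.le
      have e5 : 0 ≤ rx (-((1:ℤ):ℝ) * y) * (2 * (K + L) * pS S ζ) := by positivity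
      have e2 : L * pS S ζ * (rx y * pS S ζ) ≤ L * pS S ζ * 1 := by gcongr
      have e3 : 0 ≤ L * pS S ζ := by positivity
      have e4 : 0 ≤ K * pS S ζ := by positivity
      have e6 : 0 ≤ L * pS S ζ ^ 2 := by positivity
      push_cast at e5 ⊢
      norm_num at e5 ⊢
      nlinarith
    · have hj3 : (2:ℝ) ≤ j := by exact_mod_cast hj2
      have := hS.flow S j hj ζ hy0 hy (fun x => 2 * L / (j + 1))
        (fun x => (4 * L * pS S ζ / (j + 1)) / (1 - j) * rx ((1 - j) * x)) (fun x hx ν hν => by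
          have := hS.decay hG S j hj (by omega) ν hν _ (hn x hx.2)
          rw [habs] at this
          refine this.trans ?_
          have h1 : pS S (sh S x ζ) ≤ 1 := (pS_le_n1 _ _).trans (hn x hx.2).le
          rw [div_le_div_iff_of_pos_right (by linarith)]
          nlinarith [pS_nonneg S (sh S x ζ)]) (fun x _ => by
          convert hexp (1 - j) (4 * L * pS S ζ / (j + 1)) x (by linarith) using 1
          ring)
      rw [sh_zero] at this
      simp only [Complex.ofReal_zero, mul_zero, Complex.exp_zero, one_mul, Real.exp_zero, mul_one]
        at this
      refine red _ this ?_
      have e1 : 4 * L * pS S ζ / (j + 1) / (1 - j) * rx ((1 - j) * y) - 4 * L * pS S ζ / (j + 1) / (1 - j)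
        = (L * pS S ζ) * (4 / ((j + 1) * (j - 1))) * (1 - rx ((1 - j) * y)) := by
        have : (j:ℝ) - 1 ≠ 0 := by linarith
        have : 1 - (j:ℝ) ≠ 0 := by linarith
        field_simp; ring
      rw [e1]
      have e2 : 4 / (((j:ℝ) + 1) * (j - 1)) ≤ 12 / (j:ℝ) ^ 2 := by
        rw [div_le_div_iff₀ (by nlinarith) (by nlinarith)]
        nlinarith
      have e3 : 0 ≤ 4 / (((j:ℝ) + 1) * (j - 1)) := by
        have : 0 < (j:ℝ) - 1 := by linarith
        positivity
      have e4 : 0 ≤ rx ((1 - j) * y) := (Real.exp_pos _).le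
      calc (L * pS S ζ) * (4 / ((j + 1) * (j - 1))) * (1 - rx ((1 - j) * y))
          ≤ (L * pS S ζ) * (4 / ((j + 1) * (j - 1))) * 1 := by gcongr; linarith
        _ ≤ (L * pS S ζ) * (12 / (j:ℝ) ^ 2) := by rw [mul_one]; gcongr
        _ ≤ ((K + L) * pS S ζ) * (12 / (j:ℝ) ^ 2) := by gcongr; linarith
        _ = 12 * (K + L) * pS S ζ / (j : ℝ) ^ 2 := by ring
        _ ≤ _ := by
          have : 0 ≤ rx (-j * y) * (2 * (K + L) * pS S ζ) := by positivity
          linarith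

end Rec2

lemma hasSum_inv_sq : HasSum (fun n : ℕ => 1 / ((n : ℝ) + 1) ^ 2) (pπ ^ 2 / 6) := by
  have := (hasSum_nat_add_iff' 1).mpr hasSum_zeta_two
  simpa using this

lemma zeta_two_le : pπ ^ 2 / 6 ≤ 2 := by
  have := Real.pi_lt_d2
  have := Real.pi_pos
  nlinarith

lemma hasSum_exp_sub (x : ℝ) :
    HasSum (fun n : ℕ => x ^ (n + 1) / ((n + 1).factorial : ℝ)) (rx x - 1) := by
  have h := NormedSpace.expSeries_div_hasSum_exp x
  rw [← Real.exp_eq_exp_ℝ] at h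
  have := (hasSum_nat_add_iff' 1).mpr h
  simpa using this

lemma hasSum_geo_one {x : ℝ} (h0 : 0 ≤ x) (h1 : x < 1) :
    HasSum (fun n : ℕ => x ^ (n + 1)) (x / (1 - x)) := by
  have := (hasSum_geometric_of_lt_one h0 h1).mul_left x
  simpa [pow_succ, mul_comm, div_eq_mul_inv] using this

section Rec3

variable {ι : Type} [Fintype ι] [DecidableEq ι]
variable {h : (ι → ℤ) → ι → Cv ι → ℂ} {U : (ι → ℤ) → Cv ι → ℂ} {K L : ℝ}

lemma split_bound {α : Type} (G : Finset α) (s : α → ℤ) (v : α → ℂ) (A A0 p : ℝ) (P : ℕ → ℝ)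
    (hneg : ∀ j : ℤ, j ≤ -1 → ‖∑ k ∈ G with s k = j, v k‖ ≤ A / (j : ℝ) ^ 2)
    (h0 : ‖∑ k ∈ G with s k = 0, v k‖ ≤ A0)
    (hpos : ∀ i : ℕ, ‖∑ k ∈ G with s k = ((i + 1 : ℕ) : ℤ), v k‖ ≤ P i) (hP : HasSum P p) :
    ‖∑ k ∈ G, v k‖ ≤ 2 * A + A0 + p := by
  have hA : 0 ≤ A := by
    have := (norm_nonneg _).trans (hneg (-1) le_rfl)
    simpa using this
  rw [← Finset.sum_fiberwise_of_maps_to (s := G) (t := G.image s) (g := s)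
    (fun x hx => Finset.mem_image_of_mem _ hx)]
  refine (norm_sum_le _ _).trans ?_
  set M : ℤ → ℝ := Int.rec (fun n => Nat.rec A0 (fun i _ => P i) n) (fun n => A * (1 / ((n : ℝ) + 1) ^ 2)) with hM
  have hMs : HasSum M ((p + A0) + A * (pπ ^ 2 / 6)) := by
    refine HasSum.int_rec ?_ (hasSum_inv_sq.mul_left A)
    have : HasSum (fun n : ℕ => (Nat.rec A0 (fun i _ => P i) (n + 1) : ℝ)) p := hP
    have h2 := (hasSum_nat_add_iff (f := fun n : ℕ => (Nat.rec A0 (fun i _ => P i) n : ℝ)) 1).mp this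
    simpa using h2
  have hle : ∀ j, ‖∑ k ∈ G with s k = j, v k‖ ≤ M j := by
    intro j
    match j with
    | Int.ofNat 0 => exact h0
    | Int.ofNat (i + 1) => exact hpos i
    | Int.negSucc n =>
      have := hneg (Int.negSucc n) (by omega)
      refine this.trans (le_of_eq ?_)
      change A / ((Int.negSucc n : ℤ) : ℝ) ^ 2 = A * (1 / ((n : ℝ) + 1) ^ 2)
      rw [Int.cast_negSucc]
      push_cast
      rw [neg_sq]; ring
  have hnn : ∀ j, 0 ≤ M j := fun j => (norm_nonneg _).trans (hle j)
  calc _ ≤ ∑ j ∈ G.image s, M j := Finset.sum_le_sum fun j _ => hle j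
    _ ≤ (p + A0) + A * (pπ ^ 2 / 6) := sum_le_hasSum _ (fun j _ => hnn j) hMs
    _ ≤ _ := by
      have := zeta_two_le
      nlinarith

lemma sg_insert {T : Finset ι} {ν : ι} (hν : ν ∉ T) (k : ι → ℤ) :
    sg (insert ν T) k = k ν + sg T k := Finset.sum_insert hν

lemma sg_single (ν : ι) (k : ι → ℤ) : sg {ν} k = k ν := Finset.sum_singleton _ _

lemma pS_single (ν : ι) (ζ : ι → ℂ) : pS {ν} ζ = rx (ζ ν).re := Finset.sum_singleton _ _

lemma pS_insert {T : Finset ι} {ν : ι} (hν : ν ∉ T) (ζ : ι → ℂ) :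
    pS (insert ν T) ζ = rx (ζ ν).re + pS T ζ := Finset.sum_insert hν

lemma n1_move (ν : ι) (r : ℝ) (hr : 0 < r) (ζ : ι → ℂ) :
    n1 (ex (sh {ν} (rl r - (ζ ν).re) ζ)) ≤ n1 (ex ζ) + r := by
  rw [n1_sh, n1_split {ν}, pS_single, Real.exp_sub, Real.exp_log hr,
    div_mul_cancel₀ _ (Real.exp_pos _).ne']
  have := Real.exp_pos (ζ ν).re
  linarith

lemma exp_move (a r : ℝ) (hr : 0 < r) (i : ℕ) :
    rx (-((i : ℤ) : ℝ) * (rl r - a)) = (rx a / r) ^ i := by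
  have : rx a / r = rx (-(rl r - a)) := by
    rw [neg_sub, Real.exp_sub, Real.exp_log hr]
  rw [this, ← Real.exp_nat_mul]
  congr 1; push_cast; ring

lemma tail_arith {B E y X q z e : ℝ} (hB0 : 0 ≤ B) (hy0 : 0 ≤ y) (e3 : 60 * B ≤ E) (hX1 : 1 ≤ X)
    (e1 : q ≤ 2 * y) (e2 : z ≤ 2) (e5 : 1 + y ≤ e) :
    2 * (8 * B * y) + E + ((X - 1) * (E + 2 * B) + (q * (10 * B) + 12 * B * y * z)) ≤
      E * (X ^ 2 * e) := by
  have hX2 : 1 ≤ X ^ 2 := by nlinarith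
  have e6 : X ^ 2 + y ≤ X ^ 2 * e := by
    have : X ^ 2 * (1 + y) ≤ X ^ 2 * e := by gcongr
    nlinarith
  have e7 : 1 + 2 * (X - 1) ≤ X ^ 2 := by nlinarith [sq_nonneg (X - 1)]
  have hE0 : 0 ≤ E := by linarith
  have f1 : (X - 1) * (E + 2 * B) ≤ (X - 1) * (2 * E) := by
    apply mul_le_mul_of_nonneg_left _ (by linarith); linarith
  have f2 : q * (10 * B) ≤ 2 * y * (10 * B) := by gcongr
  have f3 : 12 * B * y * z ≤ 12 * B * y * 2 := by gcongr
  have f4 : 60 * B * y ≤ E * y := by gcongr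
  have f5 : E * (1 + 2 * (X - 1) + y) ≤ E * (X ^ 2 * e) := by
    apply mul_le_mul_of_nonneg_left _ hE0; linarith
  linarith

set_option maxHeartbeats 1000000 in
lemma Sys.tail (hS : Sys h U K L) (δ : ℝ) (hδ : 0 < δ) (hδ1 : δ ≤ 1) (n : ℕ) (hn : 1 ≤ n)
    (T : Finset ι) : ∀ (G : Finset (ι → ℤ)) (m : ℕ), m ≤ n → Bd h K L G →
    (∀ k ∈ G, ∀ k' ∈ G, ∀ i, i ∉ T → k i = k' i) → (∀ k ∈ G, sg T k = m) → ∀ ζ : ι → ℂ,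
    n1 (ex ζ) + δ * m / n + δ < 1 → (∀ i ∈ T, rx (ζ i).re ≤ δ / 2) →
    ‖∑ k ∈ G, U k ζ‖ ≤ 60 * (K + L) * rx ((2 * n + 1) * (pS T ζ / δ)) := by
  have hK := hS.K0
  have hL := hS.L0
  have hn0 : (0:ℝ) < n := by exact_mod_cast hn
  induction T using Finset.induction_on with
  | empty =>
    intro G m hm hG hagree hsg ζ hroom hy
    have hpos : 0 ≤ δ * m / n := by positivity
    have hc : ∀ k ∈ G, ∀ k' ∈ G, k = k' := fun k hk k' hk' => funext fun i => hagree k hk k' hk' i (by simp)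
    have : ‖∑ k ∈ G, U k ζ‖ ≤ 4 * K := by
      rcases G.eq_empty_or_nonempty with h0 | ⟨k, hk⟩
      · subst h0; simp; linarith
      · have : G = {k} := Finset.eq_singleton_iff_unique_mem.mpr ⟨hk, fun k' hk' => hc k' hk' k hk⟩
        rw [this, Finset.sum_singleton]
        exact hS.bU k ζ (by linarith)
    refine this.trans ?_
    simp [pS]; linarith
  | insert ν T hν ih =>
    intro G m hm hG hagree hsg ζ hroom hy
    set B := K + L with hB
    have hB0 : 0 ≤ B := by positivity
    set y := rx (ζ ν).re / δ with hydef
    have hy0 : 0 < y := by positivity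
    have hr : rx (ζ ν).re = δ * y := by rw [hydef]; field_simp
    have hy2 : y ≤ 1 / 2 := by
      have := hy ν (Finset.mem_insert_self _ _)
      rw [hydef, div_le_iff₀ hδ]; linarith
    set Y := pS T ζ / δ with hY
    have hY0 : 0 ≤ Y := div_nonneg (pS_nonneg _ _) hδ.le
    set E := 60 * B * rx ((2 * n + 1) * Y) with hE
    have hpos : 0 ≤ δ * m / n := by positivity
    have hz : n1 (ex ζ) < 1 := by linarith
    have hry : rx (ζ ν).re ≤ y := by rw [hr]; nlinarith
    have hdis : Disjoint ({ν} : Finset ι) T := Finset.disjoint_singleton_left.mpr hν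
    have agree' : ∀ j : ℤ, ∀ k ∈ G.filter (fun k => sg {ν} k = j),
        ∀ k' ∈ G.filter (fun k => sg {ν} k = j), ∀ i, i ∉ T → k i = k' i := by
      intro j k hk k' hk' i hi
      rw [Finset.mem_filter, sg_single] at hk hk'
      by_cases hiν : i = ν
      · rw [hiν, hk.2, hk'.2]
      · exact hagree k hk.1 k' hk'.1 i (by simp [hiν, hi])
    have sgT : ∀ j : ℤ, ∀ k ∈ G.filter (fun k => sg {ν} k = j), sg T k = m - j := by
      intro j k hk
      rw [Finset.mem_filter, sg_single] at hk
      have := hsg k hk.1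
      rw [sg_insert hν] at this
      omega
    have fil : ∀ j : ℤ, ∀ k ∈ G.filter (fun k => sg {ν} k = j), sg {ν} k = j :=
      fun j k hk => (Finset.mem_filter.mp hk).2
    have hsum : HasSum (fun i : ℕ => (n * y) ^ (i + 1) / ((i + 1).factorial : ℝ) * (E + 2 * B)
        + (y ^ (i + 1) * (10 * B) + 12 * B * y * (1 / ((i : ℝ) + 1) ^ 2)))
        ((rx (n * y) - 1) * (E + 2 * B) + (y / (1 - y) * (10 * B) + 12 * B * y * (pπ ^ 2 / 6))) :=
      ((hasSum_exp_sub _).mul_right _).add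
        (((hasSum_geo_one hy0.le (by linarith)).mul_right _).add (hasSum_inv_sq.mul_left _))
    have main := split_bound G (sg {ν}) (fun k => U k ζ) (8 * B * y) E _ _ ?_ ?_ ?_ hsum
    · refine main.trans ?_
      have e1 : y / (1 - y) ≤ 2 * y := by
        rw [div_le_iff₀ (by linarith)]; nlinarith
      have e2 := zeta_two_le
      have e3 : 60 * B ≤ E := by
        rw [hE]
        have : 1 ≤ rx ((2 * n + 1) * Y) := Real.one_le_exp (by positivity)
        nlinarith
      set X := rx (n * y) with hX
      have hX1 : 1 ≤ X := Real.one_le_exp (by positivity)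
      have e4 : rx ((2 * n + 1) * (pS (insert ν T) ζ / δ)) =
          rx ((2 * n + 1) * Y) * (X ^ 2 * rx y) := by
        rw [hX, ← Real.exp_nat_mul, ← Real.exp_add, ← Real.exp_add]
        congr 1
        rw [pS_insert hν, hr, hY]; field_simp; ring
      have e4' : 60 * B * rx ((2 * n + 1) * (pS (insert ν T) ζ / δ)) =
          E * (X ^ 2 * rx y) := by rw [e4, hE]; ring
      rw [e4']
      exact tail_arith hB0 hy0.le e3 hX1 e1 e2 (by linarith [Real.add_one_le_exp y])
    · intro j hj
      have := hS.Dminus (hS.bd_fiber hG {ν} j) {ν} j (fil j) hj ζ hz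
      refine this.trans ?_
      rw [pS_single, ← hB]
      gcongr
    · exact ih _ m hm (hS.bd_fiber hG {ν} 0) (agree' 0) (fun k hk => by simpa using sgT 0 k hk) ζ hroom
        (fun i hi => hy i (Finset.mem_insert_of_mem hi))
    · intro i
      set j : ℕ := i + 1 with hj
      have hj0 : (0:ℝ) < j := by positivity
      have hjr : (j : ℝ) = (i : ℝ) + 1 := by rw [hj]; push_cast; ring
      have hGj := hS.bd_fiber hG {ν} (j : ℤ)
      by_cases hjm : j ≤ m
      · have hr0 : 0 < δ * j / n := by positivity
        have hmv := n1_move ν (δ * j / n) hr0 ζ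
        have hroom2 : n1 (ex (sh {ν} (rl (δ * j / n) - (ζ ν).re) ζ)) + δ * ((m - j : ℕ) : ℝ) / n + δ < 1 := by
          have : δ * ((m - j : ℕ) : ℝ) / n = δ * m / n - δ * j / n := by
            rw [Nat.cast_sub hjm]; ring
          linarith
        have hp2 : 0 ≤ δ * ((m - j : ℕ) : ℝ) / n := by positivity
        have d := hS.Dplus hGj {ν} j (fil j) (by omega) ζ hz (rl (δ * j / n) - (ζ ν).re)
          (by linarith)
        have i1 := ih _ (m - j) (by omega) hGj (agree' j) (fun k hk => by
          rw [sgT j k hk]; omega) _ hroom2 (fun i hi => by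
            have : i ≠ ν := fun h => hν (h ▸ hi)
            simpa [sh, this] using hy i (Finset.mem_insert_of_mem hi))
        rw [pS_sh_disj hdis, ← hE] at i1
        rw [exp_move _ _ hr0, pS_single] at d
        refine d.trans ?_
        have e1 : (rx (ζ ν).re / (δ * j / n)) ^ j ≤ (n * y) ^ j / (j.factorial : ℝ) := by
          have : rx (ζ ν).re / (δ * j / n) = n * y / j := by rw [hr]; field_simp
          rw [this, div_pow]
          have hf : (j.factorial : ℝ) ≤ (j:ℝ) ^ j := by exact_mod_cast Nat.factorial_le_pow j
          have : (0:ℝ) < j.factorial := by exact_mod_cast Nat.factorial_pos j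
          gcongr
        have e2 : 2 * B * rx (ζ ν).re ≤ 2 * B := by
          have : rx (ζ ν).re ≤ 1 := by linarith
          nlinarith
        have e3 : 12 * (K + L) * rx (ζ ν).re / ((j : ℤ) : ℝ) ^ 2 ≤ 12 * B * y * (1 / ((i : ℝ) + 1) ^ 2) := by
          rw [← hB, ← hjr, mul_one_div]
          push_cast
          gcongr
        have e4 : 0 ≤ y ^ j * (10 * B) := by positivity
        have e5 : (rx (ζ ν).re / (δ * j / n)) ^ j * (‖∑ k ∈ G.filter (fun k => sg {ν} k = j), U k (sh {ν} (rl (δ * j / n) - (ζ ν).re) ζ)‖ + 2 * (K + L) * rx (ζ ν).re) ≤ (n * y) ^ j / (j.factorial : ℝ) * (E + 2 * B) := by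
          apply mul_le_mul e1 (by linarith) (by positivity) (by positivity)
        linarith
      · have hmv := n1_move ν δ hδ ζ
        have hz2 : n1 (ex (sh {ν} (rl δ - (ζ ν).re) ζ)) < 1 := by linarith
        have d := hS.Dplus hGj {ν} j (fil j) (by omega) ζ hz (rl δ - (ζ ν).re) hz2
        have i1 := hS.Dminus hGj T (m - j) (sgT j) (by omega) _ hz2
        rw [exp_move _ _ hδ, pS_single] at d
        refine d.trans ?_
        have e0 : 8 * (K + L) * pS T (sh {ν} (rl δ - (ζ ν).re) ζ) / (((m - j : ℤ)) : ℝ) ^ 2 ≤ 8 * B := by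
          have f1 : pS T (sh {ν} (rl δ - (ζ ν).re) ζ) ≤ 1 := (pS_le_n1 _ _).trans hz2.le
          have f2 : (1:ℝ) ≤ (((m - j : ℤ)) : ℝ) ^ 2 := by
            have : (1:ℤ) ≤ (m - j : ℤ) ^ 2 := by
              have : (m - j : ℤ) ≤ -1 := by omega
              nlinarith
            exact_mod_cast this
          rw [div_le_iff₀ (by linarith)]
          have := pS_nonneg T (sh {ν} (rl δ - (ζ ν).re) ζ)
          nlinarith
        have e2 : 2 * B * rx (ζ ν).re ≤ 2 * B := by
          have : rx (ζ ν).re ≤ 1 := by linarith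
          nlinarith
        have e3 : 12 * (K + L) * rx (ζ ν).re / ((j : ℤ) : ℝ) ^ 2 ≤ 12 * B * y * (1 / ((i : ℝ) + 1) ^ 2) := by
          rw [← hB, ← hjr, mul_one_div]
          push_cast
          gcongr
        have e4 : 0 ≤ (n * y) ^ j / (j.factorial : ℝ) * (E + 2 * B) := by positivity
        have e5 : (rx (ζ ν).re / δ) ^ j * (‖∑ k ∈ G.filter (fun k => sg {ν} k = j), U k (sh {ν} (rl δ - (ζ ν).re) ζ)‖ + 2 * (K + L) * rx (ζ ν).re) ≤ y ^ j * (10 * B) := by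
          apply mul_le_mul_of_nonneg_left _ (by positivity)
          linarith
        linarith

end Rec3

section Rec4

variable {ι : Type} [Fintype ι] [DecidableEq ι]
variable {h : (ι → ℤ) → ι → Cv ι → ℂ} {U : (ι → ℤ) → Cv ι → ℂ} {K L : ℝ}

lemma exp_half_le : rx (1 / 2) ≤ 2 := by
  have h1 : rx (1 / 2) ^ 2 = rx 1 := by
    rw [← Real.exp_nat_mul]; norm_num
  have := Real.exp_one_lt_d9
  nlinarith [Real.exp_pos (1 / 2)]

set_option maxHeartbeats 1000000 in
lemma Sys.tailTotal (hS : Sys h U K L) (δ : ℝ) (hδ : 0 < δ) (hδ1 : δ ≤ 1)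
    (T : Finset ι) (G : Finset (ι → ℤ)) (hG : Bd h K L G)
    (hagree : ∀ k ∈ G, ∀ k' ∈ G, ∀ i, i ∉ T → k i = k' i) (ζ : ι → ℂ)
    (hp : pS T ζ ≤ δ / 16) (hroom : pS Tᶜ ζ + 3 * δ < 1) :
    ‖∑ k ∈ G, U k ζ‖ ≤ 300 * (K + L) := by
  have hK := hS.K0
  have hL := hS.L0
  set B := K + L with hB
  have hB0 : 0 ≤ B := by positivity
  have hp0 := pS_nonneg T ζ
  have hp1 : pS T ζ ≤ 1 := by linarith
  have hn1 := n1_split T ζ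
  have hz : n1 (ex ζ) < 1 := by linarith
  have agree' : ∀ j : ℤ, ∀ k ∈ G.filter (fun k => sg T k = j),
      ∀ k' ∈ G.filter (fun k => sg T k = j), ∀ i, i ∉ T → k i = k' i :=
    fun j k hk k' hk' i hi => hagree k (Finset.mem_filter.mp hk).1 k' (Finset.mem_filter.mp hk').1 i hi
  have fil : ∀ j : ℤ, ∀ k ∈ G.filter (fun k => sg T k = j), sg T k = j :=
    fun j k hk => (Finset.mem_filter.mp hk).2
  have hsingle : ∀ i ∈ T, rx (ζ i).re ≤ pS T ζ := fun i hi =>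
    Finset.single_le_sum (f := fun i => rx (ζ i).re) (fun _ _ => (Real.exp_pos _).le) hi
  have hsum : HasSum (fun i : ℕ => (1 / 2 : ℝ) ^ (i + 1) * (122 * B) + 12 * B * (1 / ((i : ℝ) + 1) ^ 2))
      ((1 / 2 : ℝ) / (1 - 1 / 2) * (122 * B) + 12 * B * (pπ ^ 2 / 6)) :=
    ((hasSum_geo_one (by norm_num) (by norm_num)).mul_right _).add (hasSum_inv_sq.mul_left _)
  have main := split_bound G (sg T) (fun k => U k ζ) (8 * B) (120 * B) _ _ ?_ ?_ ?_ hsum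
  · refine main.trans ?_
    have f3 : 12 * B * (pπ ^ 2 / 6) ≤ 12 * B * 2 := by
      have := zeta_two_le; gcongr
    norm_num
    linarith
  · intro j hj
    have := hS.Dminus (hS.bd_fiber hG T j) T j (fil j) hj ζ hz
    refine this.trans ?_
    rw [← hB]
    refine div_le_div_of_nonneg_right ?_ (by positivity)
    nlinarith
  · have := hS.tail δ hδ hδ1 1 le_rfl T _ 0 (by norm_num) (hS.bd_fiber hG T 0) (agree' 0)
      (fun k hk => by simpa using fil 0 k hk) ζ (by simp; linarith) (fun i hi => by
        have := hsingle i hi; linarith)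
    refine this.trans ?_
    have e1 : rx ((2 * ((1:ℕ):ℝ) + 1) * (pS T ζ / δ)) ≤ 2 := by
      refine le_trans (Real.exp_le_exp.mpr ?_) exp_half_le
      have : pS T ζ / δ ≤ 1 / 16 := by rw [div_le_iff₀ hδ]; linarith
      push_cast; linarith
    nlinarith
  · intro i
    set j : ℕ := i + 1 with hj
    have hj0 : (0:ℝ) < j := by positivity
    have hjr : (j : ℝ) = (i : ℝ) + 1 := by rw [hj]; push_cast; ring
    have hGj := hS.bd_fiber hG T (j : ℤ)
    have hps : pS T (sh T (rl 4 - 0) ζ) = 4 * pS T ζ := by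
      rw [pS_sh, sub_zero, Real.exp_log (by norm_num)]
    have hn2 : n1 (ex (sh T (rl 4 - 0) ζ)) = 4 * pS T ζ + pS Tᶜ ζ := by
      rw [n1_sh, sub_zero, Real.exp_log (by norm_num)]
    have hdj : δ * (j:ℝ) / j = δ := by field_simp
    have d := hS.Dplus hGj T j (fil j) (by omega) ζ hz (rl 4 - 0) (by linarith)
    have t := hS.tail δ hδ hδ1 j (by omega) T _ j le_rfl hGj (agree' j) (fil j)
      (sh T (rl 4 - 0) ζ) (by rw [hdj, hn2]; linarith) (fun i hi => by
        have : rx ((sh T (rl 4 - 0) ζ) i).re ≤ pS T (sh T (rl 4 - 0) ζ) :=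
          Finset.single_le_sum (f := fun i => rx ((sh T (rl 4 - 0) ζ) i).re)
            (fun _ _ => (Real.exp_pos _).le) hi
        linarith)
    rw [exp_move _ _ (by norm_num)] at d
    refine d.trans ?_
    have e1 : rx ((2 * (j:ℝ) + 1) * (pS T (sh T (rl 4 - 0) ζ) / δ)) ≤ 2 * 2 ^ j := by
      have f1 : pS T (sh T (rl 4 - 0) ζ) / δ ≤ 1 / 4 := by
        rw [hps, div_le_iff₀ hδ]; linarith
      have f2 : (2 * (j:ℝ) + 1) * (pS T (sh T (rl 4 - 0) ζ) / δ) ≤ (j + 1 : ℕ) * (1 / 2) := by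
        have : (2 * (j:ℝ) + 1) * (pS T (sh T (rl 4 - 0) ζ) / δ) ≤ (2 * (j:ℝ) + 1) * (1 / 4) := by
          gcongr
        push_cast; linarith
      calc _ ≤ rx ((j + 1 : ℕ) * (1 / 2)) := Real.exp_le_exp.mpr f2
        _ = rx (1 / 2) ^ (j + 1) := by rw [Real.exp_nat_mul]
        _ ≤ 2 ^ (j + 1) := by have := exp_half_le; gcongr
        _ = _ := by ring
    have e2 : 60 * (K + L) * rx ((2 * (j:ℝ) + 1) * (pS T (sh T (rl 4 - 0) ζ) / δ)) + 2 * (K + L) * pS T ζ ≤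
        122 * B * 2 ^ j := by
      have f1 : 60 * B * rx ((2 * (j:ℝ) + 1) * (pS T (sh T (rl 4 - 0) ζ) / δ)) ≤ 60 * B * (2 * 2 ^ j) := by gcongr
      have f2 : (1:ℝ) ≤ 2 ^ j := one_le_pow₀ (by norm_num)
      have f3 : B * 1 ≤ B * 2 ^ j := by gcongr
      have f4 : B * pS T ζ ≤ B * 1 := by gcongr
      rw [← hB]; nlinarith
    have e3 : (rx 0 / 4) ^ j * (‖∑ k ∈ G.filter (fun k => sg T k = j), U k (sh T (rl 4 - 0) ζ)‖ + 2 * (K + L) * pS T ζ) ≤ (1 / 2 : ℝ) ^ j * (122 * B) := by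
      calc _ ≤ (rx 0 / 4) ^ j * (122 * B * 2 ^ j) := by
            apply mul_le_mul_of_nonneg_left _ (by positivity); linarith
        _ = (rx 0 / 4 * 2) ^ j * (122 * B) := by rw [mul_pow]; ring
        _ = _ := by rw [Real.exp_zero]; norm_num
    have e4 : 12 * (K + L) * pS T ζ / ((j : ℤ) : ℝ) ^ 2 ≤ 12 * B * (1 / ((i : ℝ) + 1) ^ 2) := by
      rw [← hB, ← hjr, mul_one_div]
      push_cast
      refine div_le_div_of_nonneg_right ?_ (by positivity)
      nlinarith
    linarith

set_option maxHeartbeats 1000000 in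
lemma Sys.head (hS : Sys h U K L) (δ : ℝ) (hδ : 0 < δ) (hδ1 : δ ≤ 1) (b : ℝ) (hb : 1 < b)
    (T : Finset ι) (H : Finset ι) : Disjoint H T → ∀ (G : Finset (ι → ℤ)), Bd h K L G →
    (∀ k ∈ G, ∀ k' ∈ G, ∀ i, i ∉ T → i ∉ H → k i = k' i) → ∀ (ζ : ι → ℂ),
    pS T ζ ≤ δ / 16 → b * pS H ζ + pS (H ∪ T)ᶜ ζ + 3 * δ < 1 →
    ‖∑ k ∈ G, U k ζ‖ ≤ 300 * (K + L) * (2 + 2 / (b - 1)) ^ H.card := by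
  have hK := hS.K0
  have hL := hS.L0
  induction H using Finset.induction_on with
  | empty =>
    intro _ G hG hagree ζ hp hroom
    have := hS.tailTotal δ hδ hδ1 T G hG (fun k hk k' hk' i hi => hagree k hk k' hk' i hi (by simp)) ζ hp
      (by simpa [pS] using hroom)
    simpa using this
  | insert ν H hν ih =>
    intro hdis G hG hagree ζ hp hroom
    rw [Finset.disjoint_insert_left] at hdis
    obtain ⟨hνT, hdis⟩ := hdis
    set B := K + L with hB
    have hB0 : 0 ≤ B := by positivity
    set C := 2 + 2 / (b - 1) with hC
    have hb1 : 0 < b - 1 := by linarith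
    have hb0 : 0 < b := by linarith
    have hC1 : 2 ≤ C := by have : 0 < 2 / (b - 1) := by positivity
                           linarith
    set E := 300 * B * C ^ H.card with hE
    have hEB : 300 * B ≤ E := by
      have : 1 ≤ C ^ H.card := one_le_pow₀ (by linarith)
      nlinarith
    set r := rx (ζ ν).re with hr
    have hr0 : 0 < r := Real.exp_pos _
    have hpc : pS (H ∪ T)ᶜ ζ = r + pS (insert ν H ∪ T)ᶜ ζ := by
      have : (H ∪ T)ᶜ = insert ν ((insert ν H ∪ T)ᶜ) := by
        ext i; simp only [Finset.mem_compl, Finset.mem_union, Finset.mem_insert]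
        by_cases hi : i = ν
        · subst hi; simp [hν, hνT]
        · simp [hi]
      rw [this, pS_insert (by simp)]
    have hpH : pS (insert ν H) ζ = r + pS H ζ := pS_insert hν ζ
    have hp0 := pS_nonneg H ζ
    have hall : ∀ ζ : ι → ℂ, n1 (ex ζ) = pS H ζ + pS T ζ + pS (H ∪ T)ᶜ ζ := by
      intro ζ
      rw [n1_split (H ∪ T)]
      congr 1
      unfold pS; rw [Finset.sum_union hdis]
    rw [hpH] at hroom
    have hrb : r ≤ b * r := by nlinarith
    have hHb : pS H ζ ≤ b * pS H ζ := by nlinarith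
    have hrest := pS_nonneg (insert ν H ∪ T)ᶜ ζ
    have hz : n1 (ex ζ) < 1 := by
      rw [hall, hpc]; linarith
    have hr1 : r ≤ 1 := by linarith
    have agree' : ∀ j : ℤ, ∀ k ∈ G.filter (fun k => sg {ν} k = j),
        ∀ k' ∈ G.filter (fun k => sg {ν} k = j), ∀ i, i ∉ T → i ∉ H → k i = k' i := by
      intro j k hk k' hk' i hi hi2
      rw [Finset.mem_filter, sg_single] at hk hk'
      by_cases hiν : i = ν
      · rw [hiν, hk.2, hk'.2]
      · exact hagree k hk.1 k' hk'.1 i hi (by simp [hiν, hi2])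
    have fil : ∀ j : ℤ, ∀ k ∈ G.filter (fun k => sg {ν} k = j), sg {ν} k = j :=
      fun j k hk => (Finset.mem_filter.mp hk).2
    have hbinv : b⁻¹ < 1 := inv_lt_one_of_one_lt₀ hb
    have hsum : HasSum (fun i : ℕ => (b⁻¹ : ℝ) ^ (i + 1) * (E + 2 * B) + 12 * B * (1 / ((i : ℝ) + 1) ^ 2))
        (b⁻¹ / (1 - b⁻¹) * (E + 2 * B) + 12 * B * (pπ ^ 2 / 6)) :=
      ((hasSum_geo_one (by positivity) hbinv).mul_right _).add (hasSum_inv_sq.mul_left _)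
    have main := split_bound G (sg {ν}) (fun k => U k ζ) (8 * B) E _ _ ?_ ?_ ?_ hsum
    · refine main.trans ?_
      rw [show 300 * B * (2 + 2 / (b - 1)) ^ (insert ν H).card = E * (2 + 2 / (b - 1)) by
        rw [Finset.card_insert_of_notMem hν, pow_succ, hE]; ring]
      have f3 : 12 * B * (pπ ^ 2 / 6) ≤ 12 * B * 2 := by
        have := zeta_two_le; gcongr
      have f1 : b⁻¹ / (1 - b⁻¹) = 1 / (b - 1) := by
        have : b - 1 ≠ 0 := hb1.ne'
        have : 1 - b⁻¹ ≠ 0 := by linarith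
        field_simp
      have f2 : 1 / (b - 1) * (E + 2 * B) ≤ 1 / (b - 1) * (2 * E) := by
        gcongr; linarith
      have f4 : E * C = 2 * E + 1 / (b - 1) * (2 * E) := by rw [hC]; ring
      rw [f1, f4]; linarith
    · intro j hj
      have := hS.Dminus (hS.bd_fiber hG {ν} j) {ν} j (fil j) hj ζ hz
      refine this.trans ?_
      rw [← hB, pS_single]
      refine div_le_div_of_nonneg_right ?_ (by positivity)
      nlinarith
    · exact ih hdis _ (hS.bd_fiber hG {ν} 0) (agree' 0) ζ hp (by rw [hpc]; linarith)
    · intro i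
      set j : ℕ := i + 1 with hj
      have hj0 : (0:ℝ) < j := by positivity
      have hjr : (j : ℝ) = (i : ℝ) + 1 := by rw [hj]; push_cast; ring
      have hGj := hS.bd_fiber hG {ν} (j : ℤ)
      have hpH2 : pS H (sh {ν} (rl b - 0) ζ) = pS H ζ :=
        pS_sh_disj (Finset.disjoint_singleton_left.mpr hν) _ _
      have hpT2 : pS T (sh {ν} (rl b - 0) ζ) = pS T ζ :=
        pS_sh_disj (Finset.disjoint_singleton_left.mpr hνT) _ _
      have hpc2 : pS (H ∪ T)ᶜ (sh {ν} (rl b - 0) ζ) = b * r + pS (insert ν H ∪ T)ᶜ ζ := by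
        have : (H ∪ T)ᶜ = insert ν ((insert ν H ∪ T)ᶜ) := by
          ext i; simp only [Finset.mem_compl, Finset.mem_union, Finset.mem_insert]
          by_cases hi : i = ν
          · subst hi; simp [hν, hνT]
          · simp [hi]
        rw [this, pS_insert (by simp), pS_sh_disj (by simp)]
        congr 1
        rw [← pS_single, pS_sh, sub_zero, Real.exp_log hb0, pS_single]
      have d := hS.Dplus hGj {ν} j (fil j) (by omega) ζ hz (rl b - 0) (by
        rw [hall, hpH2, hpT2, hpc2]; linarith)
      have t := ih hdis _ hGj (agree' j) (sh {ν} (rl b - 0) ζ) (by rwa [hpT2]) (by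
        rw [hpH2, hpc2]; linarith)
      rw [exp_move _ _ hb0, pS_single, ← hr, Real.exp_zero, one_div] at d
      refine d.trans ?_
      have e4 : 12 * (K + L) * r / ((j : ℤ) : ℝ) ^ 2 ≤ 12 * B * (1 / ((i : ℝ) + 1) ^ 2) := by
        rw [← hB, ← hjr, mul_one_div]
        push_cast
        refine div_le_div_of_nonneg_right ?_ (by positivity)
        nlinarith
      have e3 : b⁻¹ ^ j * (‖∑ k ∈ G.filter (fun k => sg {ν} k = j), U k (sh {ν} (rl b - 0) ζ)‖ + 2 * (K + L) * r) ≤ b⁻¹ ^ j * (E + 2 * B) := by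
        apply mul_le_mul_of_nonneg_left _ (by positivity)
        rw [← hB]
        nlinarith
      linarith

end Rec4

section DeltaN

theorem fac_le_aux (k : ℕ) : (k.factorial : ℝ) * rx k ≤ rx 1 * ((k:ℝ)+1) * (k:ℝ)^k := by
  rcases Nat.eq_zero_or_pos k with rfl | hk
  · simp
  have key : ∀ k : ℕ, 1 ≤ k → (k.factorial : ℝ) * rx k ≤ rx 1 * (k:ℝ) * (k:ℝ)^k := by
    intro k hk
    induction k, hk using Nat.le_induction with
    | base => simp
    | succ k hk ih =>
      have hk0 : (0:ℝ) < k := by exact_mod_cast hk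
      have h1 : rx 1 * (k:ℝ)^(k+1) ≤ ((k:ℝ)+1)^(k+1) := by
        have hl := Real.one_sub_inv_le_log_of_pos (x := ((k:ℝ)+1)/k) (by positivity)
        have h2 : 1 ≤ (k+1 : ℕ) * rl (((k:ℝ)+1)/k) := by
          have : 1 - (((k:ℝ)+1)/k)⁻¹ = 1/((k:ℝ)+1) := by field_simp; ring
          rw [this] at hl
          push_cast
          calc (1:ℝ) = (k+1) * (1/((k:ℝ)+1)) := by field_simp
            _ ≤ _ := by gcongr
        have h3 : rx 1 ≤ (((k:ℝ)+1)/k)^(k+1) := by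
          rw [← Real.exp_log (x := (((k:ℝ)+1)/k)^(k+1)) (by positivity), Real.log_pow]
          exact Real.exp_le_exp.mpr h2
        rw [div_pow, le_div_iff₀ (by positivity)] at h3
        exact h3
      rw [Nat.factorial_succ]
      push_cast
      rw [Real.exp_add]
      calc ((k:ℝ)+1) * k.factorial * (rx k * rx 1)
          = ((k:ℝ)+1) * rx 1 * (k.factorial * rx k) := by ring
        _ ≤ ((k:ℝ)+1) * rx 1 * (rx 1 * (k:ℝ) * (k:ℝ)^k) := by gcongr
        _ = ((k:ℝ)+1) * rx 1 * (rx 1 * (k:ℝ)^(k+1)) := by ring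
        _ ≤ ((k:ℝ)+1) * rx 1 * (((k:ℝ)+1)^(k+1)) := by gcongr
        _ = _ := by ring
  refine (key k hk).trans ?_
  gcongr
  linarith

theorem fac_le_self_pow (k : ℕ) : (k.factorial : ℝ) ≤ (k:ℝ)^k := by
  exact_mod_cast Nat.factorial_le_pow k

theorem coord_bound (Q a : ℝ) (hQ : 1 ≤ Q) (ha : 0 ≤ a) (hd : Prop) [Decidable hd] (k : ℕ) :
    (if k = 0 then 1 else Q) * a^k * rx k / (k:ℝ)^k ≤
      (if hd then rx 1 * Q * ((k:ℝ)+1) else 1) * ((if hd then a else rx 1 * Q * a)^k / k.factorial) := by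
  have hf : (0:ℝ) < k.factorial := by positivity
  have hkk : (0:ℝ) < (k:ℝ)^k := lt_of_lt_of_le hf (fac_le_self_pow k)
  rw [mul_div_assoc', div_le_div_iff₀ hkk hf]
  by_cases h : hd
  · simp only [h, if_true]
    have h1 := fac_le_aux k
    have hq : (if k = 0 then 1 else Q) ≤ Q := by split_ifs <;> linarith
    calc (if k = 0 then 1 else Q) * a^k * rx k * k.factorial
        = (if k = 0 then 1 else Q) * a^k * (k.factorial * rx k) := by ring
      _ ≤ Q * a^k * (rx 1 * ((k:ℝ)+1) * (k:ℝ)^k) := by gcongr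
      _ = _ := by ring
  · simp only [h, if_false]
    have hq : (if k = 0 then 1 else Q) ≤ Q^k := by
      split_ifs with h0
      · simp [h0]
      · exact le_self_pow₀ hQ h0
    rw [mul_pow, mul_pow, ← Real.exp_nat_mul]
    calc (if k = 0 then 1 else Q) * a^k * rx k * k.factorial
        ≤ Q^k * a^k * rx k * (k:ℝ)^k := by
          have := fac_le_self_pow k
          gcongr
      _ = _ := by rw [mul_one]; ring

theorem DeltaTerm_eq (Q : ℝ) (hQ : 1 ≤ Q) (z : ℕ → ℂ) (k : ℕ →₀ ℕ) (s : Finset ℕ) (hs : k.support ⊆ s) :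
    DeltaTerm (Q:ℂ) z k = nn k * ∏ i ∈ s, ((if k i = 0 then 1 else Q) * ‖z i‖^(k i) / (k i:ℝ)^(k i)) := by
  unfold DeltaTerm kk
  have : ∏ i ∈ s, ((if k i = 0 then 1 else Q) * ‖z i‖^(k i) / (k i:ℝ)^(k i)) =
     ∏ i ∈ k.support, ((if k i = 0 then 1 else Q) * ‖z i‖^(k i) / (k i:ℝ)^(k i)) := by
    symm
    apply Finset.prod_subset hs
    intro i _ hi
    simp at hi
    simp [hi]
  rw [this, Finset.prod_div_distrib, Finset.prod_mul_distrib]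
  have h2 : ∏ i ∈ k.support, (if k i = 0 then 1 else Q) = ‖(Q:ℂ)‖ ^ k.support.card := by
    rw [← Finset.prod_const]
    apply Finset.prod_congr rfl
    intro i hi
    rw [if_neg (by simpa using hi)]
    simp [abs_of_pos (show 0 < Q by linarith)]
  rw [h2]; ring

theorem knormN_eq (k : ℕ →₀ ℕ) (s : Finset ℕ) (hs : k.support ⊆ s) : knormN k = ∑ i ∈ s, k i := by
  unfold knormN Finsupp.sum
  apply Finset.sum_subset hs
  intro i _ hi
  simpa using hi

theorem DeltaTerm_le (Q : ℝ) (hQ : 1 ≤ Q) (z : ℕ → ℂ) (h : ℕ) (k : ℕ →₀ ℕ) (s : Finset ℕ) (hs : k.support ⊆ s) :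
    DeltaTerm (Q:ℂ) z k ≤ (rx 1 * Q * ((knormN k : ℝ)+1))^h *
      ((Nat.multinomial s k : ℝ) * ∏ i ∈ s, (if i < h then ‖z i‖ else rx 1 * Q * ‖z i‖)^(k i)) := by
  have hn := knormN_eq k s hs
  rw [DeltaTerm_eq Q hQ z k s hs]
  set n := knormN k with hnd
  have e1 : nn k ≤ n.factorial * rx n := by
    have := Real.pow_div_factorial_le_exp (n:ℝ) (by positivity) n
    rw [div_le_iff₀ (by positivity)] at this
    unfold nn; rw [← hnd]; linarith
  have e2 : rx n * ∏ i ∈ s, ((if k i = 0 then 1 else Q) * ‖z i‖^(k i) / (k i:ℝ)^(k i)) =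
     ∏ i ∈ s, ((if k i = 0 then 1 else Q) * ‖z i‖^(k i) * rx (k i) / (k i:ℝ)^(k i)) := by
    rw [hn]; push_cast
    rw [Real.exp_sum, ← Finset.prod_mul_distrib]
    apply Finset.prod_congr rfl; intro i _; ring
  have e3 : ∏ i ∈ s, ((if k i = 0 then 1 else Q) * ‖z i‖^(k i) * rx (k i) / (k i:ℝ)^(k i)) ≤
     ∏ i ∈ s, ((if i < h then rx 1 * Q * ((k i:ℝ)+1) else 1) * ((if i < h then ‖z i‖ else rx 1 * Q * ‖z i‖)^(k i) / (k i).factorial)) := by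
    apply Finset.prod_le_prod
    · intro i _; positivity
    · intro i _
      exact coord_bound Q ‖z i‖ hQ (norm_nonneg _) (i < h) (k i)
  have hE : 1 ≤ rx 1 * Q := by
    have := Real.one_le_exp (show (0:ℝ) ≤ 1 by norm_num); nlinarith
  have e4 : ∏ i ∈ s, (if i < h then rx 1 * Q * ((k i:ℝ)+1) else 1) ≤ (rx 1 * Q * ((n : ℝ)+1))^h := by
    rw [← Finset.prod_filter]
    calc ∏ i ∈ s.filter (fun i => i < h), (rx 1 * Q * ((k i:ℝ)+1)) 
        ≤ ∏ i ∈ s.filter (fun i => i < h), (rx 1 * Q * ((n:ℝ)+1)) := by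
          apply Finset.prod_le_prod
          · intro i _; positivity
          · intro i hi
            have : k i ≤ n := by
              rw [hn]; exact Finset.single_le_sum (f := fun i => k i) (fun _ _ => Nat.zero_le _) (Finset.mem_filter.mp hi).1
            have : (k i : ℝ) ≤ n := by exact_mod_cast this
            gcongr
      _ = (rx 1 * Q * ((n : ℝ)+1))^(s.filter (fun i => i < h)).card := by rw [Finset.prod_const]
      _ ≤ _ := by
          apply pow_le_pow_right₀
          · have : (0:ℝ) ≤ n := by positivity
            nlinarith
          · calc (s.filter (fun i => i < h)).card ≤ (Finset.range h).card := by
                  apply Finset.card_le_card; intro i hi; simpa using (Finset.mem_filter.mp hi).2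
              _ = h := by simp
  have e5 : (Nat.multinomial s k : ℝ) * ∏ i ∈ s, ((k i).factorial : ℝ) = n.factorial := by
    have := Nat.multinomial_spec s k
    rw [← hn] at this
    rw [← this]; push_cast; ring
  have hpf : (0:ℝ) < ∏ i ∈ s, ((k i).factorial : ℝ) := Finset.prod_pos (fun i _ => by positivity)
  calc nn k * ∏ i ∈ s, ((if k i = 0 then 1 else Q) * ‖z i‖^(k i) / (k i:ℝ)^(k i))
      ≤ (n.factorial * rx n) * ∏ i ∈ s, ((if k i = 0 then 1 else Q) * ‖z i‖^(k i) / (k i:ℝ)^(k i)) := by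
        apply mul_le_mul_of_nonneg_right e1
        apply Finset.prod_nonneg; intro i _; positivity
    _ = n.factorial * ∏ i ∈ s, ((if k i = 0 then 1 else Q) * ‖z i‖^(k i) * rx (k i) / (k i:ℝ)^(k i)) := by
        rw [mul_assoc, e2]
    _ ≤ n.factorial * ∏ i ∈ s, ((if i < h then rx 1 * Q * ((k i:ℝ)+1) else 1) * ((if i < h then ‖z i‖ else rx 1 * Q * ‖z i‖)^(k i) / (k i).factorial)) := by gcongr
    _ = (∏ i ∈ s, (if i < h then rx 1 * Q * ((k i:ℝ)+1) else 1)) * ((Nat.multinomial s k : ℝ) * ∏ i ∈ s, (if i < h then ‖z i‖ else rx 1 * Q * ‖z i‖)^(k i)) := by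
        rw [Finset.prod_mul_distrib, Finset.prod_div_distrib, ← e5]
        field_simp
    _ ≤ _ := by
        apply mul_le_mul_of_nonneg_right e4
        apply mul_nonneg (by positivity)
        apply Finset.prod_nonneg; intro i _; positivity

theorem DeltaTerm_nonneg (q : ℂ) (z : ℕ → ℂ) (k : ℕ →₀ ℕ) : 0 ≤ DeltaTerm q z k := by
  unfold DeltaTerm nn kk; positivity

theorem DeltaTerm_summable (Q : ℝ) (hQ : 1 ≤ Q) (z : ℕ → ℂ) (hz : Summable (fun i => ‖z i‖))
    (hz1 : ∑' i, ‖z i‖ < 1) : Summable (DeltaTerm (Q:ℂ) z) := by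
  have hE : 0 < rx 1 * Q := by positivity
  set τ := (1 - ∑' i, ‖z i‖)/2 with hτ
  have hτ0 : 0 < τ := by rw [hτ]; linarith
  obtain ⟨h, hh⟩ : ∃ h, ∀ t : Finset ℕ, Disjoint t (Finset.range h) → ∑ i ∈ t, ‖z i‖ < τ / (rx 1 * Q) := by
    obtain ⟨s, hs⟩ := summable_iff_vanishing_norm.mp hz (τ / (rx 1 * Q)) (by positivity)
    obtain ⟨h, hh⟩ := s.exists_nat_subset_range
    refine ⟨h, fun t ht => ?_⟩
    have := hs t (ht.mono_right hh)
    exact lt_of_abs_lt this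
  set σ := 1 - τ with hσ
  have hz0 : 0 ≤ ∑' i, ‖z i‖ := tsum_nonneg (fun _ => norm_nonneg _)
  have hσ0 : 0 ≤ σ := by rw [hσ, hτ]; linarith
  have hσ1 : σ < 1 := by linarith
  set p : ℕ → ℝ := fun i => if i < h then ‖z i‖ else rx 1 * Q * ‖z i‖ with hp
  have hp0 : ∀ i, 0 ≤ p i := by intro i; simp only [hp]; split_ifs <;> positivity
  have hps : ∀ s : Finset ℕ, ∑ i ∈ s, p i ≤ σ := by
    intro s
    rw [← Finset.sum_filter_add_sum_filter_not s (fun i => i < h)]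
    have a1 : ∑ i ∈ s.filter (fun i => i < h), p i ≤ ∑' i, ‖z i‖ := by
      rw [Finset.sum_congr rfl (g := fun i => ‖z i‖) (fun i hi => by simp [hp, (Finset.mem_filter.mp hi).2])]
      exact hz.sum_le_tsum _ (fun _ _ => norm_nonneg _)
    have a2 : ∑ i ∈ s.filter (fun i => ¬ i < h), p i ≤ τ := by
      rw [Finset.sum_congr rfl (g := fun i => rx 1 * Q * ‖z i‖) (fun i hi => by simp only [hp]; rw [if_neg (Finset.mem_filter.mp hi).2]), ← Finset.mul_sum]
      have := hh (s.filter (fun i => ¬ i < h)) (by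
        rw [Finset.disjoint_left]; intro i hi hi2
        exact (Finset.mem_filter.mp hi).2 (by simpa using hi2))
      rw [lt_div_iff₀ hE] at this
      linarith
    rw [hσ]; linarith
  have hsum : Summable (fun n : ℕ => (rx 1 * Q * ((n : ℝ)+1))^h * σ^n) := by
    have h1 : Summable (fun n : ℕ => ((n+1 : ℕ) : ℝ)^h * σ^(n+1)) :=
      (summable_nat_add_iff 1).mpr (summable_pow_mul_geometric_of_norm_lt_one h (r := σ) (by rw [Real.norm_of_nonneg hσ0]; exact hσ1))
    rcases hσ0.eq_or_lt with h0 | h0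
    · apply summable_of_ne_finset_zero (s := {0})
      intro n hn
      rw [← h0, zero_pow (by simpa using hn), mul_zero]
    · refine ((h1.mul_left ((rx 1 * Q)^h * σ⁻¹))).congr ?_
      intro n
      push_cast
      rw [mul_pow (rx 1 * Q), pow_succ]; field_simp
  refine summable_of_sum_le (c := ∑' n : ℕ, (rx 1 * Q * ((n : ℝ)+1))^h * σ^n) (DeltaTerm_nonneg _ _) ?_
  intro A
  obtain ⟨N, hN⟩ : ∃ N, ∀ k ∈ A, k.support ⊆ Finset.range N := by
    obtain ⟨N, hN⟩ := (A.biUnion (fun k => k.support)).exists_nat_subset_range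
    exact ⟨N, fun k hk => (Finset.subset_biUnion_of_mem (fun k : ℕ →₀ ℕ => k.support) hk).trans hN⟩
  rw [← Finset.sum_fiberwise_of_maps_to (g := knormN) (t := A.image knormN) (fun k hk => Finset.mem_image_of_mem _ hk)]
  refine le_trans ?_ (hsum.sum_le_tsum (A.image knormN) (fun n _ => by positivity))
  apply Finset.sum_le_sum
  intro n _
  calc ∑ k ∈ A.filter (fun k => knormN k = n), DeltaTerm (Q:ℂ) z k
      ≤ ∑ k ∈ A.filter (fun k => knormN k = n), (rx 1 * Q * ((n : ℝ)+1))^h *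
      ((Nat.multinomial (Finset.range N) k : ℝ) * ∏ i ∈ Finset.range N, p i^(k i)) := by
        apply Finset.sum_le_sum
        intro k hk
        rw [Finset.mem_filter] at hk
        have := DeltaTerm_le Q hQ z h k (Finset.range N) (hN k hk.1)
        rw [hk.2] at this
        exact this
    _ = (rx 1 * Q * ((n : ℝ)+1))^h * ∑ k ∈ A.filter (fun k => knormN k = n), 
      ((Nat.multinomial (Finset.range N) k : ℝ) * ∏ i ∈ Finset.range N, p i^(k i)) := by rw [Finset.mul_sum]
    _ ≤ (rx 1 * Q * ((n : ℝ)+1))^h * (∑ i ∈ Finset.range N, p i)^n := by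
        apply mul_le_mul_of_nonneg_left _ (by positivity)
        rw [Finset.sum_pow_eq_sum_piAntidiag]
        refine (Finset.sum_map (A.filter (fun k => knormN k = n)) ⟨fun k : ℕ →₀ ℕ => (k : ℕ → ℕ), DFunLike.coe_injective⟩
          (fun k => ((Nat.multinomial (Finset.range N) k : ℝ) * ∏ i ∈ Finset.range N, p i^(k i)))).symm.le.trans ?_
        apply Finset.sum_le_sum_of_subset_of_nonneg
        · intro f hf
          rw [Finset.mem_map] at hf
          obtain ⟨k, hk, rfl⟩ := hf
          rw [Finset.mem_filter] at hk
          rw [Finset.mem_piAntidiag]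
          refine ⟨?_, ?_⟩
          · rw [← hk.2]; exact (knormN_eq k _ (hN k hk.1)).symm
          · intro i hi
            apply hN k hk.1
            simpa using hi
        · intro f _ _
          apply mul_nonneg (by positivity)
          apply Finset.prod_nonneg; intro i _; exact pow_nonneg (hp0 i) _
    _ ≤ _ := by
        apply mul_le_mul_of_nonneg_left _ (by positivity)
        exact pow_le_pow_left₀ (Finset.sum_nonneg (fun i _ => hp0 i)) (hps _) n

theorem esymm_step (I : Finset ℕ) (y : ℕ → ℝ) (m : ℕ) :
    ((m:ℝ)+1) * ∑ S ∈ I.powersetCard (m+1), ∏ i ∈ S, y i =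
      ∑ S ∈ I.powersetCard m, (∏ i ∈ S, y i) * ∑ ν ∈ I \ S, y ν := by
  have : ((m:ℝ)+1) * ∑ S ∈ I.powersetCard (m+1), ∏ i ∈ S, y i =
      ∑ S ∈ I.powersetCard (m+1), ∑ ν ∈ S, (∏ i ∈ S.erase ν, y i) * y ν := by
    rw [Finset.mul_sum]
    apply Finset.sum_congr rfl
    intro S hS
    rw [Finset.mem_powersetCard] at hS
    rw [Finset.sum_congr rfl (fun ν hν => Finset.prod_erase_mul S y hν), Finset.sum_const, hS.2]
    rw [nsmul_eq_mul]; push_cast; ring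
  rw [this]
  simp_rw [Finset.mul_sum]
  rw [Finset.sum_sigma', Finset.sum_sigma']
  refine Finset.sum_bij' (fun x _ => ⟨x.1.erase x.2, x.2⟩) (fun x _ => ⟨insert x.2 x.1, x.2⟩) ?_ ?_ ?_ ?_ ?_
  · rintro ⟨S, ν⟩ h
    simp only [Finset.mem_sigma, Finset.mem_powersetCard, Finset.mem_sdiff] at h ⊢
    obtain ⟨⟨h1, h2⟩, h3⟩ := h
    exact ⟨⟨(Finset.erase_subset _ _).trans h1, by rw [Finset.card_erase_of_mem h3, h2]; rfl⟩, h1 h3, Finset.notMem_erase _ _⟩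
  · rintro ⟨S, ν⟩ h
    simp only [Finset.mem_sigma, Finset.mem_powersetCard, Finset.mem_sdiff] at h ⊢
    obtain ⟨⟨h1, h2⟩, h3, h4⟩ := h
    exact ⟨⟨Finset.insert_subset h3 h1, by rw [Finset.card_insert_of_notMem h4, h2]⟩, Finset.mem_insert_self _ _⟩
  · rintro ⟨S, ν⟩ h
    simp only [Finset.mem_sigma] at h
    simp [Finset.insert_erase h.2]
  · rintro ⟨S, ν⟩ h
    simp only [Finset.mem_sigma, Finset.mem_sdiff] at h
    simp [Finset.erase_insert h.2.2]
  · rintro ⟨S, ν⟩ h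
    rfl

theorem esymm_lower (I : Finset ℕ) (y : ℕ → ℝ) (hy : ∀ i, 0 ≤ y i) (ε : ℝ) (hε : 0 ≤ ε) (M : ℕ)
    (hM : ∀ H ⊆ I, H.card < M → ε ≤ ∑ ν ∈ I \ H, y ν) :
    ε ^ M ≤ M.factorial * ∑ S ∈ I.powersetCard M, ∏ i ∈ S, y i := by
  induction M with
  | zero => simp
  | succ m ih =>
    have h1 := ih (fun H h1 h2 => hM H h1 (by omega))
    rw [Nat.factorial_succ]
    push_cast
    calc ε^(m+1) = ε^m * ε := pow_succ _ _
      _ ≤ (m.factorial * ∑ S ∈ I.powersetCard m, ∏ i ∈ S, y i) * ε := by gcongr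
      _ = m.factorial * ∑ S ∈ I.powersetCard m, (∏ i ∈ S, y i) * ε := by rw [mul_assoc, Finset.sum_mul]
      _ ≤ m.factorial * ∑ S ∈ I.powersetCard m, (∏ i ∈ S, y i) * ∑ ν ∈ I \ S, y ν := by
          gcongr with S hS
          · exact Finset.prod_nonneg (fun i _ => hy i)
          · rw [Finset.mem_powersetCard] at hS
            exact hM S hS.1 (by omega)
      _ = _ := by rw [← esymm_step]; ring

theorem Delta_lower (Q : ℝ) (hQ : 1 ≤ Q) (z : ℕ → ℂ) (hz : Summable (fun i => ‖z i‖))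
    (hz1 : ∑' i, ‖z i‖ < 1) (I : Finset ℕ) (M : ℕ) (ε : ℝ) (hε : 0 ≤ ε)
    (hM : ∀ H ⊆ I, H.card < M → ε ≤ ∑ ν ∈ I \ H, ‖z ν‖) :
    (Q * ε)^M ≤ Delta (Q:ℂ) z := by
  have hs := DeltaTerm_summable Q hQ z hz hz1
  set ind : Finset ℕ → (ℕ →₀ ℕ) := fun S => Finsupp.indicator S (fun _ _ => 1) with hind
  have hsup : ∀ S, (ind S).support = S := by
    intro S; ext i; simp [hind, Finsupp.indicator_apply]
  have hinj : Function.Injective ind := by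
    intro S T h
    rw [← hsup S, ← hsup T, h]
  have hterm : ∀ S, S.card = M → (M.factorial:ℝ) * Q^M * ∏ i ∈ S, ‖z i‖ ≤ DeltaTerm (Q:ℂ) z (ind S) := by
    intro S hS
    have h1 : ∀ i ∈ S, ind S i = 1 := by intro i hi; simp [hind, Finsupp.indicator_apply, hi]
    rw [DeltaTerm_eq Q hQ z (ind S) S (by rw [hsup])]
    have h2 : knormN (ind S) = M := by
      rw [knormN_eq (ind S) S (by rw [hsup]), Finset.sum_congr rfl h1]; simp [hS]
    have h3 : ∏ i ∈ S, ((if ind S i = 0 then 1 else Q) * ‖z i‖^(ind S i) / (ind S i:ℝ)^(ind S i)) = ∏ i ∈ S, (Q * ‖z i‖) :=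
      Finset.prod_congr rfl (fun i hi => by rw [h1 i hi]; simp)
    rw [h3, Finset.prod_mul_distrib, Finset.prod_const, hS]
    unfold nn; rw [h2, mul_assoc]
    apply mul_le_mul_of_nonneg_right (fac_le_self_pow M)
    positivity
  have h1 := esymm_lower I (fun i => ‖z i‖) (fun i => norm_nonneg _) ε hε M hM
  calc (Q*ε)^M = Q^M * ε^M := mul_pow _ _ _
    _ ≤ Q^M * (M.factorial * ∑ S ∈ I.powersetCard M, ∏ i ∈ S, ‖z i‖) := by gcongr
    _ = ∑ S ∈ I.powersetCard M, (M.factorial:ℝ) * Q^M * ∏ i ∈ S, ‖z i‖ := by rw [← Finset.mul_sum]; ring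
    _ ≤ ∑ S ∈ I.powersetCard M, DeltaTerm (Q:ℂ) z (ind S) := by
        apply Finset.sum_le_sum
        intro S hS
        exact hterm S (Finset.mem_powersetCard.mp hS).2
    _ = ∑ k ∈ (I.powersetCard M).map ⟨ind, hinj⟩, DeltaTerm (Q:ℂ) z k := by rw [Finset.sum_map]; rfl
    _ ≤ _ := hs.sum_le_tsum _ (fun k _ => DeltaTerm_nonneg _ _ _)

end DeltaN

section OneVar
open Complex MeasureTheory Filter Topology

def cp (x θ : ℝ) : ℂ := cexp ((x:ℂ) + (θ:ℂ) * I)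

theorem norm_cp (x θ : ℝ) : ‖cp x θ‖ = rx x := by
  simp [cp, Complex.norm_exp]

theorem cp_periodic (x : ℝ) : Function.Periodic (cp x) (2 * pπ) := by
  intro θ
  simp only [cp]
  push_cast
  rw [add_mul, ← add_assoc]
  exact Complex.exp_periodic _

theorem cp_countable (x : ℝ) (p : ℂ) : {θ : ℝ | cp x θ = p}.Countable := by
  by_cases h : ∃ θ0, cp x θ0 = p
  · obtain ⟨θ0, h0⟩ := h
    refine (Set.countable_range (fun n : ℤ => θ0 + n * (2 * pπ))).mono ?_
    intro θ hθ
    have hθ : cp x θ = p := hθ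
    rw [← h0] at hθ
    unfold cp at hθ
    obtain ⟨n, hn⟩ := Complex.exp_eq_exp_iff_exists_int.mp hθ
    refine ⟨n, ?_⟩
    have := congrArg Complex.im hn
    simp at this
    linarith
  · convert Set.countable_empty (α := ℝ)
    ext θ; exact ⟨fun hh => (h ⟨θ, hh⟩).elim, fun hh => hh.elim⟩

def Em (G : ℂ → ℂ) (j : ℤ) (x : ℝ) : ℂ :=
  ∫ θ in (0:ℝ)..(2 * pπ), cexp (-(j:ℂ) * ((x:ℂ) + (θ:ℂ) * I)) * G (cp x θ)

theorem norm_cexp_j (j : ℤ) (x θ : ℝ) : ‖cexp (-(j:ℂ) * ((x:ℂ) + (θ:ℂ) * I))‖ = rx (-j * x) := by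
  simp [Complex.norm_exp]

theorem Em_norm_le (G : ℂ → ℂ) (j : ℤ) (x M : ℝ) (h : ∀ θ, ‖G (cp x θ)‖ ≤ M) :
    ‖Em G j x‖ ≤ rx (-j * x) * M * (2 * pπ) := by
  unfold Em
  have := intervalIntegral.norm_integral_le_of_norm_le_const (a := 0) (b := 2 * pπ) (C := rx (-j * x) * M)
    (f := fun θ : ℝ => cexp (-(j:ℂ) * ((x:ℂ) + (θ:ℂ) * I)) * G (cp x θ)) (by
      intro θ _
      rw [norm_mul, norm_cexp_j]
      have := h θ
      gcongr)
  rwa [sub_zero, abs_of_pos Real.two_pi_pos] at this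

structure OneV (G ψ : ℂ → ℂ) (G' : ℂ → ℂ →L[ℝ] ℂ) (p : ℂ) (b M B : ℝ) : Prop where
  meas : Measurable G
  b0 : 0 < b
  b1 : b ≤ 1
  B0 : 0 ≤ B
  bd : ∀ ζ, ‖ζ‖ < b → ‖G ζ‖ ≤ M
  der : ∀ ζ, ‖ζ‖ < b → ζ ≠ p → HasFDerivAt G (G' ζ) ζ
  dbar : ∀ ζ, ‖ζ‖ < b → ζ ≠ p → G' ζ 1 + I * G' ζ I = 2 * ψ ζ
  lip : ∀ ζ ζ', ‖ζ‖ < b → ‖ζ'‖ < b → ‖ψ ζ - ψ ζ'‖ ≤ B * ‖ζ - ζ'‖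
  psi0 : ψ 0 = 0
  small : ∀ ε : ℝ, 0 < ε → ∃ δ > 0, ∀ ζ, ‖ζ‖ < δ → ‖G ζ‖ ≤ ε * ‖ζ‖

variable {G ψ : ℂ → ℂ} {G' : ℂ → ℂ →L[ℝ] ℂ} {p : ℂ} {b M B : ℝ}

theorem OneV.Em_cont (h : OneV G ψ G' p b M B) (j : ℤ) (x : ℝ) (hx : x < rl b) :
    ContinuousAt (Em G j) x := by
  have hb := h.b0
  unfold Em
  have hxb : ∀ x, x < rl b → rx x < b := fun x hx => (Real.lt_log_iff_exp_lt hb).mp hx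
  refine intervalIntegral.continuousAt_of_dominated_interval (bound := fun _ => rx (|(j:ℝ)| * (|x| + 1)) * M) ?_ ?_ ?_ ?_
  · refine Eventually.of_forall (fun y => ?_)
    apply Measurable.aestronglyMeasurable
    refine Measurable.mul ?_ ?_
    · fun_prop
    · exact h.meas.comp (by unfold cp; fun_prop)
  · have e1 : ∀ᶠ y in 𝓝 x, y < rl b := eventually_lt_nhds hx
    have e2 : ∀ᶠ y in 𝓝 x, |y - x| < 1 := by
      have := Metric.ball_mem_nhds x one_pos
      filter_upwards [this] with y hy
      simpa [Real.dist_eq] using hy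
    filter_upwards [e1, e2] with y hy hy2
    refine Eventually.of_forall (fun θ _ => ?_)
    rw [norm_mul, norm_cexp_j]
    have hG := h.bd (cp y θ) (by rw [norm_cp]; exact hxb y hy)
    have : -(j:ℝ) * y ≤ |(j:ℝ)| * (|x| + 1) := by
      calc -(j:ℝ) * y ≤ |-(j:ℝ) * y| := le_abs_self _
        _ = |(j:ℝ)| * |y| := by rw [abs_mul, abs_neg]
        _ ≤ _ := by
          have : |y| ≤ |x| + 1 := by
            calc |y| = |x + (y - x)| := by ring_nf
              _ ≤ |x| + |y - x| := abs_add_le _ _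
              _ ≤ _ := by linarith
          gcongr
    gcongr
  · exact intervalIntegrable_const
  · have := (cp_countable x p).ae_notMem volume
    filter_upwards [this] with θ hθ _
    have hθ : cp x θ ≠ p := hθ
    have hd := (h.der (cp x θ) (by rw [norm_cp]; exact hxb x hx) hθ).continuousAt
    refine ContinuousAt.mul (by fun_prop) ?_
    exact ContinuousAt.comp (f := fun y => cp y θ) (g := G) hd (by unfold cp; fun_prop)

def kap (j : ℤ) : ℝ := if j = -1 then 1 else 2 / |(j:ℝ) + 1|

theorem kap_nonneg (j : ℤ) : 0 ≤ kap j := by unfold kap; split_ifs <;> positivity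

theorem four_decay (φ : ℝ → ℂ) (hper : Function.Periodic φ (2 * pπ)) (hc : Continuous φ) (A : ℝ) (hA : 0 ≤ A)
    (hbd : ∀ θ, ‖φ θ‖ ≤ A) (hl : ∀ θ s, 0 ≤ s → ‖φ θ - φ (θ + s)‖ ≤ A * s) (n : ℤ) :
    ‖∫ θ in (0:ℝ)..(2 * pπ), cexp (-(n:ℂ) * (θ * I)) * φ θ‖ ≤ 2 * pπ * A * kap (n - 1) := by
  unfold kap
  split_ifs with hn
  · have := intervalIntegral.norm_integral_le_of_norm_le_const (a := 0) (b := 2 * pπ) (C := A)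
      (f := fun θ : ℝ => cexp (-(n:ℂ) * (θ * I)) * φ θ) (by
        intro θ _
        have : ‖cexp (-(n:ℂ) * (θ * I))‖ = 1 := by simp [Complex.norm_exp]
        rw [norm_mul, this, one_mul]; exact hbd θ)
    rw [sub_zero, abs_of_pos Real.two_pi_pos] at this
    linarith
  · have hn0 : n ≠ 0 := by omega
    -- positive shift
    have hna : (0:ℝ) < |(n:ℝ)| := by positivity
    set s : ℝ := pπ / |(n:ℝ)| with hs
    have hs0 : 0 ≤ s := by positivity
    have hexp : ∀ θ : ℝ, cexp (-(n:ℂ) * (((θ + s : ℝ):ℂ) * I)) = - cexp (-(n:ℂ) * (θ * I)) := by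
      intro θ
      have : (n:ℝ) * s = pπ ∨ (n:ℝ) * s = -pπ := by
        rcases abs_cases (n:ℝ) with ⟨h1, _⟩ | ⟨h1, _⟩
        · left; rw [hs, h1]; field_simp
        · right; rw [hs, h1]; field_simp
      push_cast
      rw [show -(n:ℂ) * (((θ:ℂ) + s) * I) = -(n:ℂ) * (θ * I) + -(((n:ℝ) * s : ℝ) : ℂ) * I by push_cast; ring, Complex.exp_add]
      rcases this with h1 | h1 <;> rw [h1]
      · rw [show (-((pπ:ℝ):ℂ) * I) = -(pπ * I) by ring, Complex.exp_neg, Complex.exp_pi_mul_I]; norm_num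
      · push_cast; rw [neg_neg, Complex.exp_pi_mul_I]; ring
    set f : ℝ → ℂ := fun θ => cexp (-(n:ℂ) * (θ * I)) * φ θ with hf
    have hfper : Function.Periodic f (2 * pπ) := by
      intro θ
      simp only [hf]
      rw [hper]
      congr 1
      push_cast
      rw [show -(n:ℂ) * (((θ:ℂ) + 2 * pπ) * I) = -(n:ℂ) * (θ * I) + ((-n : ℤ) : ℂ) * (2 * pπ * I) by push_cast; ring]
      rw [Complex.exp_add, Complex.exp_int_mul_two_pi_mul_I, mul_one]
    have hfc : Continuous f := by simp only [hf]; fun_prop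
    have hshift : ∫ θ in (0:ℝ)..(2 * pπ), f (θ + s) = ∫ θ in (0:ℝ)..(2 * pπ), f θ := by
      rw [intervalIntegral.integral_comp_add_right, zero_add, add_comm (2 * pπ) s]
      have := hfper.intervalIntegral_add_eq s 0
      rwa [zero_add] at this
    have h2 : 2 * ∫ θ in (0:ℝ)..(2 * pπ), f θ = ∫ θ in (0:ℝ)..(2 * pπ), cexp (-(n:ℂ) * (θ * I)) * (φ θ - φ (θ + s)) := by
      rw [two_mul]
      nth_rewrite 2 [← hshift]
      rw [← intervalIntegral.integral_add (hfc.intervalIntegrable _ _) ((show Continuous fun θ => f (θ + s) from hfc.comp (by fun_prop)).intervalIntegrable _ _)]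
      apply intervalIntegral.integral_congr
      intro θ _
      simp only [hf]
      rw [hexp]; ring
    have h3 : ‖∫ θ in (0:ℝ)..(2 * pπ), cexp (-(n:ℂ) * (θ * I)) * (φ θ - φ (θ + s))‖ ≤ A * s * (2 * pπ) := by
      have := intervalIntegral.norm_integral_le_of_norm_le_const (a := 0) (b := 2 * pπ) (C := A * s)
        (f := fun θ : ℝ => cexp (-(n:ℂ) * (θ * I)) * (φ θ - φ (θ + s))) (by
          intro θ _
          have : ‖cexp (-(n:ℂ) * (θ * I))‖ = 1 := by simp [Complex.norm_exp]
          rw [norm_mul, this, one_mul]; exact hl θ s hs0)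
      rwa [sub_zero, abs_of_pos Real.two_pi_pos] at this
    rw [← h2, norm_mul] at h3
    have h4 : s ≤ 4 / |(n:ℝ)| := by rw [hs]; gcongr; exact Real.pi_le_four
    have h5 : A * s * (2 * pπ) ≤ A * (4 / |(n:ℝ)|) * (2 * pπ) := by gcongr
    rw [show ((n - 1 : ℤ):ℝ) + 1 = n by push_cast; ring]
    have h6 : ‖(2:ℂ)‖ = 2 := by simp
    rw [h6] at h3
    have : 2 * pπ * A * (2 / |(n:ℝ)|) = A * (4 / |(n:ℝ)|) * (2 * pπ) / 2 := by ring
    rw [this]; linarith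

end OneVar

section OneVar2
open Complex MeasureTheory Filter Topology

variable {G ψ : ℂ → ℂ} {G' : ℂ → ℂ →L[ℝ] ℂ} {p : ℂ} {b M B : ℝ}

theorem clm_expand (L : ℂ →L[ℝ] ℂ) (e : ℂ) : L e = e.re * L 1 + e.im * L I := by
  have h : e = e.re • (1:ℂ) + e.im • I := by
    apply Complex.ext <;> simp
  conv_lhs => rw [h]
  rw [map_add, map_smul, map_smul]; simp

theorem OneV.psi_cont (h : OneV G ψ G' p b M B) : ContinuousOn ψ {ζ | ‖ζ‖ < b} := by
  have : LipschitzOnWith (Real.toNNReal B) ψ {ζ | ‖ζ‖ < b} := by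
    apply LipschitzOnWith.of_dist_le_mul
    intro x hx y hy
    rw [dist_eq_norm, dist_eq_norm, Real.coe_toNNReal _ h.B0]
    exact h.lip x y hx hy
  exact this.continuousOn

theorem cp_shift (x θ s : ℝ) (hs : 0 ≤ s) : ‖cp x θ - cp x (θ + s)‖ ≤ rx x * s := by
  have : cp x (θ + s) = cp x θ * cexp (I * s) := by
    unfold cp; rw [← Complex.exp_add]; push_cast; ring_nf
  rw [this, show cp x θ - cp x θ * cexp (I * s) = - (cp x θ * (cexp (I * s) - 1)) by ring, norm_neg, norm_mul, norm_cp]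
  have := Real.norm_exp_I_mul_ofReal_sub_one_le (x := s)
  rw [Real.norm_of_nonneg hs] at this
  gcongr

theorem OneV.inner_bd (h : OneV G ψ G' p b M B) (j : ℤ) (x : ℝ) (hx : x < rl b) :
    ‖∫ θ in (0:ℝ)..(2 * pπ), 2 * I * (cexp (-(j:ℂ) * ((x:ℂ) + (θ:ℂ) * I)) * (cj (cp x θ) * ψ (cp x θ)))‖
      ≤ 4 * pπ * B * kap j * rx ((3/2 - j) * x) := by
  have hb := h.b0
  have hxb : rx x < b := (Real.lt_log_iff_exp_lt hb).mp hx
  have hx0 : x ≤ 0 := by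
    have := h.b1
    have := Real.log_nonpos hb.le this
    linarith
  have hcb : ∀ θ, ‖cp x θ‖ < b := fun θ => by rw [norm_cp]; exact hxb
  have hfd := four_decay (fun θ => ψ (cp x θ)) (fun θ => by simp only [cp_periodic x θ])
    (by
      refine h.psi_cont.comp_continuous ?_ hcb
      unfold cp; fun_prop) (B * rx x) (mul_nonneg h.B0 (Real.exp_pos _).le)
    (fun θ => by
      have := h.lip (cp x θ) 0 (hcb θ) (by simpa using hb)
      rw [h.psi0, sub_zero, sub_zero, norm_cp] at this
      exact this)
    (fun θ s hs => by
      refine (h.lip _ _ (hcb _) (hcb _)).trans ?_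
      have := cp_shift x θ s hs
      rw [mul_assoc]
      exact mul_le_mul_of_nonneg_left this h.B0) (j+1)
  rw [show j + 1 - 1 = j by ring] at hfd
  have heq : (∫ θ in (0:ℝ)..(2 * pπ), 2 * I * (cexp (-(j:ℂ) * ((x:ℂ) + (θ:ℂ) * I)) * (cj (cp x θ) * ψ (cp x θ))))
      = (2 * I * cexp ((1 - j) * x)) * ∫ θ in (0:ℝ)..(2 * pπ), cexp (-((j+1:ℤ):ℂ) * (θ * I)) * ψ (cp x θ) := by
    rw [← intervalIntegral.integral_const_mul]
    apply intervalIntegral.integral_congr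
    intro θ _
    simp only
    have : cj (cp x θ) = cexp ((x:ℂ) - θ * I) := by
      unfold cp; rw [← Complex.exp_conj]; simp [sub_eq_add_neg]
    rw [this]
    have e : cexp (-(j:ℂ) * ((x:ℂ) + (θ:ℂ) * I)) * cexp ((x:ℂ) - θ * I) = cexp ((1 - j) * x) * cexp (-((j+1:ℤ):ℂ) * (θ * I)) := by
      rw [← Complex.exp_add, ← Complex.exp_add]; congr 1; push_cast; ring
    linear_combination (2 * I * ψ (cp x θ)) * e
  rw [heq, norm_mul]
  have hn : ‖2 * I * cexp ((1 - j) * x)‖ = 2 * rx ((1 - j) * x) := by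
    rw [norm_mul, norm_mul, Complex.norm_exp]; simp
  rw [hn]
  calc 2 * rx ((1 - j) * x) * ‖∫ θ in (0:ℝ)..(2 * pπ), cexp (-((j+1:ℤ):ℂ) * (θ * I)) * ψ (cp x θ)‖
      ≤ 2 * rx ((1 - j) * x) * (2 * pπ * (B * rx x) * kap j) := by gcongr
    _ = 4 * pπ * B * kap j * rx ((2 - j) * x) := by
        rw [show ((2:ℝ) - j) * x = (1 - j) * x + x by ring, Real.exp_add]; ring
    _ ≤ _ := by
        have := kap_nonneg j
        have hB := h.B0
        apply mul_le_mul_of_nonneg_left _ (by positivity)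
        apply Real.exp_le_exp.mpr; nlinarith

theorem OneV.green (h : OneV G ψ G' p b M B) (j : ℤ) (x1 x2 : ℝ) (h12 : x1 ≤ x2) (hx : x2 < rl b)
    (hp : ∀ x ∈ Icc x1 x2, rx x ≠ ‖p‖) :
    ‖Em G j x2 - Em G j x1‖ ≤ ∫ x in x1..x2, 4 * pπ * B * kap j * rx ((3/2 - j) * x) := by
  have hb := h.b0
  set f : ℂ → ℂ := fun ξ => cexp (-(j:ℂ) * ξ) * G (cexp ξ) with hf
  set f' : ℂ → ℂ →L[ℝ] ℂ := fun ξ =>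
    cexp (-(j:ℂ) * ξ) • ((G' (cexp ξ)).comp ((cexp ξ • (1 : ℂ →L[ℂ] ℂ)).restrictScalars ℝ)) +
     G (cexp ξ) • (((-(j:ℂ) * cexp (-(j:ℂ) * ξ)) • (1 : ℂ →L[ℂ] ℂ)).restrictScalars ℝ) with hf'
  have hmem : ∀ ξ : ℂ, ξ.re ∈ Icc x1 x2 → ‖cexp ξ‖ < b ∧ cexp ξ ≠ p := by
    intro ξ hξ
    refine ⟨?_, ?_⟩
    · rw [Complex.norm_exp]
      exact (Real.lt_log_iff_exp_lt hb).mp (lt_of_le_of_lt hξ.2 hx)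
    · intro he
      apply hp ξ.re hξ
      rw [← he, Complex.norm_exp]
  have hder : ∀ ξ : ℂ, ξ.re ∈ Icc x1 x2 → HasFDerivAt f (f' ξ) ξ := by
    intro ξ hξ
    obtain ⟨m1, m2⟩ := hmem ξ hξ
    have d1 : HasDerivAt (fun ξ => cexp (-(j:ℂ) * ξ)) (-(j:ℂ) * cexp (-(j:ℂ) * ξ)) ξ := by
      have := ((hasDerivAt_id ξ).const_mul (-(j:ℂ))).cexp
      refine this.congr_deriv ?_; simp; ring
    have d2 : HasFDerivAt cexp ((cexp ξ • (1 : ℂ →L[ℂ] ℂ)).restrictScalars ℝ) ξ := by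
      have := (Complex.hasDerivAt_exp ξ).hasFDerivAt.restrictScalars ℝ
      refine this.congr_fderiv ?_
      ext <;> simp [mul_comm]
    have d3 := (h.der (cexp ξ) m1 m2).comp ξ d2
    have d1' := d1.hasFDerivAt.restrictScalars ℝ
    refine (d1'.mul d3).congr_fderiv ?_
    ext v
    simp [hf']
    left; ring
  have hdb : ∀ ξ : ℂ, ξ.re ∈ Icc x1 x2 → I • f' ξ 1 - f' ξ I = 2 * I * (cexp (-(j:ℂ) * ξ) * (cj (cexp ξ) * ψ (cexp ξ))) := by
    intro ξ hξ
    obtain ⟨m1, m2⟩ := hmem ξ hξ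
    have hd := h.dbar _ m1 m2
    simp only [hf']
    simp only [add_apply, smul_apply, ContinuousLinearMap.comp_apply,
      ContinuousLinearMap.coe_restrictScalars', one_apply_eq_self, smul_eq_mul, mul_one]
    set e := cexp ξ with he
    rw [clm_expand (G' e) e, clm_expand (G' e) (e * I)]
    have hc : cj e = (e.re : ℂ) - e.im * I := by
      apply Complex.ext <;> simp
    rw [hc]
    simp only [mul_re, mul_im, I_re, I_im, mul_zero, mul_one, zero_sub, add_zero]
    push_cast
    have I2 := Complex.I_mul_I
    linear_combination (I * cexp (-(j:ℂ) * ξ) * ((e.re:ℂ) - e.im * I)) * hd + (cexp (-(j:ℂ) * ξ)) * (e.im * (G' e 1) - e.re * (G' e I) + I * e.im * (G' e I)) * I2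
  have hreeq : ∀ y : ℂ, y ∈ ((uIcc ((x1:ℂ)).re ((x2:ℂ) + (2*pπ:ℝ) * I).re) ×ℂ (uIcc ((x1:ℂ)).im ((x2:ℂ) + (2*pπ:ℝ) * I).im)) → y.re ∈ Icc x1 x2 := by
    intro y hy
    have := hy.1
    simp only [mem_preimage] at this
    simpa [uIcc_of_le h12] using this
  have hcomp : IsCompact ((uIcc ((x1:ℂ)).re ((x2:ℂ) + (2*pπ:ℝ) * I).re) ×ℂ (uIcc ((x1:ℂ)).im ((x2:ℂ) + (2*pπ:ℝ) * I).im)) :=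
    isCompact_uIcc.reProdIm isCompact_uIcc
  have green := integral_boundary_rect_of_hasFDerivAt_real_off_countable f f' (x1:ℂ) ((x2:ℂ) + (2*pπ:ℝ) * I) ∅ countable_empty
    (fun y hy => (hder y (hreeq y hy)).continuousAt.continuousWithinAt)
    (by
      intro y hy
      apply hder
      have := hy.1.1
      simp [h12] at this
      exact ⟨this.1.le, this.2.le⟩)
    (by
      refine (IntegrableOn.congr_fun (f := fun ξ => 2 * I * (cexp (-(j:ℂ) * ξ) * (cj (cexp ξ) * ψ (cexp ξ)))) ?_ (fun y hy => (hdb y (hreeq y hy)).symm) hcomp.measurableSet)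
      apply ContinuousOn.integrableOn_compact hcomp
      have hψ : ContinuousOn (fun ξ => ψ (cexp ξ)) ((uIcc ((x1:ℂ)).re ((x2:ℂ) + (2*pπ:ℝ) * I).re) ×ℂ (uIcc ((x1:ℂ)).im ((x2:ℂ) + (2*pπ:ℝ) * I).im)) :=
        h.psi_cont.comp (by fun_prop) (fun y hy => (hmem y (hreeq y hy)).1)
      have hcj : Continuous (fun ξ : ℂ => cj (cexp ξ)) := Complex.continuous_conj.comp Complex.continuous_exp
      refine ContinuousOn.mul (by fun_prop) (ContinuousOn.mul (by fun_prop) (hcj.continuousOn.mul hψ)))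
  have hfper : ∀ x : ℝ, f (x + (2*pπ:ℝ) * I) = f x := by
    intro x
    simp only [hf]
    push_cast
    rw [Complex.exp_periodic]
    congr 1
    rw [show -(j:ℂ) * ((x:ℂ) + 2 * pπ * I) = -(j:ℂ) * x + ((-j : ℤ) : ℂ) * (2 * pπ * I) by push_cast; ring]
    rw [Complex.exp_add, Complex.exp_int_mul_two_pi_mul_I, mul_one]
  simp only [ofReal_re, ofReal_im, add_re, add_im, mul_re, mul_im, I_re, I_im, mul_zero, mul_one, zero_mul, sub_zero, add_zero, zero_add, ofReal_zero] at green
  simp only [hfper, sub_self, zero_add] at green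
  have hE : ∀ x : ℝ, ∫ y in (0:ℝ)..(2*pπ), f (x + y * I) = Em G j x := fun x => rfl
  rw [hE, hE] at green
  rw [← smul_sub] at green
  have hnorm : ‖Em G j x2 - Em G j x1‖ = ‖I • (Em G j x2 - Em G j x1)‖ := by
    rw [norm_smul]; simp
  rw [hnorm, green]
  apply intervalIntegral.norm_integral_le_of_norm_le h12
  · refine Eventually.of_forall (fun x hx' => ?_)
    have hxI : x ∈ Icc x1 x2 := ⟨hx'.1.le, hx'.2⟩
    refine le_trans (le_of_eq ?_) (h.inner_bd j x (lt_of_le_of_lt hx'.2 hx))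
    congr 1
    apply intervalIntegral.integral_congr
    intro y _
    simp only
    rw [hdb _ (by simpa using hxI)]; rfl
  · apply Continuous.intervalIntegrable; fun_prop

end OneVar2

section OneVar3
open Complex MeasureTheory Filter Topology

variable {G ψ : ℂ → ℂ} {G' : ℂ → ℂ →L[ℝ] ℂ} {p : ℂ} {b M B : ℝ}

theorem cross_point (E : ℝ → ℂ) (P : ℝ → ℝ) (ℓ q : ℝ) (hE : ∀ x < ℓ, ContinuousAt E x) (hP : Continuous P)
    (h : ∀ x1 x2, x1 ≤ x2 → x2 < ℓ → q ∉ Icc x1 x2 → ‖E x2 - E x1‖ ≤ P x2 - P x1) :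
    ∀ x1 x2, x1 ≤ x2 → x2 < ℓ → ‖E x2 - E x1‖ ≤ P x2 - P x1 := by
  intro x1 x2 h12 hx2
  by_cases hq : q ∈ Icc x1 x2
  swap
  · exact h x1 x2 h12 hx2 hq
  have r1 : ‖E x2 - E q‖ ≤ P x2 - P q := by
    rcases hq.2.eq_or_lt with e | e
    · rw [e]; simp
    · have hc : Tendsto (fun y => P x2 - P y - ‖E x2 - E y‖) (𝓝[>] q) (𝓝 (P x2 - P q - ‖E x2 - E q‖)) := by
        have := (hE q (lt_trans e hx2))
        have h2 : ContinuousAt (fun y => P x2 - P y - ‖E x2 - E y‖) q :=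
          (continuousAt_const.sub hP.continuousAt).sub (continuousAt_const.sub this).norm
        exact h2.tendsto.mono_left nhdsWithin_le_nhds
      have := ge_of_tendsto (b := 0) hc (by
        filter_upwards [Ioo_mem_nhdsGT e] with y hy
        have := h y x2 hy.2.le hx2 (fun hh => absurd hh.1 (not_le.mpr hy.1))
        linarith)
      linarith
  have r2 : ‖E q - E x1‖ ≤ P q - P x1 := by
    rcases hq.1.eq_or_lt with e | e
    · rw [e]; simp
    · have hc : Tendsto (fun y => P y - P x1 - ‖E y - E x1‖) (𝓝[<] q) (𝓝 (P q - P x1 - ‖E q - E x1‖)) := by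
        have := (hE q (lt_of_le_of_lt hq.2 hx2))
        have h2 : ContinuousAt (fun y => P y - P x1 - ‖E y - E x1‖) q :=
          (hP.continuousAt.sub continuousAt_const).sub (this.sub continuousAt_const).norm
        exact h2.tendsto.mono_left nhdsWithin_le_nhds
      have := ge_of_tendsto (b := 0) hc (by
        filter_upwards [Ioo_mem_nhdsLT e] with y hy
        have := h x1 y hy.1.le (by linarith [hy.2, hq.2]) (fun hh => absurd hh.2 (not_le.mpr hy.2))
        linarith)
      linarith
  calc ‖E x2 - E x1‖ = ‖(E x2 - E q) + (E q - E x1)‖ := by ring_nf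
    _ ≤ ‖E x2 - E q‖ + ‖E q - E x1‖ := norm_add_le _ _
    _ ≤ _ := by linarith

def Pj (B : ℝ) (j : ℤ) (x : ℝ) : ℝ := 4 * pπ * B * kap j * (rx ((3/2 - j) * x) / (3/2 - j))

theorem half_ne (j : ℤ) : (3/2 - (j:ℝ)) ≠ 0 := by
  intro h
  have h1 : (3:ℝ) = 2 * j := by linarith
  have h2 : (3:ℤ) = 2 * j := by exact_mod_cast h1
  omega

theorem OneV.Em_diff (h : OneV G ψ G' p b M B) (j : ℤ) : ∀ x1 x2, x1 ≤ x2 → x2 < rl b →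
    ‖Em G j x2 - Em G j x1‖ ≤ Pj B j x2 - Pj B j x1 := by
  refine cross_point (Em G j) (Pj B j) (rl b) (rl ‖p‖) (fun x hx => h.Em_cont j x hx) (by unfold Pj; fun_prop) ?_
  intro x1 x2 h12 hx hq
  refine (h.green j x1 x2 h12 hx ?_).trans (le_of_eq ?_)
  · intro x hx he
    apply hq
    rw [← he, Real.log_exp]; exact hx
  · have hder : ∀ x : ℝ, HasDerivAt (Pj B j) (4 * pπ * B * kap j * rx ((3/2 - j) * x)) x := by
      intro x
      have h1 := (((((hasDerivAt_id x).const_mul (3/2 - (j:ℝ))).exp).div_const (3/2 - (j:ℝ))).const_mul (4 * pπ * B * kap j))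
      refine h1.congr_deriv ?_
      have := half_ne j
      simp only [id, mul_one]
      rw [mul_div_assoc, div_self this, mul_one]
    rw [intervalIntegral.integral_eq_sub_of_hasDerivAt (fun x _ => hder x)]
    apply Continuous.intervalIntegrable; fun_prop

theorem OneV.Em_low (h : OneV G ψ G' p b M B) (j : ℤ) (hj : j ≤ 1) (x : ℝ) (hx : x < rl b) :
    ‖Em G j x‖ ≤ Pj B j x := by
  apply le_of_forall_pos_le_add
  intro ε hε
  obtain ⟨δ, hδ, hs⟩ := h.small (ε / (2 * pπ)) (by positivity)
  set y := min (min x (-1)) (rl (δ/2)) with hy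
  have y1 : y ≤ x := (min_le_left _ _).trans (min_le_left _ _)
  have y2 : y ≤ -1 := (min_le_left _ _).trans (min_le_right _ _)
  have y3 : rx y ≤ δ / 2 := (Real.le_log_iff_exp_le (by positivity)).mp (min_le_right _ _)
  have h1 := h.Em_diff j y x y1 hx
  have h2 := Em_norm_le G j y (ε / (2 * pπ) * rx y) (fun θ => by
    have := hs (cp y θ) (by rw [norm_cp]; linarith)
    rwa [norm_cp] at this)
  have hj' : (j:ℝ) ≤ 1 := by exact_mod_cast hj
  have h3 : rx (-j * y) * (ε / (2 * pπ) * rx y) * (2 * pπ) ≤ ε := by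
    have : rx (-j * y) * (ε / (2 * pπ) * rx y) * (2 * pπ) = ε * rx ((1 - j) * y) := by
      rw [show (1 - (j:ℝ)) * y = -j * y + y by ring, Real.exp_add]; field_simp
    rw [this]
    have : rx ((1 - j) * y) ≤ 1 := Real.exp_le_one_iff.mpr (by nlinarith)
    nlinarith
  have h4 : 0 ≤ Pj B j y := by
    unfold Pj
    have := kap_nonneg j
    have := h.B0
    have : 0 < 3/2 - (j:ℝ) := by linarith
    positivity
  calc ‖Em G j x‖ = ‖(Em G j x - Em G j y) + Em G j y‖ := by ring_nf
    _ ≤ ‖Em G j x - Em G j y‖ + ‖Em G j y‖ := norm_add_le _ _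
    _ ≤ _ := by linarith

theorem kap_sum (j : ℤ) : kap j / |3/2 - (j:ℝ)| ≤ 20 / (1 + (j:ℝ)^2) := by
  have h0 := abs_pos.mpr (half_ne j)
  rw [div_le_div_iff₀ h0 (by positivity)]
  unfold kap
  split_ifs with hj
  · subst hj; norm_num
  · have hj1 : ((j:ℝ) + 1) ≠ 0 := by
      intro h; apply hj
      have : (j:ℝ) = ((-1:ℤ):ℝ) := by push_cast; linarith
      exact_mod_cast this
    rw [div_mul_eq_mul_div, div_le_iff₀ (abs_pos.mpr hj1), mul_assoc, ← abs_mul]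
    have : 1 + (j:ℝ)^2 ≤ 10 * |(3/2 - (j:ℝ)) * (j + 1)| := by
      by_cases h2 : 2 ≤ j ∨ j ≤ -2
      · have := neg_abs_le ((3/2 - (j:ℝ)) * (j + 1))
        rcases h2 with h2 | h2
        · have : (2:ℝ) ≤ j := by exact_mod_cast h2
          nlinarith
        · have : (j:ℝ) ≤ -2 := by exact_mod_cast h2
          nlinarith
      · have : j = 0 ∨ j = 1 := by omega
        have := le_abs_self ((3/2 - (j:ℝ)) * (j + 1))
        rcases ‹j = 0 ∨ j = 1› with rfl | rfl
        · norm_num at this ⊢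
        · norm_num at this ⊢
    linarith

theorem geo_sum (n : ℕ) : (1/2 : ℝ)^n ≤ 20 / (1 + ((n:ℝ) + 2)^2) := by
  rw [le_div_iff₀ (by positivity)]
  have : 1 + ((n:ℝ) + 2)^2 ≤ 20 * 2^n := by
    induction n with
    | zero => norm_num
    | succ n ih =>
      rw [pow_succ 2 n]; push_cast
      have : (0:ℝ) ≤ n := by positivity
      nlinarith
  calc (1/2 : ℝ)^n * (1 + ((n:ℝ) + 2)^2) ≤ (1/2 : ℝ)^n * (20 * 2^n) := by gcongr
    _ = 20 := by rw [one_div, inv_pow]; field_simp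

theorem Pj_scale (j : ℤ) (x : ℝ) (hB : 0 ≤ B) : rx (j * x) * |Pj B j x| / (2 * pπ) ≤ 40 * B * rx (3/2 * x) / (1 + (j:ℝ)^2) := by
  have h1 : rx (j * x) * |Pj B j x| / (2 * pπ) = 2 * B * rx (3/2 * x) * (kap j / |3/2 - (j:ℝ)|) := by
    unfold Pj
    have hk := kap_nonneg j
    rw [abs_mul, abs_div, abs_of_pos (Real.exp_pos _), abs_of_nonneg (by positivity)]
    rw [show (3/2:ℝ) * x = j * x + (3/2 - j) * x by ring, Real.exp_add]
    field_simp; ring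
  rw [h1]
  calc 2 * B * rx (3/2 * x) * (kap j / |3/2 - (j:ℝ)|) ≤ 2 * B * rx (3/2 * x) * (20 / (1 + (j:ℝ)^2)) := by
        have := kap_sum j; gcongr
    _ = _ := by ring

theorem OneV.mode (h : OneV G ψ G' p b M B) (j : ℤ) (x : ℝ) (hx : rx x ≤ b/4) :
    rx (j * x) * ‖Em G j x‖ / (2 * pπ) ≤ (40 * B + 80 * M / b^2) * rx (3/2 * x) / (1 + (j:ℝ)^2) := by
  have hb := h.b0
  have hb1 := h.b1
  have hM : 0 ≤ M := (norm_nonneg _).trans (h.bd 0 (by simpa using hb))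
  have hxb : x < rl b := (Real.lt_log_iff_exp_lt hb).mpr (by linarith)
  have hx0 : x ≤ 0 := by
    by_contra hh
    have := Real.one_le_exp (not_le.mp hh).le
    linarith
  have hsc := Pj_scale (B := B) j x h.B0
  have hle : 40 * B * rx (3/2 * x) / (1 + (j:ℝ)^2) ≤ (40 * B + 80 * M / b^2) * rx (3/2 * x) / (1 + (j:ℝ)^2) := by
    gcongr
    have : 0 ≤ 80 * M / b^2 := by positivity
    linarith
  by_cases hj : j ≤ 1
  · refine le_trans ?_ (hsc.trans hle)
    have := (h.Em_low j hj x hxb).trans (le_abs_self _)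
    gcongr
  · have hj2 : 2 ≤ j := by omega
    obtain ⟨n, rfl⟩ : ∃ n : ℕ, j = n + 2 := ⟨(j - 2).toNat, by omega⟩
    set j : ℤ := n + 2 with hjd
    have hjr : (j:ℝ) = n + 2 := by rw [hjd]; push_cast; ring
    set y := rl (b/2) with hy
    have hey : rx y = b/2 := Real.exp_log (by positivity)
    have hyb : y < rl b := Real.log_lt_log (by positivity) (by linarith)
    have hxy : x ≤ y := (Real.le_log_iff_exp_le (by positivity)).mpr (by linarith)
    have h1 := h.Em_diff j x y hxy hyb
    have h2 := Em_norm_le G j y M (fun θ => h.bd _ (by rw [norm_cp, hey]; linarith))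
    have hn : 3/2 - (j:ℝ) < 0 := by rw [hjr]; have : (0:ℝ) ≤ n := by positivity
                                    linarith
    have hneg : ∀ x, Pj B j x ≤ 0 := by
      intro x
      unfold Pj
      have := kap_nonneg j
      have := h.B0
      apply mul_nonpos_of_nonneg_of_nonpos (by positivity)
      exact div_nonpos_of_nonneg_of_nonpos (Real.exp_pos _).le hn.le
    have h3 : ‖Em G j x‖ ≤ |Pj B j x| + rx (-j * y) * M * (2 * pπ) := by
      rw [abs_of_nonpos (hneg x)]
      have := hneg y
      calc ‖Em G j x‖ = ‖Em G j y - (Em G j y - Em G j x)‖ := by ring_nf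
        _ ≤ ‖Em G j y‖ + ‖Em G j y - Em G j x‖ := norm_sub_le _ _
        _ ≤ _ := by linarith
    have h4 : rx (j * x) * (rx (-j * y) * M * (2 * pπ)) / (2 * pπ) ≤ 80 * M / b^2 * rx (3/2 * x) / (1 + (j:ℝ)^2) := by
      have e1 : rx (j * x) * (rx (-j * y) * M * (2 * pπ)) / (2 * pπ) = M * (rx (x - y))^(n+2) := by
        rw [← Real.exp_nat_mul, show ((n+2:ℕ):ℝ) * (x - y) = j * x + -j * y by rw [hjr]; push_cast; ring, Real.exp_add]
        field_simp
      rw [e1, pow_add]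
      have e2 : rx (x - y) = rx x / (b/2) := by rw [Real.exp_sub, hey]
      have e3 : rx (x - y) ≤ 1/2 := by rw [e2, div_le_iff₀ (by positivity)]; linarith
      have e4 : rx (x - y)^n ≤ 20 / (1 + (j:ℝ)^2) := by
        rw [hjr]
        exact (pow_le_pow_left₀ (Real.exp_pos _).le e3 n).trans (geo_sum n)
      have e5 : rx (x-y)^2 ≤ 4 / b^2 * rx (3/2*x) := by
        rw [e2, div_pow, ← Real.exp_nat_mul]
        have : rx ((2:ℕ) * x) ≤ rx (3/2*x) := Real.exp_le_exp.mpr (by push_cast; linarith)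
        calc rx ((2:ℕ) * x) / (b/2)^2 ≤ rx (3/2*x) / (b/2)^2 := by gcongr
          _ = _ := by field_simp; norm_num
      calc M * (rx (x - y)^n * rx (x-y)^2) ≤ M * (20 / (1 + (j:ℝ)^2) * (4 / b^2 * rx (3/2*x))) := by gcongr
        _ = _ := by ring
    calc rx (j * x) * ‖Em G j x‖ / (2 * pπ) ≤ rx (j * x) * (|Pj B j x| + rx (-j * y) * M * (2 * pπ)) / (2 * pπ) := by gcongr
      _ = rx (j * x) * |Pj B j x| / (2 * pπ) + rx (j * x) * (rx (-j * y) * M * (2 * pπ)) / (2 * pπ) := by ring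
      _ ≤ 40 * B * rx (3/2 * x) / (1 + (j:ℝ)^2) + 80 * M / b^2 * rx (3/2 * x) / (1 + (j:ℝ)^2) := add_le_add hsc h4
      _ = _ := by ring

theorem summable_Z : Summable (fun j : ℤ => 1 / (1 + (j:ℝ)^2)) := by
  have h := (Real.summable_one_div_int_pow (p := 2)).mpr (by norm_num)
  have h2 : Summable (fun j : ℤ => if j = 0 then (1:ℝ) else 0) := by
    apply summable_of_ne_finset_zero (s := {0})
    intro j hj; simp at hj; simp [hj]
  refine Summable.of_nonneg_of_le (fun j => by positivity) (fun j => ?_) (h.add h2)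
  by_cases hj : j = 0
  · simp [hj]
  · have : (0:ℝ) < (j:ℝ)^2 := by positivity
    simp only [hj, if_false, add_zero]
    apply one_div_le_one_div_of_le this; linarith

def ZZ : ℝ := ∑' j : ℤ, 1 / (1 + (j:ℝ)^2)

theorem ZZ_nonneg : 0 ≤ ZZ := tsum_nonneg (fun j => by positivity)

theorem OneV.value (h : OneV G ψ G' p b M B) (x θ0 : ℝ) (hx : rx x ≤ b/4) (hp : rx x ≠ ‖p‖) :
    ‖G (cp x θ0)‖ ≤ (40 * B + 80 * M / b^2) * rx (3/2 * x) * ZZ := by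
  have hb := h.b0
  have : Fact (0 < 2 * pπ) := ⟨Real.two_pi_pos⟩
  set g : AddCircle (2 * pπ) → ℂ := fun y => (rx x : ℂ) * (AddCircle.toCircle y : ℂ) with hg
  have hgn : ∀ y, ‖g y‖ = rx x := by
    intro y; simp only [hg]; rw [norm_mul, Circle.norm_coe, mul_one]
    rw [Complex.norm_real, Real.norm_of_nonneg (Real.exp_pos _).le]
  have hgc : Continuous g := by
    simp only [hg]
    exact continuous_const.mul (continuous_subtype_val.comp AddCircle.continuous_toCircle)
  have hgθ : ∀ θ : ℝ, g (θ : AddCircle (2 * pπ)) = cp x θ := by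
    intro θ
    simp only [hg]
    rw [AddCircle.toCircle_apply_mk, Circle.coe_exp]
    unfold cp
    rw [Complex.exp_add]
    congr 1
    · push_cast; rfl
    · congr 1
      have := Real.pi_ne_zero
      rw [div_self (by positivity), one_mul]
  let f : C(AddCircle (2 * pπ), ℂ) := ⟨fun y => G (g y), by
    rw [continuous_iff_continuousAt]
    intro y
    have hd := (h.der (g y) (by rw [hgn]; linarith) (by
      intro he; apply hp; rw [← hgn y, he])).continuousAt
    exact ContinuousAt.comp (f := g) (g := G) hd hgc.continuousAt⟩
  have hco : ∀ n : ℤ, ‖fourierCoeff f n‖ = rx (n * x) * ‖Em G n x‖ / (2 * pπ) := by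
    intro n
    rw [fourierCoeff_eq_intervalIntegral f n 0, zero_add]
    have : (∫ θ in (0:ℝ)..(2 * pπ), fourier (-n) (θ : AddCircle (2 * pπ)) • f θ) = cexp (n * x) * Em G n x := by
      unfold Em
      rw [← intervalIntegral.integral_const_mul]
      apply intervalIntegral.integral_congr
      intro θ _
      simp only
      rw [fourier_coe_apply, smul_eq_mul]
      have hfθ : f (θ : AddCircle (2 * pπ)) = G (cp x θ) := by
        change G (g _) = _
        rw [hgθ]
      rw [hfθ, ← mul_assoc, ← Complex.exp_add]
      congr 2
      have := Real.pi_ne_zero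
      push_cast
      field_simp
      ring
    rw [this, norm_smul, norm_mul, Complex.norm_exp]
    simp
    rw [abs_of_pos Real.pi_pos]
    ring
  have hbd : ∀ n : ℤ, ‖fourierCoeff f n‖ ≤ (40 * B + 80 * M / b^2) * rx (3/2 * x) * (1 / (1 + (n:ℝ)^2)) := by
    intro n
    rw [hco, mul_one_div]
    exact h.mode n x hx
  have hsum : Summable (fun n : ℤ => (40 * B + 80 * M / b^2) * rx (3/2 * x) * (1 / (1 + (n:ℝ)^2))) :=
    summable_Z.mul_left _
  have hs : Summable (fourierCoeff f) := Summable.of_norm_bounded hsum hbd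
  have hS := has_pointwise_sum_fourier_series_of_summable hs (θ0 : AddCircle (2 * pπ))
  have hfθ : f (θ0 : AddCircle (2 * pπ)) = G (cp x θ0) := by
    change G (g _) = _
    rw [hgθ]
  rw [hfθ] at hS
  unfold ZZ
  rw [← tsum_mul_left]
  refine hS.norm_le_of_bounded hsum.hasSum ?_
  intro n
  rw [norm_smul]
  have : ‖fourier n (θ0 : AddCircle (2 * pπ))‖ = 1 := Circle.norm_coe _
  rw [this, mul_one]
  exact hbd n

end OneVar3

section OneVar4
open Complex MeasureTheory Filter Topology

def CC (b M B : ℝ) : ℝ := (40 * B + 80 * (2 * M + (2 * M / b + 4 * B) + B) / b^2) * ZZ + (2 * M / b + 4 * B)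

theorem int_exp_n (n : ℤ) (hn : n ≠ 0) : ∫ θ in (0:ℝ)..(2 * pπ), cexp ((n * I) * θ) = 0 := by
  have h0 : (n:ℂ) * I ≠ 0 := mul_ne_zero (by exact_mod_cast hn) I_ne_zero
  rw [integral_exp_mul_complex h0]
  push_cast
  rw [show (n:ℂ) * I * (2 * pπ) = n * (2 * pπ * I) by ring, Complex.exp_int_mul_two_pi_mul_I]
  simp

theorem expand (g φ : ℂ → ℂ) (g' : ℂ → ℂ →L[ℝ] ℂ) (p : ℂ) (b M B : ℝ) (hb : 0 < b) (hb1 : b ≤ 1) (hB : 0 ≤ B)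
    (hp : p ≠ 0) (hbd : ∀ ζ, ‖ζ‖ < b → ζ ≠ p → ‖g ζ‖ ≤ M)
    (hder : ∀ ζ, ‖ζ‖ < b → ζ ≠ p → HasFDerivAt g (g' ζ) ζ)
    (hdbar : ∀ ζ, ‖ζ‖ < b → ζ ≠ p → g' ζ 1 + I * g' ζ I = 2 * φ ζ)
    (hlip : ∀ ζ ζ', ‖ζ‖ < b → ‖ζ'‖ < b → ‖φ ζ - φ ζ'‖ ≤ B * ‖ζ - ζ'‖) (hφ0 : ‖φ 0‖ ≤ B) :
    ∃ D : ℂ, ‖D‖ ≤ CC b M B ∧ ∀ ζ, ‖ζ‖ ≤ b/4 → ‖ζ‖ ≠ ‖p‖ →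
      ‖g ζ - g 0 - D * ζ - φ 0 * cj ζ‖ ≤ CC b M B * (‖ζ‖ * Real.sqrt ‖ζ‖) := by
  classical
  have h00 : ‖(0:ℂ)‖ < b := by simpa using hb
  have hM : 0 ≤ M := (norm_nonneg _).trans (hbd 0 h00 hp.symm)
  set s : Set ℂ := {ζ | ‖ζ‖ < b} \ {p} with hs
  have hso : IsOpen s := (isOpen_lt continuous_norm continuous_const).sdiff isClosed_singleton
  set gm : ℂ → ℂ := s.piecewise g (fun _ => 0) with hgm
  have hgms : ∀ ζ ∈ s, gm ζ = g ζ := fun ζ h => Set.piecewise_eq_of_mem _ _ _ h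
  have hgmM : ∀ ζ, ‖gm ζ‖ ≤ M := by
    intro ζ
    by_cases h : ζ ∈ s
    · rw [hgms ζ h]; exact hbd ζ h.1 h.2
    · rw [hgm, Set.piecewise_eq_of_notMem _ _ _ h]; simpa using hM
  have hgmeas : Measurable gm := by
    apply ContinuousOn.measurable_piecewise
    · intro ζ h; exact (hder ζ h.1 h.2).continuousAt.continuousWithinAt
    · exact continuousOn_const
    · exact hso.measurableSet
  set D : ℂ := (g' 0 1 - I * g' 0 I) / 2 with hD
  have hd0 := hdbar 0 h00 hp.symm
  set lin : ℂ → ℂ := fun ζ => g 0 + D * ζ + φ 0 * cj ζ with hlin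
  have hlinc : Continuous lin := by
    simp only [hlin]
    exact (continuous_const.add (continuous_const.mul continuous_id)).add (continuous_const.mul Complex.continuous_conj)
  set lin' : ℂ →L[ℝ] ℂ := D • (1 : ℂ →L[ℝ] ℂ) + φ 0 • (Complex.conjCLE : ℂ →L[ℝ] ℂ) with hlin'
  have hlin'a : ∀ v, lin' v = D * v + φ 0 * cj v := by
    intro v; simp [hlin']
  have hlind : ∀ ζ, HasFDerivAt lin lin' ζ := by
    intro ζ
    have : lin = fun ζ => g 0 + lin' ζ := by funext v; rw [hlin'a]; simp only [hlin]; ring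
    rw [this]
    exact (lin'.hasFDerivAt).const_add _
  have hg'0 : g' 0 = lin' := by
    ext v
    rw [hlin'a, clm_expand (g' 0) v]
    have hv : cj v = (v.re : ℂ) - v.im * I := by apply Complex.ext <;> simp
    have hv2 : v = (v.re : ℂ) + v.im * I := (Complex.re_add_im v).symm
    have : φ 0 = (g' 0 1 + I * g' 0 I) / 2 := by rw [hd0]; ring
    rw [hv, this, hD]
    conv_rhs => rw [hv2]
    simp only [add_re, ofReal_re, mul_re, ofReal_im, I_re, I_im, add_im, mul_im]
    simp only [mul_zero, mul_one, zero_add, add_zero, sub_zero]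
    linear_combination ((v.im:ℂ) * (g' 0) I) * Complex.I_mul_I
  have hone : ∀ M', 2 * M + ‖D‖ + B ≤ M' → OneV (fun ζ => gm ζ - lin ζ) (fun ζ => φ ζ - φ 0) (fun ζ => g' ζ - lin') p b M' B := by
    intro M' hM'
    have hgd : ∀ ζ, ‖ζ‖ < b → ζ ≠ p → HasFDerivAt (fun ζ => gm ζ - lin ζ) (g' ζ - lin') ζ := by
      intro ζ h1 h2
      refine HasFDerivAt.sub ?_ (hlind ζ)
      refine (hder ζ h1 h2).congr_of_eventuallyEq ?_
      filter_upwards [hso.mem_nhds ⟨h1, h2⟩] with w hw using hgms w hw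
    refine ⟨hgmeas.sub hlinc.measurable, hb, hb1, hB, ?_, hgd, ?_, ?_, by simp, ?_⟩
    · intro ζ hζ
      have e1 : ‖lin ζ‖ ≤ M + ‖D‖ + B := by
        simp only [hlin]
        have hz1 : ‖ζ‖ ≤ 1 := by linarith
        calc ‖g 0 + D * ζ + φ 0 * cj ζ‖ ≤ ‖g 0‖ + ‖D * ζ‖ + ‖φ 0 * cj ζ‖ := norm_add₃_le
          _ ≤ M + ‖D‖ * 1 + B * 1 := by
            rw [norm_mul, norm_mul, Complex.norm_conj]
            have := hbd 0 h00 hp.symm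
            gcongr
          _ = _ := by ring
      calc ‖gm ζ - lin ζ‖ ≤ ‖gm ζ‖ + ‖lin ζ‖ := norm_sub_le _ _
        _ ≤ _ := by have := hgmM ζ; linarith
    · intro ζ h1 h2
      have := hdbar ζ h1 h2
      simp only [sub_apply, hlin'a]
      simp only [map_one, mul_one, Complex.conj_I]
      linear_combination this - (D - φ 0) * Complex.I_mul_I
    · intro ζ ζ' h1 h2
      rw [sub_sub_sub_cancel_right]
      exact hlip ζ ζ' h1 h2
    · intro ε hε
      have h1 := (hgd 0 h00 hp.symm)
      rw [hg'0, sub_self] at h1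
      have h2 := h1.isLittleO.def hε
      obtain ⟨δ, hδ, h3⟩ := Metric.eventually_nhds_iff.mp h2
      refine ⟨δ, hδ, fun ζ hζ => ?_⟩
      have h4 := h3 (y := ζ) (by simpa using hζ)
      have h5 : gm 0 - lin 0 = 0 := by
        rw [hgms 0 ⟨h00, hp.symm⟩]; simp [hlin]
      simp only [h5] at h4
      simpa using h4
  -- bound of D
  have hDb : ‖D‖ ≤ 2 * M / b + 4 * B := by
    have h1 := hone _ le_rfl
    set x := rl (b/2) with hx
    have hex : rx x = b/2 := Real.exp_log (by positivity)
    have hxb : x < rl b := Real.log_lt_log (by positivity) (by linarith)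
    have hx0 : x ≤ 0 := by
      have := Real.log_nonpos hb.le hb1; linarith
    have h2 := h1.Em_low 1 le_rfl x hxb
    have h3 : Pj B 1 x ≤ 8 * pπ * B := by
      have hk : kap 1 = 1 := by unfold kap; norm_num
      unfold Pj
      rw [hk]
      have : rx ((3/2 - ((1:ℤ):ℝ)) * x) ≤ 1 := Real.exp_le_one_iff.mpr (by push_cast; linarith)
      have h4 : rx ((3/2 - ((1:ℤ):ℝ)) * x) / (3/2 - ((1:ℤ):ℝ)) ≤ 2 := by
        rw [div_le_iff₀ (by norm_num)]; push_cast at this ⊢; linarith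
      calc 4 * pπ * B * 1 * (rx ((3/2 - ((1:ℤ):ℝ)) * x) / (3/2 - ((1:ℤ):ℝ))) ≤ 4 * pπ * B * 1 * 2 := by gcongr
        _ = _ := by ring
    have h4 := Em_norm_le gm 1 x M (fun θ => hgmM _)
    have h5 : Em gm 1 x - Em (fun ζ => gm ζ - lin ζ) 1 x = 2 * pπ * D := by
      unfold Em
      have hcpm : Continuous (fun θ : ℝ => cp x θ) := by unfold cp; fun_prop
      have hint : IntervalIntegrable (fun θ : ℝ => cexp (-((1:ℤ):ℂ) * ((x:ℂ) + (θ:ℂ) * I)) * gm (cp x θ)) volume 0 (2 * pπ) := by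
        refine IntervalIntegrable.mono_fun' (g := fun _ => rx (-(1:ℤ) * x) * M) intervalIntegrable_const ?_ ?_
        · apply Measurable.aestronglyMeasurable
          exact Measurable.mul (by fun_prop) (hgmeas.comp hcpm.measurable)
        · refine Eventually.of_forall (fun θ => ?_)
          simp only
          rw [norm_mul, norm_cexp_j]
          have := hgmM (cp x θ)
          gcongr
      have hint2 : IntervalIntegrable (fun θ : ℝ => cexp (-((1:ℤ):ℂ) * ((x:ℂ) + (θ:ℂ) * I)) * lin (cp x θ)) volume 0 (2 * pπ) := by
        apply Continuous.intervalIntegrable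
        exact Continuous.mul (by fun_prop) (hlinc.comp hcpm)
      rw [← intervalIntegral.integral_sub hint (by
        refine (hint.sub hint2).congr ?_
        intro θ _; simp only; ring)]
      have hfun : ∀ θ : ℝ, cexp (-((1:ℤ):ℂ) * ((x:ℂ) + (θ:ℂ) * I)) * gm (cp x θ) - cexp (-((1:ℤ):ℂ) * ((x:ℂ) + (θ:ℂ) * I)) * (gm (cp x θ) - lin (cp x θ))
          = g 0 * cexp (-x) * cexp (((-1:ℤ) * I) * θ) + D + φ 0 * cexp (((-2:ℤ) * I) * θ) := by
        intro θ
        have a1 : cexp (-((1:ℤ):ℂ) * ((x:ℂ) + (θ:ℂ) * I)) = cexp (-x) * cexp (((-1:ℤ) * I) * θ) := by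
          rw [← Complex.exp_add]; congr 1; push_cast; ring
        have a2 : cexp (-((1:ℤ):ℂ) * ((x:ℂ) + (θ:ℂ) * I)) * cp x θ = 1 := by
          unfold cp; rw [← Complex.exp_add, ← Complex.exp_zero]; congr 1; push_cast; ring
        have a3 : cexp (-((1:ℤ):ℂ) * ((x:ℂ) + (θ:ℂ) * I)) * cj (cp x θ) = cexp (((-2:ℤ) * I) * θ) := by
          unfold cp; rw [← Complex.exp_conj, ← Complex.exp_add]; congr 1
          simp only [map_add, map_mul, Complex.conj_ofReal, Complex.conj_I]; push_cast; ring
        simp only [hlin]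
        linear_combination g 0 * a1 + D * a2 + φ 0 * a3
      simp only [hfun]
      rw [intervalIntegral.integral_add (by apply Continuous.intervalIntegrable; fun_prop) (by apply Continuous.intervalIntegrable; fun_prop),
        intervalIntegral.integral_add (by apply Continuous.intervalIntegrable; fun_prop) (by apply Continuous.intervalIntegrable; fun_prop),
        intervalIntegral.integral_const_mul, intervalIntegral.integral_const_mul, int_exp_n _ (by norm_num), int_exp_n _ (by norm_num)]
      simp
    have h6 : ‖2 * pπ * D‖ = 2 * pπ * ‖D‖ := by
      rw [norm_mul, norm_mul]; simp [abs_of_pos Real.pi_pos]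
    have h7 : rx (-((1:ℤ):ℝ) * x) = 2 / b := by
      rw [show -((1:ℤ):ℝ) * x = -x by push_cast; ring, Real.exp_neg, hex]; field_simp
    rw [h7] at h4
    have h8 : 2 * pπ * ‖D‖ ≤ 2 / b * M * (2 * pπ) + 8 * pπ * B := by
      rw [← h6, ← h5]
      exact (norm_sub_le _ _).trans (by linarith)
    have h9 : 2 * pπ * ‖D‖ ≤ 2 * pπ * (2 * M / b + 4 * B) := by
      refine h8.trans (le_of_eq ?_); ring
    exact le_of_mul_le_mul_left h9 Real.two_pi_pos
  have hC0 : 0 ≤ (40 * B + 80 * (2 * M + (2 * M / b + 4 * B) + B) / b^2) * ZZ := by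
    have := ZZ_nonneg
    positivity
  refine ⟨D, hDb.trans ?_, ?_⟩
  · unfold CC; linarith
  · intro ζ hζ hζp
    rcases eq_or_ne ζ 0 with rfl | h0
    · simp
    have h1 := hone (2 * M + (2 * M / b + 4 * B) + B) (by linarith)
    set x := rl ‖ζ‖ with hx
    have hζ0 : 0 < ‖ζ‖ := norm_pos_iff.mpr h0
    have hex : rx x = ‖ζ‖ := Real.exp_log hζ0
    have hcp : cp x ζ.arg = ζ := by
      unfold cp
      rw [Complex.exp_add, ← Complex.ofReal_exp, hex]
      exact Complex.norm_mul_exp_arg_mul_I ζ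
    have h2 := h1.value x ζ.arg (by rw [hex]; exact hζ) (by rw [hex]; exact hζp)
    rw [hcp] at h2
    have h3 : gm ζ = g ζ := hgms ζ ⟨lt_of_le_of_lt hζ (by linarith), fun h => hζp (by rw [h])⟩
    rw [h3] at h2
    have h4 : rx (3/2 * x) = ‖ζ‖ * Real.sqrt ‖ζ‖ := by
      rw [show (3/2:ℝ) * x = x + x/2 by ring, Real.exp_add, hex]
      congr 1
      rw [← hex, Real.exp_half]
    rw [h4] at h2
    rw [show g ζ - g 0 - D * ζ - φ 0 * cj ζ = g ζ - lin ζ by simp only [hlin]; ring]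
    refine h2.trans ?_
    unfold CC
    have e0 : 0 ≤ ‖ζ‖ * Real.sqrt ‖ζ‖ := by positivity
    have e1 : 0 ≤ 2 * M / b + 4 * B := by positivity
    calc (40 * B + 80 * (2 * M + (2 * M / b + 4 * B) + B) / b^2) * (‖ζ‖ * Real.sqrt ‖ζ‖) * ZZ
        = (40 * B + 80 * (2 * M + (2 * M / b + 4 * B) + B) / b^2) * ZZ * (‖ζ‖ * Real.sqrt ‖ζ‖) := by ring
      _ ≤ _ := by gcongr; linarith

end OneVar4

section LogC
open Complex MeasureTheory Filter Topology

variable {ι : Type} [Fintype ι] [DecidableEq ι]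

def kd (k : ι → ℤ) (s : ι → ℝ) : ℝ := ∑ i, (k i : ℝ) * s i

def EE (s : ι → ℝ) : ι → ℂ := fun i => ((rx (s i) : ℝ) : ℂ)

def rotv (θ : ι → ℝ) (z : ι → ℂ) : ι → ℂ := fun i => cexp (θ i * I) * z i

structure Hk (k : ι → ℤ) (h : ι → Cv ι → ℂ) (h' : ι → Cv ι → Cv ι →L[ℝ] ℂ) (K : ℝ) : Prop where
  der : ∀ ν z, n1 z < 1 → HasFDerivAt (h ν) (h' ν z) z
  hom : ∀ ν θ z, n1 z < 1 → h ν (rotv θ z) = cexp (((kd k θ + θ ν : ℝ) : ℂ) * I) * h ν z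
  closed : ∀ μ ν z, n1 z < 1 → h' ν z (pis μ 1) + I * h' ν z (pis μ I) =
    h' μ z (pis ν 1) + I * h' μ z (pis ν I)
  bd : ∀ ν z, n1 z < 1 → ‖h ν z‖ ≤ K

lemma kd_single (k : ι → ℤ) (μ : ι) (t : ℝ) : kd k (pis μ t) = k μ * t := by
  unfold kd
  rw [Finset.sum_eq_single μ]
  · simp
  · intro b _ hb; simp [hb]
  · simp

lemma Hk.rotder {k : ι → ℤ} {h : ι → Cv ι → ℂ} {h' : ι → Cv ι → Cv ι →L[ℝ] ℂ} {K : ℝ}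
    (H : Hk k h h' K) (μ ν : ι) (z : ι → ℂ) (hz : n1 z < 1) :
    h' ν z (pis μ (I * z μ)) = I * ((k μ : ℂ) + if ν = μ then 1 else 0) * h ν z := by
  have hc : HasDerivAt (fun t : ℝ => rotv (pis μ t) z) (pis μ (I * z μ)) 0 := by
    rw [hasDerivAt_pi]
    intro i
    by_cases hi : i = μ
    · subst hi
      simp only [rotv, Pi.single_eq_same]
      have : HasDerivAt (fun t : ℝ => (t : ℂ)) 1 0 := Complex.ofRealCLM.hasDerivAt
      refine (((this.mul_const I).cexp).mul_const (z i)).congr_deriv ?_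
      simp
    · simp only [rotv, Pi.single_eq_of_ne hi]
      exact hasDerivAt_const _ _
  have hr0 : rotv (pis μ (0:ℝ)) z = z := by
    funext i; simp [rotv]
  have h1 : HasDerivAt (fun t : ℝ => h ν (rotv (pis μ t) z)) (h' ν z (pis μ (I * z μ))) 0 := by
    have hd := H.der ν z hz
    rw [← hr0] at hd
    have := hd.comp_hasDerivAt (0:ℝ) hc
    rw [hr0] at this
    exact this
  have h2 : HasDerivAt (fun t : ℝ => h ν (rotv (pis μ t) z))
      (I * ((k μ : ℂ) + if ν = μ then 1 else 0) * h ν z) 0 := by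
    have e : (fun t : ℝ => h ν (rotv (pis μ t) z)) =
        fun t : ℝ => cexp ((t : ℂ) * (((k μ : ℂ) + if ν = μ then 1 else 0) * I)) * h ν z := by
      funext t
      rw [H.hom ν _ z hz, kd_single]
      congr 2
      by_cases hn : ν = μ
      · subst hn; simp; ring
      · simp [hn]; ring
    rw [e]
    have : HasDerivAt (fun t : ℝ => (t : ℂ)) 1 0 := Complex.ofRealCLM.hasDerivAt
    refine (((this.mul_const _).cexp).mul_const (h ν z)).congr_deriv ?_
    simp; ring_nf; simp
  exact h1.unique h2

def om (k : ι → ℤ) (h : ι → Cv ι → ℂ) (ν : ι) (s : ι → ℝ) : ℂ :=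
  2 * ((rx (s ν - kd k s) : ℝ) : ℂ) * h ν (EE s)

def om' (k : ι → ℤ) (h : ι → Cv ι → ℂ) (h' : ι → Cv ι → Cv ι →L[ℝ] ℂ) (s : ι → ℝ) (ν μ : ι) : ℂ :=
  2 * ((rx (s ν + s μ - kd k s) : ℝ) : ℂ) *
    (h' ν (EE s) (pis μ 1) + I * h' ν (EE s) (pis μ I)) +
  if ν = μ then 4 * ((rx (s ν - kd k s) : ℝ) : ℂ) * h ν (EE s) else 0

def pj (ν : ι) : (ι → ℝ) →L[ℝ] ℝ := ContinuousLinearMap.proj ν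

def kdL (k : ι → ℤ) : (ι → ℝ) →L[ℝ] ℝ := ∑ i, (k i : ℝ) • pj i

lemma kdL_apply (k : ι → ℤ) (s) : kdL k s = kd k s := by
  simp [kdL, kd, pj, sum_apply]

lemma single_smul' (μ : ι) (x : ℝ) (c : ℂ) :
    (pis μ ((x : ℂ) * c) : ι → ℂ) = x • pis μ c := by
  rw [← Pi.single_smul]; simp

lemma EE_der (s : ι → ℝ) : HasFDerivAt (EE (ι := ι))
    (∑ μ, (pj μ).smulRight (pis μ ((rx (s μ) : ℝ) : ℂ) : ι → ℂ)) s := by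
  rw [hasFDerivAt_pi']
  intro i
  have h1 : HasFDerivAt (fun s : ι → ℝ => s i) (pj i) s := (pj i).hasFDerivAt
  have h2 := h1.exp
  have h3 := (Complex.ofRealCLM.hasFDerivAt (x := rx (s i))).comp s h2
  refine h3.congr_fderiv ?_
  ext x
  simp [pj, sum_apply, Pi.single_apply]
  ring

lemma Hk.om_der {k : ι → ℤ} {h : ι → Cv ι → ℂ} {h' : ι → Cv ι → Cv ι →L[ℝ] ℂ} {K : ℝ}
    (H : Hk k h h' K) (ν : ι) (s : ι → ℝ) (hz : n1 (EE s) < 1) :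
    HasFDerivAt (om k h ν) (∑ μ, (pj μ).smulRight (om' k h h' s ν μ)) s := by
  have h1 : HasFDerivAt (fun s : ι → ℝ => s ν - kd k s) (pj ν - kdL k) s := by
    refine HasFDerivAt.sub (pj ν).hasFDerivAt ?_
    have := (kdL k).hasFDerivAt (x := s)
    simpa only [kdL_apply] using (this.congr_of_eventuallyEq (Eventually.of_forall fun y => (kdL_apply k y).symm))
  have h3 := (Complex.ofRealCLM.hasFDerivAt (x := rx (s ν - kd k s))).comp s h1.exp
  have h4 := (H.der ν _ hz).comp s (EE_der s)
  have h5 := (h3.const_mul (2:ℂ)).mul h4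
  refine h5.congr_fderiv ?_
  ext x
  simp only [Function.comp_apply, add_apply, smul_apply, ContinuousLinearMap.comp_apply,
    sum_apply, ContinuousLinearMap.smulRight_apply, sub_apply, map_sum, map_smul, ofRealCLM_apply,
    smul_eq_mul, kdL_apply]
  have hr : ∀ μ, om' k h h' s ν μ = 2 * ((rx (s ν - kd k s) : ℝ) : ℂ) *
      (h' ν (EE s) (pis μ ((rx (s μ) : ℝ) : ℂ)) - ((k μ : ℂ) - if ν = μ then 1 else 0) * h ν (EE s)) := by
    intro μ
    have e1 := H.rotder μ ν (EE s) hz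
    have e2 : h' ν (EE s) (pis μ (I * EE s μ)) = (rx (s μ) : ℂ) * h' ν (EE s) (pis μ I) := by
      rw [mul_comm, EE, single_smul', map_smul]; simp
    have e3 : h' ν (EE s) (pis μ ((rx (s μ) : ℝ) : ℂ)) = (rx (s μ) : ℂ) * h' ν (EE s) (pis μ 1) := by
      conv_lhs => rw [← mul_one ((rx (s μ) : ℝ) : ℂ), single_smul', map_smul]
      simp
    rw [e2] at e1
    unfold om'
    rw [e3]
    have e4 : rx (s ν + s μ - kd k s) = rx (s ν - kd k s) * rx (s μ) := by
      rw [← Real.exp_add]; ring_nf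
    rw [e4]
    have e5 : (if ν = μ then 4 * ((rx (s ν - kd k s) : ℝ) : ℂ) * h ν (EE s) else 0) =
        4 * ((rx (s ν - kd k s) : ℝ) : ℂ) * h ν (EE s) * (if ν = μ then 1 else 0) := by split_ifs <;> simp
    rw [e5]
    push_cast at e1 ⊢
    linear_combination 2 * cexp (s ν - kd k s) * I * e1 +
      2 * cexp (s ν - kd k s) * ((k μ : ℂ) + if ν = μ then 1 else 0) * h ν (EE s) * I_mul_I
  simp only [hr]
  have hx : ∑ μ, (x μ : ℂ) * ((k μ : ℂ) - if ν = μ then 1 else 0) = (kd k x : ℂ) - x ν := by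
    simp only [mul_sub, Finset.sum_sub_distrib, kd]
    push_cast
    congr 1
    · exact Finset.sum_congr rfl fun i _ => mul_comm _ _
    · simp
  have hpj : ∀ i, pj i x = x i := fun i => rfl
  simp only [hpj, real_smul]
  have : ∀ μ, (x μ : ℂ) * (2 * ((rx (s ν - kd k s) : ℝ) : ℂ) *
      (h' ν (EE s) (pis μ ((rx (s μ) : ℝ) : ℂ)) - ((k μ : ℂ) - if ν = μ then 1 else 0) * h ν (EE s))) =
      2 * ((rx (s ν - kd k s) : ℝ) : ℂ) * ((x μ : ℂ) * h' ν (EE s) (pis μ ((rx (s μ) : ℝ) : ℂ)))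
      - (2 * ((rx (s ν - kd k s) : ℝ) : ℂ) * h ν (EE s)) * ((x μ : ℂ) * ((k μ : ℂ) - if ν = μ then 1 else 0)) := by
    intro μ; ring
  simp only [this, Finset.sum_sub_distrib, ← Finset.mul_sum, hx]
  push_cast
  ring

def SD (ι : Type) [Fintype ι] : Set (ι → ℝ) := {s | n1 (EE s) < 1}

lemma n1_EE (s : ι → ℝ) : n1 (EE s) = ∑ i, rx (s i) := by
  unfold n1 EE
  refine Finset.sum_congr rfl fun i _ => ?_
  rw [Complex.norm_real, Real.norm_eq_abs, abs_of_pos (Real.exp_pos _)]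

lemma SD_open : IsOpen (SD ι) := by
  unfold SD
  simp only [n1_EE]
  exact isOpen_lt (by fun_prop) continuous_const

lemma SD_convex : Convex ℝ (SD ι) := by
  intro s hs t ht a b ha hb hab
  simp only [SD, n1_EE, Set.mem_ofPred_eq] at *
  have : ∀ i, rx ((a • s + b • t) i) ≤ a * rx (s i) + b * rx (t i) := by
    intro i
    have := convexOn_exp.2 (mem_univ (s i)) (mem_univ (t i)) ha hb hab
    simpa using this
  calc _ ≤ ∑ i, (a * rx (s i) + b * rx (t i)) := Finset.sum_le_sum fun i _ => this i
    _ = a * ∑ i, rx (s i) + b * ∑ i, rx (t i) := by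
      rw [Finset.sum_add_distrib, Finset.mul_sum, Finset.mul_sum]
    _ < 1 := by
      rcases eq_or_lt_of_le ha with h | h
      · subst h; simp at hab; subst hab; simpa using ht
      · nlinarith

lemma smulR_der {E : Type*} [NormedAddCommGroup E] [NormedSpace ℝ E] (c : E →L[ℝ] ℝ) (g : E → ℂ)
    (g' : E →L[ℝ] ℂ) (s : E) (hg : HasFDerivAt g g' s) : HasFDerivAt (fun s => c.smulRight (g s))
      ((ContinuousLinearMap.smulRightL ℝ E ℂ c).comp g') s := by
  have h1 := (ContinuousLinearMap.smulRightL ℝ E ℂ c).hasFDerivAt (x := g s)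
  exact h1.comp s hg

lemma poinc {E : Type*} [NormedAddCommGroup E] [NormedSpace ℝ E] (s : Set E) (hs : Convex ℝ s) (ho : IsOpen s)
   (ω : E → E →L[ℝ] ℂ) (h1 : DifferentiableOn ℝ ω s) (h2 : ∀ a ∈ s, ∀ x y, fderiv ℝ ω a x y = fderiv ℝ ω a y x) :
   ∃ f : E → ℂ, ∀ a ∈ s, HasFDerivAt f (ω a) a := by
  obtain ⟨f, hf⟩ := hs.exists_forall_hasFDerivAt_of_fderiv_symmetric ho h1 h2
  exact ⟨f, hf⟩

def OM (k : ι → ℤ) (h : ι → Cv ι → ℂ) (s : ι → ℝ) : (ι → ℝ) →L[ℝ] ℂ := ∑ ν, (pj ν).smulRight (om k h ν s)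

lemma Hk.prim1 {k : ι → ℤ} {h : ι → Cv ι → ℂ} {h' : ι → Cv ι → Cv ι →L[ℝ] ℂ} {K : ℝ}
    (H : Hk k h h' K) (s) (hs : s ∈ SD ι) : HasFDerivAt (OM k h)
      (∑ ν, ((ContinuousLinearMap.smulRightL ℝ (ι → ℝ) ℂ) (pj ν)).comp
        (∑ μ, (pj μ).smulRight (om' k h h' s ν μ))) s := by
  unfold OM
  refine HasFDerivAt.fun_sum fun ν _ => ?_
  exact smulR_der (pj ν) (om k h ν) _ s (H.om_der ν s hs)

lemma Hk.sym {k : ι → ℤ} {h : ι → Cv ι → ℂ} {h' : ι → Cv ι → Cv ι →L[ℝ] ℂ} {K : ℝ}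
    (H : Hk k h h' K) (s) (hs : s ∈ SD ι) (x y) : fderiv ℝ (OM k h) s x y = fderiv ℝ (OM k h) s y x := by
  rw [(H.prim1 s hs).fderiv]
  have hpj : ∀ i (x : ι → ℝ), pj i x = x i := fun i x => rfl
  have hf : ∀ x y : ι → ℝ, (∑ ν, ((ContinuousLinearMap.smulRightL ℝ (ι → ℝ) ℂ) (pj ν)).comp
        (∑ μ, (pj μ).smulRight (om' k h h' s ν μ))) x y = ∑ ν, ∑ μ, (y ν * x μ) • om' k h h' s ν μ := by
    intro x y
    simp only [sum_apply, ContinuousLinearMap.comp_apply,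
      ContinuousLinearMap.smulRightL_apply_apply, ContinuousLinearMap.smulRight_apply, hpj, Finset.smul_sum, smul_smul]
  rw [hf, hf, Finset.sum_comm]
  refine Finset.sum_congr rfl fun μ _ => Finset.sum_congr rfl fun ν _ => ?_
  rw [mul_comm]
  congr 1
  unfold om'
  rw [H.closed μ ν _ hs, add_comm (s ν)]
  congr 1
  by_cases hn : ν = μ
  · subst hn; simp
  · simp [hn, Ne.symm hn]

lemma Hk.prim {k : ι → ℤ} {h : ι → Cv ι → ℂ} {h' : ι → Cv ι → Cv ι →L[ℝ] ℂ} {K : ℝ}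
    (H : Hk k h h' K) : ∃ w : (ι → ℝ) → ℂ, ∀ s ∈ SD ι, HasFDerivAt w (OM k h s) s := by
  have h1 : DifferentiableOn ℝ (OM k h) (SD ι) := fun s hs => (H.prim1 s hs).differentiableAt.differentiableWithinAt
  have h2 := H.sym
  have h3 := SD_convex (ι := ι)
  have h4 := SD_open (ι := ι)
  generalize OM k h = ω at *
  exact poinc (SD ι) h3 h4 ω h1 h2

lemma Hk.seg {k : ι → ℤ} {h : ι → Cv ι → ℂ} {h' : ι → Cv ι → Cv ι →L[ℝ] ℂ} {K : ℝ} (hK : 0 ≤ K)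
    (H : Hk k h h' K) (w : (ι → ℝ) → ℂ) (hw : ∀ s ∈ SD ι,
      HasFDerivAt w (OM k h s) s) (s0 s1 : ι → ℝ) (h0 : s0 ∈ SD ι) (h1 : s1 ∈ SD ι)
      (hle : kd k s1 ≤ kd k s0) : ‖w s1 - w s0‖ ≤ 4 * K * rx (-kd k s1) := by
  set γ : ℝ → ι → ℝ := fun t => s0 + t • (s1 - s0) with hγ
  have hγd : ∀ t, HasDerivAt γ (s1 - s0) t := by
    intro t
    exact (((hasDerivAt_id t).smul_const (s1 - s0)).const_add s0).congr_deriv (by simp)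
  have hγm : ∀ t ∈ Icc (0:ℝ) 1, γ t ∈ SD ι := by
    intro t ht
    have := SD_convex.add_smul_sub_mem h0 h1 ht
    exact this
  have hsgn : ∀ x : ℝ, ∃ σ : ℝ, |σ| ≤ 1 ∧ σ * x = |x| := by
    intro x
    rcases le_total 0 x with hx | hx
    · exact ⟨1, by simp, by rw [abs_of_nonneg hx]; ring⟩
    · exact ⟨-1, by simp, by rw [abs_of_nonpos hx]; ring⟩
  choose σ hσ1 hσ2 using hsgn
  have key := cmp_deriv (ψ := fun t => w (γ t)) (ψ' := fun t => OM k h (γ t) (s1 - s0))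
    (Φ := fun t => 2 * K * rx (-kd k s1) * ∑ ν, σ (s1 ν - s0 ν) * rx (γ t ν))
    (Φ' := fun t => 2 * K * rx (-kd k s1) * ∑ ν, σ (s1 ν - s0 ν) * (rx (γ t ν) * (s1 ν - s0 ν)))
    (a := 0) (b := 1) zero_le_one
    (fun t ht => (hw _ (hγm t ht)).comp_hasDerivAt t (hγd t))
    (fun t ht => by
      refine HasDerivAt.const_mul _ (HasDerivAt.fun_sum fun ν _ => HasDerivAt.const_mul _ ?_)
      exact (hasDerivAt_pi.mp (hγd t) ν).exp)
    (fun t ht => by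
      have hpj : ∀ i (x : ι → ℝ), pj i x = x i := fun i x => rfl
      simp only [OM, sum_apply, ContinuousLinearMap.smulRight_apply, hpj]
      rw [Finset.mul_sum]
      refine (norm_sum_le _ _).trans (Finset.sum_le_sum fun ν _ => ?_)
      rw [norm_smul, om, norm_mul, norm_mul, Complex.norm_real, Real.norm_eq_abs, Real.norm_eq_abs, abs_of_pos (Real.exp_pos _)]
      have hb := H.bd ν _ (hγm t ht)
      have e1 : kd k (γ t) = kd k s0 + t * (kd k s1 - kd k s0) := by
        rw [← kdL_apply, ← kdL_apply, ← kdL_apply, hγ]; simp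
      have e2 : kd k s1 ≤ kd k (γ t) := by rw [e1]; nlinarith [ht.1, ht.2]
      have e3 : rx (γ t ν - kd k (γ t)) ≤ rx (-kd k s1) * rx (γ t ν) := by
        rw [← Real.exp_add]; exact Real.exp_le_exp.mpr (by linarith)
      have e4 := hσ2 (s1 ν - s0 ν)
      have e5 := abs_nonneg (s1 ν - s0 ν)
      simp only [Pi.sub_apply, Complex.norm_ofNat]
      calc |s1 ν - s0 ν| * (2 * rx (γ t ν - kd k (γ t)) * ‖h ν (EE (γ t))‖)
          ≤ |s1 ν - s0 ν| * (2 * (rx (-kd k s1) * rx (γ t ν)) * K) := by gcongr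
        _ = _ := by rw [← e4]; ring)
  have g0 : γ 0 = s0 := by simp [hγ]
  have g1 : γ 1 = s1 := by simp [hγ]
  simp only [g0, g1] at key
  refine key.trans ?_
  rw [← mul_sub, ← Finset.sum_sub_distrib]
  have : ∑ ν, (σ (s1 ν - s0 ν) * rx (s1 ν) - σ (s1 ν - s0 ν) * rx (s0 ν)) ≤ 2 := by
    have h0' : ∑ i, rx (s0 i) < 1 := by rw [← n1_EE]; exact h0
    have h1' : ∑ i, rx (s1 i) < 1 := by rw [← n1_EE]; exact h1
    calc _ ≤ ∑ ν, (rx (s1 ν) + rx (s0 ν)) := by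
          refine Finset.sum_le_sum fun ν _ => ?_
          have := abs_le.mp (hσ1 (s1 ν - s0 ν))
          nlinarith [Real.exp_pos (s1 ν), Real.exp_pos (s0 ν)]
      _ ≤ 2 := by rw [Finset.sum_add_distrib]; linarith
  have hp : 0 ≤ 2 * K * rx (-kd k s1) := by positivity
  nlinarith

lemma Hk.prim2 {k : ι → ℤ} {h : ι → Cv ι → ℂ} {h' : ι → Cv ι → Cv ι →L[ℝ] ℂ} {K : ℝ} (hK : 0 ≤ K)
    (H : Hk k h h' K) : ∃ w : (ι → ℝ) → ℂ, ∀ s ∈ SD ι,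
      HasFDerivAt w (OM k h s) s ∧ ‖w s‖ ≤ 4 * K * rx (-kd k s) := by
  obtain ⟨w, hw⟩ := H.prim
  rcases (SD ι).eq_empty_or_nonempty with he | ⟨s₀, hs₀⟩
  · exact ⟨w, fun s hs => by rw [he] at hs; exact hs.elim⟩
  let t : SD ι → Set ℂ := fun s => Metric.closedBall (w s) (4 * K * rx (-kd k s))
  have hc := (isCompact_closedBall (w s₀) (4 * K * rx (-kd k s₀))).inter_iInter_nonempty t
    (fun s => Metric.isClosed_closedBall) (by
      intro v
      obtain ⟨m, hm, hmax⟩ := Finset.exists_max_image (insert (⟨s₀, hs₀⟩ : SD ι) v) (fun s => kd k s.1)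
        (Finset.insert_nonempty _ _)
      have hin : ∀ s ∈ insert (⟨s₀, hs₀⟩ : SD ι) v, w m.1 ∈ t s := by
        intro s hs
        have := H.seg hK w hw m.1 s.1 m.2 s.2 (hmax s hs)
        rw [Metric.mem_closedBall, dist_comm, dist_eq_norm]
        exact this
      refine ⟨w m.1, hin _ (Finset.mem_insert_self _ _), ?_⟩
      simp only [mem_iInter]
      exact fun s hs => hin s (Finset.mem_insert_of_mem hs))
  obtain ⟨c, -, hc⟩ := hc
  refine ⟨fun s => w s - c, fun s hs => ⟨(hw s hs).sub_const c, ?_⟩⟩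
  have := mem_iInter.mp hc ⟨s, hs⟩
  rw [Metric.mem_closedBall, dist_comm, dist_eq_norm] at this
  exact this

end LogC

section LogC2
open Complex MeasureTheory Filter Topology

variable {ι : Type} [Fintype ι] [DecidableEq ι]

lemma lognorm_der (z0 : ℂ) (hz : z0 ≠ 0) : HasFDerivAt (fun z : ℂ => rl ‖z‖)
    (reCLM.comp ((z0⁻¹) • (ContinuousLinearMap.id ℝ ℂ))) z0 := by
  have h1 : HasDerivAt (fun z : ℂ => Complex.log (z * z0⁻¹)) (z0⁻¹) z0 := by
    have : HasDerivAt (fun z : ℂ => z * z0⁻¹) (z0⁻¹) z0 := by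
      simpa using (hasDerivAt_id z0).mul_const z0⁻¹
    have h2 := this.clog (by rw [mul_inv_cancel₀ hz]; exact Complex.one_mem_slitPlane)
    refine h2.congr_deriv ?_
    rw [mul_inv_cancel₀ hz, div_one]
  have h2 := (reCLM.hasFDerivAt.comp z0 (h1.hasFDerivAt.restrictScalars ℝ)).add_const (rl ‖z0‖)
  refine (h2.congr_fderiv ?_).congr_of_eventuallyEq ?_
  · ext <;> simp <;> ring
  · filter_upwards [eventually_ne_nhds hz] with z hz'
    simp only [Function.comp_apply, reCLM_apply, Complex.log_re, norm_mul, norm_inv]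
    rw [Real.log_mul (by simpa using hz') (by simpa using hz), Real.log_inv]
    ring

def kC (k : ι → ℤ) (ζ : ι → ℂ) : ℂ := ∑ i, (k i : ℂ) * ζ i

lemma kC_eq (k : ι → ℤ) (ζ : ι → ℂ) : kC k ζ = (kd k (fun i => (ζ i).re) : ℂ) + kd k (fun i => (ζ i).im) * I := by
  unfold kC kd
  push_cast
  rw [Finset.sum_mul, ← Finset.sum_add_distrib]
  refine Finset.sum_congr rfl fun i _ => ?_
  conv_lhs => rw [← re_add_im (ζ i)]
  ring

lemma n1_EE_re (ζ : ι → ℂ) : n1 (EE (fun i => (ζ i).re)) = n1 (ex ζ) := by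
  rw [n1_EE, n1_ex]; rfl

lemma Hk.key {k : ι → ℤ} {h : ι → Cv ι → ℂ} {h' : ι → Cv ι → Cv ι →L[ℝ] ℂ} {K : ℝ}
    (H : Hk k h h' K) (ζ : ι → ℂ) (hz : n1 (ex ζ) < 1) (ν : ι) :
    cexp (kC k ζ) * om k h ν (fun i => (ζ i).re) = 2 * (h ν (ex ζ) * cj (cexp (ζ ν))) := by
  have e1 : ex ζ = rotv (fun i => (ζ i).im) (EE (fun i => (ζ i).re)) := by
    funext i
    simp only [ex, rotv, EE]
    push_cast
    rw [← Complex.exp_add]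
    congr 1
    conv_lhs => rw [← re_add_im (ζ i)]
    ring
  have h1 := H.hom ν (fun i => (ζ i).im) (EE (fun i => (ζ i).re)) (by rw [n1_EE_re]; exact hz)
  rw [e1, h1, kC_eq, om, ← Complex.exp_conj]
  have e2 : cj (ζ ν) = (ζ ν).re - (ζ ν).im * I := by apply Complex.ext <;> simp
  rw [e2]
  push_cast
  generalize h ν (EE fun i => (ζ i).re) = X
  have : ∀ a b c d : ℂ, a + b = c + d → cexp a * (2 * cexp b * X) = 2 * (cexp c * X * cexp d) := by
    intro a b c d e
    have : cexp a * cexp b = cexp c * cexp d := by rw [← Complex.exp_add, ← Complex.exp_add, e]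
    linear_combination 2 * X * this
  apply this
  ring

lemma OM_apply (k : ι → ℤ) (h : ι → Cv ι → ℂ) (s x : ι → ℝ) :
    OM k h s x = ∑ ν, (x ν : ℂ) * om k h ν s := by
  have hpj : ∀ i (x : ι → ℝ), pj i x = x i := fun i x => rfl
  simp [OM, sum_apply, hpj]

theorem Hk.solve {k : ι → ℤ} {h : ι → Cv ι → ℂ} {h' : ι → Cv ι → Cv ι →L[ℝ] ℂ} {K : ℝ} (hK : 0 ≤ K)
    (H : Hk k h h' K) : ∃ u : Cv ι → ℂ,
    (∀ S (ζ : ι → ℂ) (x : ℝ), n1 (ex (sh S x ζ)) < 1 →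
      HasDerivAt (fun x : ℝ => cx (-(sg S k : ℂ) * x) * u (ex (sh S x ζ)))
      (2 * cx (-(sg S k : ℂ) * x) *
        ∑ ν ∈ S, h ν (ex (sh S x ζ)) * cj (cx (ζ ν + x))) x) ∧
    (∀ ζ, n1 (ex ζ) < 1 → ‖u (ex ζ)‖ ≤ 4 * K) ∧
    (∀ z, n1 z < 1 → (∀ i, z i ≠ 0) → ∃ u' : Cv ι →L[ℝ] ℂ, HasFDerivAt u u' z ∧
      ∀ ν, u' (pis ν 1) + I * u' (pis ν I) = 2 * h ν z) := by
  obtain ⟨w, hw⟩ := H.prim2 hK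
  have hu : ∀ ζ : ι → ℂ, (∏ i, (ex ζ i) ^ (k i)) * w (fun i => rl ‖ex ζ i‖) =
      cexp (kC k ζ) * w (fun i => (ζ i).re) := by
    intro ζ
    congr 1
    · simp only [ex, kC, ← Complex.exp_int_mul, Complex.exp_sum]
    · congr 1; funext i; simp [ex, Complex.norm_exp]
  refine ⟨fun z => (∏ i, (z i) ^ (k i)) * w (fun i => rl ‖z i‖), ?_, ?_, ?_⟩
  · intro S ζ x hx
    simp only [hu]
    have hkC : ∀ y : ℝ, kC k (sh S y ζ) = kC k ζ + sg S k * y := by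
      intro y
      unfold kC sh sg
      have : ∀ i, (k i : ℂ) * (if i ∈ S then ζ i + (y:ℂ) else ζ i) = k i * ζ i + if i ∈ S then (k i : ℂ) * y else 0 := by
        intro i; split_ifs <;> ring
      simp only [this, Finset.sum_add_distrib]
      push_cast
      rw [Finset.sum_mul]
      simp
    have e1 : (fun y : ℝ => cexp (-(sg S k : ℂ) * y) * (cexp (kC k (sh S y ζ)) * w (fun i => (sh S y ζ i).re))) =
        fun y : ℝ => cexp (kC k ζ) * w (fun i => (sh S y ζ i).re) := by
      funext y
      rw [hkC, ← mul_assoc, ← Complex.exp_add]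
      congr 2; ring
    rw [e1]
    have hc : HasDerivAt (fun y : ℝ => (fun i => (sh S y ζ i).re)) (fun i => if i ∈ S then (1:ℝ) else 0) x := by
      rw [hasDerivAt_pi]
      intro i
      by_cases hi : i ∈ S
      · simp only [sh, hi, if_true, add_re, ofReal_re]
        exact (hasDerivAt_id x).const_add _
      · simp only [sh, hi, if_false]
        exact hasDerivAt_const _ _
    have hm : (fun i => (sh S x ζ i).re) ∈ SD ι := by
      change n1 (EE _) < 1
      rw [n1_EE_re]; exact hx
    refine (((hw _ hm).1.comp_hasDerivAt x hc).const_mul (cexp (kC k ζ))).congr_deriv ?_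
    rw [OM_apply, Finset.mul_sum, Finset.mul_sum]
    rw [← Finset.sum_subset (Finset.subset_univ S)]
    · refine Finset.sum_congr rfl fun ν hν => ?_
      have h1 := H.key (sh S x ζ) hx ν
      rw [hkC] at h1
      have h2 : sh S x ζ ν = ζ ν + x := by simp [sh, hν]
      rw [h2] at h1
      have h3 : cexp (kC k ζ) = cexp (-(sg S k : ℂ) * x) * cexp (kC k ζ + sg S k * x) := by
        rw [← Complex.exp_add]; congr 1; ring
      rw [h3]
      simp only [hν, if_true]
      push_cast
      linear_combination cexp (-(sg S k : ℂ) * x) * h1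
    · intro i _ hi; simp [hi]
  · intro ζ hζ
    simp only [hu]
    have hm : (fun i => (ζ i).re) ∈ SD ι := by
      change n1 (EE _) < 1
      rw [n1_EE_re]; exact hζ
    have := (hw _ hm).2
    rw [norm_mul, Complex.norm_exp, kC_eq]
    simp only [add_re, ofReal_re, mul_re, I_re, I_im, mul_zero, ofReal_im, zero_mul, sub_zero, add_zero]
    calc _ ≤ rx (kd k fun i => (ζ i).re) * (4 * K * rx (-kd k fun i => (ζ i).re)) := by gcongr
      _ = 4 * K * (rx (kd k fun i => (ζ i).re) * rx (-kd k fun i => (ζ i).re)) := by ring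
      _ = 4 * K := by rw [← Real.exp_add]; simp
  · intro z hz hz0
    have hex : ex (fun i => Complex.log (z i)) = z := by
      funext i; simp [ex, Complex.exp_log (hz0 i)]
    have hre : (fun i => (Complex.log (z i)).re) = fun i => rl ‖z i‖ := by
      funext i; exact Complex.log_re _
    have hP : DifferentiableAt ℂ (fun z : ι → ℂ => ∏ i, (z i) ^ (k i)) z := by
      have h1 : ∀ i ∈ (Finset.univ : Finset ι), DifferentiableAt ℂ (fun z : ι → ℂ => z i ^ k i) z := by
        intro i _
        have : DifferentiableAt ℂ (fun z : ι → ℂ => z i) z := by fun_prop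
        exact this.zpow (Or.inl (hz0 i))
      exact (HasFDerivAt.finsetProd fun i hi => (h1 i hi).hasFDerivAt).differentiableAt
    have hP' := hP.hasFDerivAt.restrictScalars ℝ
    set P' := fderiv ℂ (fun z : ι → ℂ => ∏ i, (z i) ^ (k i)) z
    have hL : HasFDerivAt (fun z : ι → ℂ => (fun i => rl ‖z i‖))
        (ContinuousLinearMap.pi fun i => (reCLM.comp (((z i)⁻¹) • (ContinuousLinearMap.id ℝ ℂ))).comp
          (ContinuousLinearMap.proj (R := ℝ) (φ := fun _ : ι => ℂ) i)) z := by
      rw [hasFDerivAt_pi]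
      intro i
      exact (lognorm_der (z i) (hz0 i)).comp z (ContinuousLinearMap.proj (R := ℝ) (φ := fun _ : ι => ℂ) i).hasFDerivAt
    have hm : (fun i => rl ‖z i‖) ∈ SD ι := by
      rw [← hre]
      change n1 (EE _) < 1
      rw [n1_EE_re, hex]; exact hz
    have hW := (hw _ hm).1.comp z hL
    refine ⟨_, hP'.mul hW, fun ν => ?_⟩
    have hk := H.key (fun i => Complex.log (z i)) (by rw [hex]; exact hz) ν
    have hPe : ∏ i, (z i) ^ (k i) = cexp (kC k fun i => Complex.log (z i)) := by
      simp only [kC, Complex.exp_sum, Complex.exp_int_mul]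
      exact Finset.prod_congr rfl fun i _ => by rw [Complex.exp_log (hz0 i)]
    rw [hex, hre, ← hPe, Complex.exp_log (hz0 ν)] at hk
    have hPI : P' (pis ν I) = I * P' (pis ν 1) := by
      rw [← smul_eq_mul, ← map_smul]
      congr 1
      rw [← Pi.single_smul]; simp
    have hOM : ∀ c : ℂ, OM k h (fun i => rl ‖z i‖) ((ContinuousLinearMap.pi fun i => (reCLM.comp (((z i)⁻¹) • (ContinuousLinearMap.id ℝ ℂ))).comp
          (ContinuousLinearMap.proj (R := ℝ) (φ := fun _ : ι => ℂ) i)) (pis ν c)) =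
          (((z ν)⁻¹ * c).re : ℂ) * om k h ν (fun i => rl ‖z i‖) := by
      intro c
      rw [OM_apply, Finset.sum_eq_single ν]
      · simp
      · intro b _ hb; simp [hb]
      · simp
    simp only [add_apply, smul_apply, ContinuousLinearMap.comp_apply, hOM, ContinuousLinearMap.coe_restrictScalars', hPI, smul_eq_mul]
    have hc : ((((z ν)⁻¹ * 1).re : ℂ) + I * (((z ν)⁻¹ * I).re : ℂ)) * cj (z ν) = 1 := by
      have : ((((z ν)⁻¹ * 1).re : ℂ) + I * (((z ν)⁻¹ * I).re : ℂ)) = cj ((z ν)⁻¹) := by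
        apply Complex.ext <;> simp <;> ring
      rw [this, ← map_mul, inv_mul_cancel₀ (hz0 ν), map_one]
    have hzc : cj (z ν) ≠ 0 := by simpa using hz0 ν
    apply mul_right_cancel₀ hzc
    linear_combination ((∏ i, (z i) ^ (k i)) * om k h ν (fun i => rl ‖z i‖)) * hc + hk +
      (w fun i => rl ‖z i‖) * P' (pis ν 1) * cj (z ν) * I_mul_I

lemma Hk.homS {k : ι → ℤ} {h : ι → Cv ι → ℂ} {h' : ι → Cv ι → Cv ι →L[ℝ] ℂ} {K : ℝ}
    (H : Hk k h h' K) (ν S) (θ : ℝ) (z) (hz : n1 z < 1) : h ν (rot S θ z) =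
    cx (((sg S k + if ν ∈ S then 1 else 0 : ℤ) : ℂ) * θ * Complex.I) * h ν z := by
  have e : rot S θ z = rotv (fun i => if i ∈ S then θ else 0) z := by
    funext i
    simp only [rot, rotv]
    split_ifs <;> simp
  rw [e, H.hom ν _ z hz]
  congr 3
  have : kd k (fun i => if i ∈ S then θ else 0) = sg S k * θ := by
    unfold kd sg
    push_cast
    rw [Finset.sum_mul]
    simp
  rw [this]
  split_ifs <;> push_cast <;> ring

end LogC2

section Fejer
open Complex MeasureTheory Filter Topology

variable {ι : Type} [Fintype ι] [DecidableEq ι]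

abbrev TT (ι : Type) : Type := ι → UnitAddCircle

def mT (ι : Type) [Fintype ι] : Measure (TT ι) := Measure.pi fun _ => AddCircle.haarAddCircle

instance : IsProbabilityMeasure (mT ι) := by unfold mT; infer_instance
instance : (mT ι).IsAddLeftInvariant := by unfold mT; infer_instance

def eT (x : TT ι) (i : ι) : ℂ := fourier 1 (x i)

lemma eT_cont (i : ι) : Continuous (fun x : TT ι => eT x i) :=
  (fourier (T := 1) 1).continuous.comp (continuous_apply i)

lemma eT_norm (x : TT ι) (i : ι) : ‖eT x i‖ = 1 := by
  rw [eT, fourier_apply]; exact Circle.norm_coe _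

lemma eT_ne (x : TT ι) (i : ι) : eT x i ≠ 0 := by
  intro h; have := eT_norm x i; rw [h] at this; simp at this

lemma eT_add (x y : TT ι) (i : ι) : eT (x + y) i = eT x i * eT y i := by
  simp [eT, fourier_apply, AddCircle.toCircle_add]

def ptT (θ : ι → ℝ) : TT ι := fun i => ((θ i / (2 * pπ) : ℝ) : UnitAddCircle)

lemma eT_pt (θ : ι → ℝ) (i : ι) : eT (ptT θ) i = cexp (θ i * I) := by
  unfold eT ptT
  rw [fourier_coe_apply]
  congr 1
  have : (pπ : ℂ) ≠ 0 := by exact_mod_cast Real.pi_ne_zero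
  push_cast
  field_simp

def chi (k : ι → ℤ) (x : TT ι) : ℂ := ∏ i, (eT x i) ^ (k i)

lemma chi_cont (k : ι → ℤ) : Continuous (chi (ι := ι) k) := by
  unfold chi
  exact continuous_finsetProd _ fun i _ => (eT_cont i).zpow₀ _ (fun x => Or.inl (eT_ne x i))

lemma chi_norm (k : ι → ℤ) (x : TT ι) : ‖chi k x‖ = 1 := by
  simp [chi, eT_norm, norm_zpow]

lemma chi_add (k : ι → ℤ) (x y : TT ι) : chi k (x + y) = chi k x * chi k y := by
  simp [chi, eT_add, mul_zpow, Finset.prod_mul_distrib]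

lemma chi_conj (k : ι → ℤ) (x : TT ι) : cj (chi k x) = (chi k x)⁻¹ := by
  rw [Complex.inv_def, Complex.normSq_eq_norm_sq, chi_norm]; simp

lemma chi_sub (k l : ι → ℤ) (x : TT ι) : chi (k - l) x = chi k x * (chi l x)⁻¹ := by
  simp only [chi, Pi.sub_apply, zpow_sub₀ (eT_ne x _), Finset.prod_div_distrib]
  rw [div_eq_mul_inv]

lemma chi_single (i : ι) (x : TT ι) : chi (pis i 1) x = eT x i := by
  unfold chi
  rw [Finset.prod_eq_single i]
  · simp
  · intro b _ hb; simp [hb]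
  · simp

lemma chi_pt (k : ι → ℤ) (θ : ι → ℝ) : chi k (ptT θ) = cexp ((kd k θ : ℝ) * I) := by
  unfold chi kd
  simp only [eT_pt, ← Complex.exp_int_mul, ← Complex.exp_sum]
  congr 1
  push_cast
  rw [Finset.sum_mul]
  exact Finset.sum_congr rfl fun i _ => by ring

lemma int_cont {E : Type*} [NormedAddCommGroup E] {f : TT ι → E} (hf : Continuous f) : Integrable f (mT ι) :=
  hf.integrable_of_hasCompactSupport (HasCompactSupport.of_compactSpace f)

lemma chi_int (k : ι → ℤ) : ∫ x, chi k x ∂(mT ι) = if k = 0 then 1 else 0 := by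
  split_ifs with h
  · subst h; simp [chi]
  · obtain ⟨i, hi⟩ : ∃ i, k i ≠ 0 := by
      by_contra hc; push Not at hc; exact h (funext hc)
    have h1 : ∫ x, chi k (ptT (pis i (pπ / k i)) + x) ∂(mT ι) = ∫ x, chi k x ∂(mT ι) :=
      integral_add_left_eq_self _ _
    have h2 : chi k (ptT (pis i (pπ / k i))) = -1 := by
      rw [chi_pt, kd_single]
      have : (k i : ℝ) * (pπ / k i) = pπ := by
        have : (k i : ℝ) ≠ 0 := by exact_mod_cast hi
        field_simp
      rw [this, Complex.exp_pi_mul_I]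
    simp only [chi_add, h2, integral_const_mul] at h1
    have : (2:ℂ) * ∫ x, chi k x ∂(mT ι) = 0 := by linear_combination -h1
    simpa using this

def box (ι : Type) [Fintype ι] [DecidableEq ι] (m : ℕ) : Finset (ι → ℤ) := Fintype.piFinset fun _ => Finset.Ico (0:ℤ) m

lemma box_card (m : ℕ) : (box ι m).card = m ^ Fintype.card ι := by
  simp [box, Fintype.card_piFinset]

lemma box_shift (m : ℕ) (hm : 1 ≤ m) (i : ι) : (m - 1) * m ^ (Fintype.card ι) ≤
    m * ((box ι m ×ˢ box ι m).filter (fun p => p.1 - p.2 = pis i 1)).card := by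
  set B : Finset (ι → ℤ) := Fintype.piFinset (Function.update (fun _ => Finset.Ico (0:ℤ) m) i (Finset.Ico (0:ℤ) (m - 1 : ℕ))) with hB
  have h1 : B.card ≤ ((box ι m ×ˢ box ι m).filter (fun p => p.1 - p.2 = pis i 1)).card := by
    refine Finset.card_le_card_of_injOn (fun l => (l + pis i 1, l)) ?_ ?_
    · intro l hl
      have hl' : ∀ j, l j ∈ Function.update (fun _ => Finset.Ico (0:ℤ) m) i (Finset.Ico (0:ℤ) (m - 1 : ℕ)) j := by
        simpa [hB, Fintype.mem_piFinset] using hl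
      simp only [Finset.coe_filter, Finset.mem_product, Set.mem_ofPred_eq, box, Fintype.mem_piFinset, Finset.mem_Ico]
      refine ⟨⟨fun j => ?_, fun j => ?_⟩, by simp⟩
      all_goals
        have := hl' j
        by_cases hj : j = i
        · subst hj; simp at this ⊢; omega
        · simpa [hj] using this
    · intro a _ b _ hab
      exact (Prod.ext_iff.mp hab).2
  have h2 : m * B.card = (m - 1) * m ^ Fintype.card ι := by
    rw [hB, Fintype.card_piFinset]
    have e : ∀ j, (Function.update (fun _ => Finset.Ico (0:ℤ) m) i (Finset.Ico (0:ℤ) (m - 1 : ℕ)) j).card =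
        Function.update (fun _ => m) i (m - 1) j := by
      intro j
      by_cases hj : j = i
      · subst hj; simp
      · simp [hj]
    simp only [e]
    rw [Finset.prod_update_of_mem (Finset.mem_univ i), Finset.prod_const, ← Finset.card_univ,
      Finset.card_sdiff_of_subset (by simp), Finset.card_singleton]
    have hc : 1 ≤ (Finset.univ : Finset ι).card := Finset.card_pos.mpr ⟨i, Finset.mem_univ i⟩
    obtain ⟨n, hn⟩ := Nat.exists_eq_add_of_le hc
    rw [hn]; simp; ring
  rw [← h2]
  exact Nat.mul_le_mul_left _ h1

theorem kernel (ε : ℝ) (hε : 0 < ε) : ∃ (G : Finset (ι → ℤ)) (c : (ι → ℤ) → ℝ) (P : TT ι → ℝ),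
    (∀ k, |c k| ≤ 1) ∧ Continuous P ∧ (∀ x, 0 ≤ P x) ∧ (∫ x, P x ∂(mT ι) = 1) ∧
    (∀ x, (P x : ℂ) = ∑ k ∈ G, (c k : ℂ) * cj (chi k x)) ∧
    ∀ i, ∫ x, P x * ‖eT x i - 1‖ ∂(mT ι) ≤ ε := by
  obtain ⟨m, hm⟩ := exists_nat_gt (2 / ε^2 + 1)
  have hm1 : (1:ℝ) < m := by have : 0 < 2 / ε^2 := by positivity
                             linarith
  have hm1' : 1 ≤ m := by exact_mod_cast hm1.le
  set n : ℝ := (m:ℝ) ^ Fintype.card ι with hn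
  have hn0 : 0 < n := by positivity
  set BB := box ι m ×ˢ box ι m with hBB
  set c : (ι → ℤ) → ℝ := fun k => ((BB.filter fun p => p.1 - p.2 = k).card : ℝ) / n with hc
  set P : TT ι → ℝ := fun x => ‖∑ l ∈ box ι m, chi l x‖^2 / n with hP
  have hPc : Continuous P := by
    have := fun l => chi_cont (ι := ι) l
    fun_prop
  have hP0 : ∀ x, 0 ≤ P x := fun x => by positivity
  have hPe : ∀ x, (P x : ℂ) = ∑ p ∈ BB, (n : ℂ)⁻¹ * cj (chi (p.1 - p.2) x) := by
    intro x
    rw [← Finset.mul_sum, hBB, Finset.sum_product]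
    have : ∀ a b : ι → ℤ, cj (chi (a - b) x) = cj (chi a x) * chi b x := by
      intro a b
      rw [chi_sub, map_mul, ← chi_conj, Complex.conj_conj]
    simp only [this]
    rw [← Finset.sum_mul_sum, ← map_sum, hP]
    push_cast
    rw [Complex.conj_mul']
    ring
  have hco : ∀ k, ∫ x, (P x : ℂ) * chi k x ∂(mT ι) = c k := by
    intro k
    have e : ∀ x, (P x : ℂ) * chi k x = ∑ p ∈ BB, (n : ℂ)⁻¹ * chi (k - (p.1 - p.2)) x := by
      intro x
      rw [hPe, Finset.sum_mul]
      refine Finset.sum_congr rfl fun p _ => ?_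
      rw [chi_sub k, chi_conj]; ring
    simp only [e]
    have hi : ∀ p ∈ BB, Integrable (fun x => (n:ℂ)⁻¹ * chi (k-(p.1-p.2)) x) (mT ι) := fun p _ =>
      int_cont (by have := chi_cont (ι:=ι) (k-(p.1-p.2)); fun_prop)
    rw [integral_finsetSum _ hi]
    simp only [integral_const_mul, chi_int, sub_eq_zero]
    rw [← Finset.mul_sum, Finset.sum_boole, hc]
    push_cast
    simp only [eq_comm (a := k)]
    ring
  have hPi : ∫ x, P x ∂(mT ι) = 1 := by
    have h1 := hco 0
    have h0 : ∀ x, chi (0 : ι → ℤ) x = 1 := by intro x; simp [chi]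
    simp only [h0, mul_one] at h1
    rw [integral_complex_ofReal] at h1
    have h2 : c 0 = 1 := by
      have : (BB.filter fun p => p.1 - p.2 = 0).card = (box ι m).card := by
        refine (Finset.card_bij (fun l _ => (l, l)) ?_ ?_ ?_).symm
        · intro l hl; simp [hBB, hl]
        · intro a _ b _ hab; exact (Prod.ext_iff.mp hab).1
        · rintro ⟨a, b⟩ hab
          simp only [hBB, Finset.mem_filter, Finset.mem_product, sub_eq_zero] at hab
          exact ⟨a, hab.1.1, by simp [hab.2]⟩
      rw [hc]
      simp only [this, box_card]
      push_cast
      rw [div_self hn0.ne']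
    rw [h2] at h1
    exact_mod_cast h1
  refine ⟨BB.image fun p => p.1 - p.2, c, P, ?_, hPc, hP0, hPi, ?_, ?_⟩
  · intro k
    have h1 : ‖((c k : ℝ) : ℂ)‖ ≤ 1 := by
      rw [← hco]
      refine (norm_integral_le_integral_norm _).trans ?_
      refine le_trans (le_of_eq (integral_congr_ae (Eventually.of_forall fun x => ?_))) hPi.le
      simp only [norm_mul, chi_norm, mul_one, Complex.norm_real, Real.norm_eq_abs, abs_of_nonneg (hP0 x)]
    simpa using h1
  · intro x
    rw [hPe, Finset.sum_comp (fun k => (n : ℂ)⁻¹ * cj (chi k x)) (fun p : (ι → ℤ) × (ι → ℤ) => p.1 - p.2)]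
    refine Finset.sum_congr rfl fun k _ => ?_
    rw [hc]; push_cast; rw [nsmul_eq_mul]; ring
  · intro i
    have hei := eT_cont (ι := ι) i
    have h2 : ∫ x, P x * ‖eT x i - 1‖^2 ∂(mT ι) = 2 - 2 * c (pis i 1) := by
      have e1 : ∀ x, P x * ‖eT x i - 1‖^2 = 2 * P x - 2 * ((P x : ℂ) * chi (pis i 1) x).re := by
        intro x
        rw [chi_single, re_ofReal_mul]
        have h3 : ‖eT x i - 1‖^2 = ‖eT x i‖^2 + 1 - 2 * (eT x i).re := by
          rw [← Complex.normSq_eq_norm_sq, ← Complex.normSq_eq_norm_sq, Complex.normSq_sub]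
          simp
        rw [h3, eT_norm]; ring
      simp only [e1]
      have hcc : Continuous fun x => (P x : ℂ) * chi (pis i 1) x :=
        (Complex.continuous_ofReal.comp hPc).mul (chi_cont _)
      have i1 : Integrable (fun x => 2 * P x) (mT ι) := int_cont (by fun_prop)
      have i2 : Integrable (fun x => 2 * ((P x : ℂ) * chi (pis i 1) x).re) (mT ι) :=
        int_cont (by have := chi_cont (ι := ι) (pis i 1); fun_prop)
      rw [integral_sub i1 i2, integral_const_mul, integral_const_mul, hPi]
      have := integral_re (𝕜 := ℂ) (int_cont hcc)
      simp only [RCLike.re_to_complex] at this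
      rw [this, hco]; simp
    have h3 : 1 - 1 / m ≤ c (pis i 1) := by
      have := box_shift (ι := ι) m hm1' i
      have h4 : ((m:ℝ) - 1) * n ≤ m * ((BB.filter fun p => p.1 - p.2 = pis i 1).card : ℝ) := by
        have : (((m - 1) * m ^ (Fintype.card ι) : ℕ) : ℝ) ≤ ((m * (BB.filter fun p => p.1 - p.2 = pis i 1).card : ℕ) : ℝ) := by
          exact_mod_cast this
        push_cast [Nat.cast_sub hm1'] at this
        exact this
      simp only [hc]
      rw [le_div_iff₀ hn0]
      have hm0 : (0:ℝ) < m := by linarith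
      have : (1 - 1 / (m:ℝ)) * n = ((m:ℝ) - 1) * n / m := by field_simp
      rw [this, div_le_iff₀ hm0]; linarith
    have h4 : ∫ x, P x * ‖eT x i - 1‖ ∂(mT ι) ≤ ∫ x, ((1 / (2 * ε)) * (P x * ‖eT x i - 1‖^2) + ε / 2 * P x) ∂(mT ι) := by
      refine integral_mono (int_cont (by fun_prop)) (int_cont (by fun_prop)) fun x => ?_
      have : ‖eT x i - 1‖ ≤ (1 / (2 * ε)) * ‖eT x i - 1‖^2 + ε / 2 := by
        have h5 : 0 ≤ (‖eT x i - 1‖ - ε)^2 / (2 * ε) := by positivity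
        have h6 : (‖eT x i - 1‖ - ε)^2 / (2 * ε) = (1 / (2 * ε)) * ‖eT x i - 1‖^2 + ε / 2 - ‖eT x i - 1‖ := by
          field_simp; ring
        linarith
      have := mul_le_mul_of_nonneg_left this (hP0 x)
      simp only
      nlinarith
    refine h4.trans ?_
    rw [integral_add (int_cont (by fun_prop)) (int_cont (by fun_prop)), integral_const_mul, integral_const_mul, hPi, h2]
    have hm0 : (0:ℝ) < m := by linarith
    have h7 : 2 - 2 * c (pis i 1) ≤ 2 / m := by
      have : 2 / (m:ℝ) = 2 * (1 / m) := by ring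
      rw [this]; linarith
    have h8 : 2 / (m:ℝ) ≤ ε^2 := by
      rw [div_le_iff₀ hm0]
      have : 2 / ε^2 < m := by linarith
      rw [div_lt_iff₀ (by positivity)] at this
      linarith
    have h9 : 1 / (2 * ε) * (2 - 2 * c (pis i 1)) ≤ 1 / (2 * ε) * ε^2 := by gcongr; linarith
    have h10 : 1 / (2 * ε) * ε^2 = ε / 2 := by field_simp
    linarith

end Fejer

section FejA
open Complex MeasureTheory Filter Topology

variable {ι : Type} [Fintype ι] [DecidableEq ι]

def act (x : TT ι) (z : ι → ℂ) : ι → ℂ := fun i => eT x i * z i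

lemma n1_act (x : TT ι) (z : ι → ℂ) : n1 (act x z) = n1 z := by
  simp [n1, act, eT_norm]

lemma act_sub (x : TT ι) (z w : ι → ℂ) : act x z - act x w = act x (z - w) := by
  funext i; simp [act]; ring

lemma act_cont (z : ι → ℂ) : Continuous fun x : TT ι => act x z :=
  continuous_pi fun i => (eT_cont i).mul continuous_const

lemma n1_cont : Continuous (n1 (ι := ι)) := by
  unfold n1; fun_prop

lemma n1_le (z : ι → ℂ) : n1 z ≤ Fintype.card ι * ‖z‖ := by
  unfold n1
  refine (Finset.sum_le_sum fun i _ => norm_le_pi_norm z i).trans ?_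
  simp

def actL (x : TT ι) : Cv ι →L[ℝ] Cv ι :=
  ContinuousLinearMap.pi fun i => (ContinuousLinearMap.mul ℝ ℂ (eT x i)).comp (ContinuousLinearMap.proj i)

lemma actL_apply (x : TT ι) (z : ι → ℂ) : actL x z = act x z := by
  funext i; simp [actL, act]

lemma actL_cont : Continuous (actL (ι := ι)) := by
  rw [continuous_clm_apply]
  intro y
  simp only [actL_apply]
  exact act_cont y

lemma act_single (x : TT ι) (μ : ι) (a : ℂ) : act x (pis μ a) = pis μ (eT x μ * a) := by
  funext i
  by_cases hi : i = μ
  · subst hi; simp [act]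
  · simp [act, hi]

structure FF (F : ι → Cv ι → ℂ) (F' : ι → Cv ι → Cv ι →L[ℝ] ℂ) (K L : ℝ) : Prop where
  K0 : 0 ≤ K
  L0 : 0 ≤ L
  der : ∀ ν z, n1 z < 1 → HasFDerivAt (F ν) (F' ν z) z
  cont : ∀ ν, ContinuousOn (F' ν) {z | n1 z < 1}
  closed : ∀ μ ν z, n1 z < 1 → F' ν z (pis μ 1) + I * F' ν z (pis μ I) =
    F' μ z (pis ν 1) + I * F' μ z (pis ν I)
  bd : ∀ ν z, n1 z < 1 → ‖F ν z‖ ≤ K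
  lip : ∀ ν z z', n1 z < 1 → n1 z' < 1 → ‖F ν z - F ν z'‖ ≤ L * n1 (z - z')

variable {F : ι → Cv ι → ℂ} {F' : ι → Cv ι → Cv ι →L[ℝ] ℂ} {K L : ℝ}

def psi (k : ι → ℤ) (ν : ι) (x : TT ι) : ℂ := cj (chi k x) * cj (eT x ν)

lemma psi_norm (k : ι → ℤ) (ν : ι) (x : TT ι) : ‖psi k ν x‖ = 1 := by
  simp [psi, chi_norm, eT_norm]

lemma psi_cont (k : ι → ℤ) (ν : ι) : Continuous (psi k ν) :=
  (Complex.continuous_conj.comp (chi_cont k)).mul (Complex.continuous_conj.comp (eT_cont ν))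

lemma FF.contF (H : FF F F' K L) (ν : ι) {z : ι → ℂ} (hz : n1 z < 1) :
    Continuous fun x : TT ι => F ν (act x z) := by
  have : ContinuousOn (F ν) {z | n1 z < 1} := fun w hw => (H.der ν w hw).continuousAt.continuousWithinAt
  exact this.comp_continuous (act_cont z) (fun x => by simpa [n1_act] using hz)

def hh (F : ι → Cv ι → ℂ) (c : ℂ) (k : ι → ℤ) (ν : ι) (z : ι → ℂ) : ℂ :=
  c * ∫ x, psi k ν x * F ν (act x z) ∂(mT ι)

def dd (F' : ι → Cv ι → Cv ι →L[ℝ] ℂ) (k : ι → ℤ) (ν : ι) (z : ι → ℂ) (x : TT ι) : Cv ι →L[ℝ] ℂ :=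
  psi k ν x • (F' ν (act x z)).comp (actL x)

def hh' (F' : ι → Cv ι → Cv ι →L[ℝ] ℂ) (c : ℂ) (k : ι → ℤ) (ν : ι) (z : ι → ℂ) : Cv ι →L[ℝ] ℂ :=
  c • ∫ x, dd F' k ν z x ∂(mT ι)

lemma FF.dd_cont (H : FF F F' K L) (k : ι → ℤ) (ν : ι) {z : ι → ℂ} (hz : n1 z < 1) :
    Continuous (dd F' k ν z) := by
  have h1 : Continuous fun x : TT ι => F' ν (act x z) :=
    (H.cont ν).comp_continuous (act_cont z) (fun x => by simpa [n1_act] using hz)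
  exact (psi_cont k ν).smul (h1.clm_comp actL_cont)

lemma FF.derh (H : FF F F' K L) (c : ℂ) (k : ι → ℤ) (ν : ι) (z : ι → ℂ) (hz : n1 z < 1) :
    HasFDerivAt (hh F c k ν) (hh' F' c k ν z) z := by
  have hs : {z : ι → ℂ | n1 z < 1} ∈ 𝓝 z := (isOpen_lt n1_cont continuous_const).mem_nhds hz
  have hc : ∀ w, n1 w < 1 → Continuous fun x : TT ι => psi k ν x * F ν (act x w) := fun w hw =>
    (psi_cont k ν).mul (H.contF ν hw)
  have key : HasFDerivAt (fun z => ∫ x, psi k ν x * F ν (act x z) ∂(mT ι)) (∫ x, dd F' k ν z x ∂(mT ι)) z := by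
    refine And.right (hasFDerivAt_integral_of_dominated_loc_of_lip (bound := fun _ => L * Fintype.card ι) hs
      (F := fun z x => psi k ν x * F ν (act x z)) ?_
      (int_cont (hc z hz)) (H.dd_cont k ν hz).aestronglyMeasurable ?_ (integrable_const _) ?_)
    · filter_upwards [hs] with w hw using (hc w hw).aestronglyMeasurable
    · refine Eventually.of_forall fun x => ?_
      refine LipschitzOnWith.of_dist_le_mul fun w hw w' hw' => ?_
      rw [dist_eq_norm, dist_eq_norm, ← mul_sub, norm_mul, psi_norm, one_mul]
      have h1 := H.lip ν (act x w) (act x w') (by simpa [n1_act] using hw) (by simpa [n1_act] using hw')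
      rw [act_sub, n1_act] at h1
      have h2 := mul_le_mul_of_nonneg_left (n1_le (w - w')) H.L0
      have h3 : ((Real.nnabs (L * Fintype.card ι) : ℝ≥0) : ℝ) = L * Fintype.card ι := by
        rw [Real.coe_nnabs, abs_of_nonneg (mul_nonneg H.L0 (Nat.cast_nonneg _))]
      rw [h3]; linarith
    · refine Eventually.of_forall fun x => ?_
      have h1 : HasFDerivAt (F ν) (F' ν (act x z)) (act x z) := H.der ν _ (by rw [n1_act]; exact hz)
      have h2 : HasFDerivAt (fun w => act x w) (actL x) z :=
        ((actL x).hasFDerivAt (x := z)).congr_of_eventuallyEq (Eventually.of_forall fun w => (actL_apply x w).symm)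
      have h3 : HasFDerivAt (fun w => F ν (act x w)) ((F' ν (act x z)).comp (actL x)) z :=
        HasFDerivAt.comp (g := F ν) z h1 h2
      exact h3.const_mul (psi k ν x)
  exact key.const_mul c

lemma FF.hk (H : FF F F' K L) (c : ℂ) (hc : ‖c‖ ≤ 1) (k : ι → ℤ) : Hk k (hh F c k) (hh' F' c k) K where
  der := fun ν z hz => H.derh c k ν z hz
  hom := by
    intro ν θ z hz
    have e : ∀ x, psi k ν x * F ν (act x (rotv θ z)) =
        cexp (((kd k θ + θ ν : ℝ) : ℂ) * I) * (psi k ν (ptT θ + x) * F ν (act (ptT θ + x) z)) := by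
      intro x
      have h1 : act (ptT θ + x) z = act x (rotv θ z) := by
        funext i; simp only [act, rotv, eT_add, eT_pt]; ring
      have h2 : cexp (((kd k θ + θ ν : ℝ) : ℂ) * I) = chi k (ptT θ) * eT (ptT θ) ν := by
        rw [chi_pt, eT_pt, ← Complex.exp_add]; push_cast; ring_nf
      have a1 : chi k (ptT θ) * cj (chi k (ptT θ)) = 1 := by
        rw [Complex.mul_conj', chi_norm]; simp
      have a2 : eT (ptT θ) ν * cj (eT (ptT θ) ν) = 1 := by
        rw [Complex.mul_conj', eT_norm]; simp
      rw [h1, h2, psi, psi, chi_add, eT_add, map_mul, map_mul]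
      linear_combination (-cj (chi k x) * cj (eT x ν) * F ν (act x (rotv θ z))) * (a1 * (eT (ptT θ) ν * cj (eT (ptT θ) ν)) + a2)
    unfold hh
    simp only [e]
    rw [integral_const_mul, integral_add_left_eq_self (fun x => psi k ν x * F ν (act x z)) (ptT θ)]
    ring
  closed := by
    intro μ ν z hz
    have e : ∀ μ ν : ι, hh' F' c k ν z (pis μ 1) + I * hh' F' c k ν z (pis μ I) =
        c * ∫ x, (dd F' k ν z x (pis μ 1) + I * dd F' k ν z x (pis μ I)) ∂(mT ι) := by
      intro μ ν
      have hd := H.dd_cont k ν hz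
      have hi := int_cont hd
      have h1 : ∀ v, hh' F' c k ν z v = c * ∫ x, dd F' k ν z x v ∂(mT ι) := by
        intro v
        unfold hh'
        rw [smul_apply, ContinuousLinearMap.integral_apply hi, smul_eq_mul]
      have c1 : ∀ v, Continuous fun x => dd F' k ν z x v := fun v => hd.clm_apply continuous_const
      have i1 := int_cont (c1 (pis μ 1))
      have i2 : Integrable (fun x => I * dd F' k ν z x (pis μ I)) (mT ι) :=
        (int_cont (c1 (pis μ I))).const_mul I
      rw [h1, h1, integral_add i1 i2, integral_const_mul]; ring
    rw [e, e]
    congr 1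
    refine integral_congr_ae (Eventually.of_forall fun x => ?_)
    have g : ∀ μ ν : ι, dd F' k ν z x (pis μ 1) + I * dd F' k ν z x (pis μ I) =
        cj (chi k x) * (cj (eT x ν) * cj (eT x μ)) *
        (F' ν (act x z) (pis μ 1) + I * F' ν (act x z) (pis μ I)) := by
      intro μ ν
      set A : ℂ →L[ℝ] ℂ := (F' ν (act x z)).comp (ContinuousLinearMap.single ℝ (fun _ : ι => ℂ) μ) with hA
      have hA' : ∀ a, F' ν (act x z) (pis μ a) = A a := fun a => by simp [hA]
      have hd : ∀ a, dd F' k ν z x (pis μ a) = psi k ν x * A (eT x μ * a) := by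
        intro a
        rw [← hA', ← act_single, ← actL_apply]; rfl
      rw [hd, hd, hA', hA', clm_expand A (eT x μ * 1), clm_expand A (eT x μ * I)]
      have hcj : cj (eT x μ) = (eT x μ).re - (eT x μ).im * I := by
        apply Complex.ext <;> simp
      rw [hcj, psi]
      simp only [mul_one, Complex.mul_re, Complex.mul_im, Complex.I_re, Complex.I_im]
      push_cast
      ring_nf
      simp only [Complex.I_sq]
      ring
    simp only
    rw [g μ ν, g ν μ, H.closed μ ν (act x z) (by rw [n1_act]; exact hz)]
    ring
  bd := by
    intro ν z hz
    unfold hh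
    rw [norm_mul]
    have : ‖∫ x, psi k ν x * F ν (act x z) ∂(mT ι)‖ ≤ K := by
      refine (norm_integral_le_of_norm_le_const (C := K) (Eventually.of_forall fun x => ?_)).trans (by simp)
      rw [norm_mul, psi_norm, one_mul]
      exact H.bd ν _ (by rw [n1_act]; exact hz)
    have := mul_le_mul hc this (norm_nonneg _) zero_le_one
    simpa using this

theorem FF.approx (H : FF F F' K L) (ε : ℝ) (hε : 0 < ε) :
    ∃ (h : (ι → ℤ) → ι → Cv ι → ℂ) (u : (ι → ℤ) → Cv ι → ℂ) (G : Finset (ι → ℤ)),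
      Sys h (fun k ζ => u k (ex ζ)) K L ∧ Bd h K L G ∧
      (∀ ν z, n1 z < 1 → ‖∑ k ∈ G, h k ν z - F ν z‖ ≤ (K + L) * ε) ∧
      ∀ k z, n1 z < 1 → (∀ i, z i ≠ 0) → ∃ u' : Cv ι →L[ℝ] ℂ, HasFDerivAt (u k) u' z ∧
        ∀ ν, u' (pis ν 1) + I * u' (pis ν I) = 2 * h k ν z := by
  obtain ⟨G, c, P, hc, hPc, hP0, hPi, hPe, hPε⟩ := kernel (ι := ι) ε hε
  have hk : ∀ k, Hk k (hh F (c k) k) (hh' F' (c k) k) K := fun k => H.hk (c k) (by simpa using hc k) k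
  choose u hu1 hu2 hu3 using fun k => (hk k).solve H.K0
  refine ⟨fun k => hh F (c k) k, u, G, ⟨H.K0, H.L0, ?_, ?_, ?_⟩, ?_, ?_, hu3⟩
  · intro k ν S θ z hz
    exact (hk k).homS ν S θ z hz
  · intro k S ζ x hx
    exact hu1 k S ζ x hx
  · intro k ζ hζ
    exact hu2 k ζ hζ
  all_goals
    have hcont : ∀ ν z, n1 z < 1 → Continuous fun x : TT ι => (P x : ℂ) * (cj (eT x ν) * F ν (act x z)) := by
      intro ν z hz
      exact (Complex.continuous_ofReal.comp hPc).mul ((Complex.continuous_conj.comp (eT_cont ν)).mul (H.contF ν hz))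
    have hsum : ∀ ν z, n1 z < 1 → ∑ k ∈ G, hh F (c k) k ν z =
        ∫ x, (P x : ℂ) * (cj (eT x ν) * F ν (act x z)) ∂(mT ι) := by
      intro ν z hz
      have e : ∀ x, (P x : ℂ) * (cj (eT x ν) * F ν (act x z)) =
          ∑ k ∈ G, (c k : ℂ) * (psi k ν x * F ν (act x z)) := by
        intro x
        rw [hPe, Finset.sum_mul]
        exact Finset.sum_congr rfl fun k _ => by rw [psi]; ring
      simp only [e]
      have hi : ∀ k ∈ G, Integrable (fun x => (c k : ℂ) * (psi k ν x * F ν (act x z))) (mT ι) := by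
        intro k _
        exact (int_cont ((psi_cont k ν).mul (H.contF ν hz))).const_mul _
      rw [integral_finsetSum _ hi]
      exact Finset.sum_congr rfl fun k _ => by rw [integral_const_mul]; rfl
    have hint : ∀ (g : TT ι → ℂ) (C : ℝ), (∀ x, ‖g x‖ ≤ C * P x) → ‖∫ x, g x ∂(mT ι)‖ ≤ C := by
      intro g C hg
      refine (norm_integral_le_of_norm_le ((int_cont hPc).const_mul C) (Eventually.of_forall hg)).trans ?_
      rw [integral_const_mul, hPi, mul_one]
  · constructor
    · intro z hz ν
      simp only
      rw [hsum ν z hz]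
      refine hint _ _ fun x => ?_
      rw [norm_mul, norm_mul, RCLike.norm_conj, eT_norm, one_mul, Complex.norm_real, Real.norm_eq_abs, abs_of_nonneg (hP0 x), mul_comm]
      exact mul_le_mul_of_nonneg_right (H.bd ν _ (by rw [n1_act]; exact hz)) (hP0 x)
    · intro z z' hz hz' ν
      simp only
      rw [hsum ν z hz, hsum ν z' hz', ← integral_sub (int_cont (hcont ν z hz)) (int_cont (hcont ν z' hz'))]
      refine hint _ _ fun x => ?_
      rw [← mul_sub, ← mul_sub, norm_mul, norm_mul, RCLike.norm_conj, eT_norm, one_mul, Complex.norm_real, Real.norm_eq_abs, abs_of_nonneg (hP0 x), mul_comm]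
      refine mul_le_mul_of_nonneg_right ?_ (hP0 x)
      have := H.lip ν (act x z) (act x z') (by rw [n1_act]; exact hz) (by rw [n1_act]; exact hz')
      rwa [act_sub, n1_act] at this
  · intro ν z hz
    simp only
    have e : F ν z = ∫ x, (P x : ℂ) * F ν z ∂(mT ι) := by
      rw [integral_mul_const, integral_complex_ofReal, hPi]; simp
    have hc2 : Continuous fun x : TT ι => (P x : ℂ) * F ν z := by fun_prop
    rw [hsum ν z hz]
    nth_rewrite 1 [e]
    rw [← integral_sub (int_cont (hcont ν z hz)) (int_cont hc2)]
    have hei := fun i => eT_cont (ι := ι) i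
    have hb : ∀ x, ‖(P x : ℂ) * (cj (eT x ν) * F ν (act x z)) - (P x : ℂ) * F ν z‖ ≤
        K * (P x * ‖eT x ν - 1‖) + ∑ i, L * ‖z i‖ * (P x * ‖eT x i - 1‖) := by
      intro x
      rw [← mul_sub, norm_mul, Complex.norm_real, Real.norm_eq_abs, abs_of_nonneg (hP0 x)]
      have h1 : ‖cj (eT x ν) * F ν (act x z) - F ν z‖ ≤ K * ‖eT x ν - 1‖ + ∑ i, L * ‖z i‖ * ‖eT x i - 1‖ := by
        have e1 : cj (eT x ν) * F ν (act x z) - F ν z =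
          cj (eT x ν - 1) * F ν (act x z) + (F ν (act x z) - F ν z) := by
          rw [map_sub, map_one]; ring
        rw [e1]
        refine (norm_add_le _ _).trans (add_le_add ?_ ?_)
        · rw [norm_mul, RCLike.norm_conj, mul_comm]
          exact mul_le_mul_of_nonneg_right (H.bd ν _ (by rw [n1_act]; exact hz)) (norm_nonneg _)
        · refine (H.lip ν _ _ (by rw [n1_act]; exact hz) hz).trans (le_of_eq ?_)
          rw [n1, Finset.mul_sum]
          refine Finset.sum_congr rfl fun i _ => ?_
          have : (act x z - z) i = (eT x i - 1) * z i := by simp [act]; ring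
          rw [this, norm_mul]; ring
      refine (mul_le_mul_of_nonneg_left h1 (hP0 x)).trans (le_of_eq ?_)
      rw [mul_add, Finset.mul_sum]
      congr 1
      · ring
      · exact Finset.sum_congr rfl fun i _ => by ring
    have j1 : Integrable (fun x => K * (P x * ‖eT x ν - 1‖)) (mT ι) := int_cont (by fun_prop)
    have j2 : ∀ i ∈ (Finset.univ : Finset ι), Integrable (fun x => L * ‖z i‖ * (P x * ‖eT x i - 1‖)) (mT ι) :=
      fun i _ => int_cont (by fun_prop)
    refine (norm_integral_le_of_norm_le (j1.add (integrable_finset_sum _ j2)) (Eventually.of_forall hb)).trans ?_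
    simp only [Pi.add_apply]
    rw [integral_add j1 (integrable_finset_sum _ j2), integral_finsetSum _ j2, integral_const_mul]
    simp only [integral_const_mul]
    have h1 := mul_le_mul_of_nonneg_left (hPε ν) H.K0
    have h2 : ∑ i, L * ‖z i‖ * ∫ x, P x * ‖eT x i - 1‖ ∂(mT ι) ≤ L * ε := by
      refine (Finset.sum_le_sum fun i _ => mul_le_mul_of_nonneg_left (hPε i) (mul_nonneg H.L0 (norm_nonneg (z i)))).trans ?_
      rw [← Finset.sum_mul, ← Finset.mul_sum]
      have h3 : L * n1 z ≤ L * 1 := mul_le_mul_of_nonneg_left hz.le H.L0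
      have := mul_le_mul_of_nonneg_right h3 hε.le
      simpa [n1] using this
    linarith

end FejA

section LevS
open Complex MeasureTheory Filter Topology

variable {ι : Type} [Fintype ι] [DecidableEq ι]

def dl (ρ : ℝ) : ℝ := (1 - ρ) / 8
def bb (ρ : ℝ) : ℝ := (1 + 1 / ρ) / 2
def CH (ρ : ℝ) : ℝ := 2 + 2 / (bb ρ - 1)
def Mm (K L ρ : ℝ) (m : ℕ) : ℝ := 300 * (K + L) * CH ρ ^ m
def Cm (b K L ρ : ℝ) (m : ℕ) : ℝ := CC b (Mm K L ρ m) (K + L)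

lemma bb_gt {ρ : ℝ} (h0 : 0 < ρ) (h1 : ρ < 1) : 1 < bb ρ := by
  have : 1 < 1 / ρ := by rw [lt_div_iff₀ h0]; linarith
  unfold bb; linarith

lemma CH_ge {ρ : ℝ} (h0 : 0 < ρ) (h1 : ρ < 1) : 2 ≤ CH ρ := by
  have := bb_gt h0 h1
  have : 0 ≤ 2 / (bb ρ - 1) := div_nonneg (by norm_num) (by linarith)
  unfold CH; linarith

structure Lev (v : Cv ι → ℂ) (F : ι → Cv ι → ℂ) (K L ε ρ : ℝ) : Prop where
  A : ∀ (H : Finset ι) (m : ℕ) z, H.card ≤ m → n1 z < ρ → (∀ i, z i ≠ 0) → ∑ i ∈ Hᶜ, ‖z i‖ ≤ dl ρ / 16 →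
    ‖v z‖ ≤ Mm K L ρ m
  B : ∀ (H : Finset ι) (m : ℕ) z b ν, H.card ≤ m → 0 < b → b ≤ 1 → (∀ i, z i ≠ 0) → n1 z + b ≤ ρ →
    ∑ i ∈ Hᶜ, ‖z i‖ + b ≤ dl ρ / 16 → ∃ D φ : ℂ, ‖D‖ ≤ Cm b K L ρ m ∧ ‖φ‖ ≤ K ∧ ‖φ - F ν z‖ ≤ (K + L) * ε ∧
    ∀ ζ, ‖ζ‖ < b / 4 → z ν + ζ ≠ 0 → ‖v (z + pis ν ζ) - v z - D * ζ - φ * cj ζ‖ ≤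
      Cm b K L ρ m * (‖ζ‖ * √‖ζ‖)

lemma n1_add_le (z w : ι → ℂ) : n1 (z + w) ≤ n1 z + n1 w := by
  unfold n1; rw [← Finset.sum_add_distrib]
  exact Finset.sum_le_sum fun i _ => norm_add_le _ _

lemma sum_single_le (S : Finset ι) (ν : ι) (ζ : ℂ) : ∑ i ∈ S, ‖(pis ν ζ : ι → ℂ) i‖ ≤ ‖ζ‖ := by
  refine (Finset.sum_le_univ_sum_of_nonneg fun i => norm_nonneg _).trans (le_of_eq ?_)
  rw [Finset.sum_eq_single ν]
  · simp
  · intro b _ hb; simp [hb]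
  · simp

lemma sum_add_le (S : Finset ι) (z w : ι → ℂ) : ∑ i ∈ S, ‖(z + w) i‖ ≤ ∑ i ∈ S, ‖z i‖ + ∑ i ∈ S, ‖w i‖ := by
  rw [← Finset.sum_add_distrib]
  exact Finset.sum_le_sum fun i _ => norm_add_le _ _

theorem FF.lev {F : ι → Cv ι → ℂ} {F' : ι → Cv ι → Cv ι →L[ℝ] ℂ} {K L : ℝ} (H : FF F F' K L)
    (ε : ℝ) (hε : 0 < ε) (ρ : ℝ) (h0 : 0 < ρ) (h1 : ρ < 1) : ∃ v, Lev v F K L ε ρ := by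
  obtain ⟨h, u, G, hS, hB, hF, hu⟩ := H.approx ε hε
  have hbg := bb_gt h0 h1
  have hA : ∀ (H : Finset ι) (m : ℕ) z, H.card ≤ m → n1 z < ρ → (∀ i, z i ≠ 0) → ∑ i ∈ Hᶜ, ‖z i‖ ≤ dl ρ / 16 →
    ‖∑ k ∈ G, u k z‖ ≤ Mm K L ρ m := by
    intro Hd m z hm hz hz0 ht
    set ζ : ι → ℂ := fun i => Complex.log (z i) with hζ
    have hex : ex ζ = z := by funext i; simp [ex, hζ, Complex.exp_log (hz0 i)]
    have hp : ∀ S, pS S ζ = ∑ i ∈ S, ‖z i‖ := by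
      intro S; unfold pS
      refine Finset.sum_congr rfl fun i _ => ?_
      rw [← Complex.norm_exp, hζ, Complex.exp_log (hz0 i)]
    have := hS.head (dl ρ) (by unfold dl; linarith) (by unfold dl; linarith) (bb ρ) hbg Hdᶜ Hd disjoint_compl_right G hB
      (fun k _ k' _ i hi hi' => absurd (Finset.mem_compl.mpr hi') hi) ζ (by rw [hp]; exact ht) (by
        rw [Finset.union_compl, Finset.compl_univ, hp, hp]
        have e1 : ∑ i ∈ Hd, ‖z i‖ ≤ ρ :=
          (Finset.sum_le_univ_sum_of_nonneg fun i => norm_nonneg _).trans hz.le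
        have e2 := mul_le_mul_of_nonneg_left e1 (by linarith : 0 ≤ bb ρ)
        have e3 : bb ρ * ρ = (ρ + 1) / 2 := by unfold bb; field_simp
        simp only [Finset.sum_empty]
        unfold dl; linarith)
    simp only [hex] at this
    refine this.trans ?_
    unfold Mm
    have hC := CH_ge h0 h1
    exact mul_le_mul_of_nonneg_left (pow_le_pow_right₀ (by unfold CH at hC; linarith) hm)
      (by have := H.K0; have := H.L0; positivity)
  refine ⟨fun z => ∑ k ∈ G, u k z, ⟨hA, ?_⟩⟩
  intro Hd m z b ν hm hb hb1 hz0 hzρ ht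
  have hK0 := H.K0
  have hL0 := H.L0
  have hz1 : ∀ ζ, ‖ζ‖ < b → n1 (z + pis ν ζ) < ρ := by
    intro ζ hζ
    have := n1_add_le z (pis ν ζ)
    have h2 := sum_single_le Finset.univ ν ζ
    unfold n1 at this h2 hzρ ⊢; linarith
  have hnz : ∀ ζ : ℂ, ζ ≠ - z ν → ∀ i, (z + pis ν ζ : ι → ℂ) i ≠ 0 := by
    intro ζ hζ i
    by_cases hi : i = ν
    · subst hi; simp only [Pi.add_apply, Pi.single_eq_same]
      intro h; apply hζ; linear_combination h
    · simpa [hi] using hz0 i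
  choose! u' hu1 hu2 using hu
  have hline : ∀ ζ : ℂ, HasFDerivAt (fun ζ : ℂ => z + pis ν ζ) (ContinuousLinearMap.single ℝ (fun _ : ι => ℂ) ν) ζ :=
    fun ζ => ((ContinuousLinearMap.single ℝ (fun _ : ι => ℂ) ν).hasFDerivAt).const_add z
  set S : ℂ →L[ℝ] Cv ι := ContinuousLinearMap.single ℝ (fun _ : ι => ℂ) ν with hSd
  have hder : ∀ ζ, ‖ζ‖ < b → ζ ≠ - z ν → HasFDerivAt (fun ζ => ∑ k ∈ G, u k (z + pis ν ζ))
      (∑ k ∈ G, (u' k (z + pis ν ζ)).comp S) ζ := by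
    intro ζ h2 h3
    refine HasFDerivAt.fun_sum fun k _ => ?_
    exact HasFDerivAt.comp (g := u k) ζ (hu1 k _ ((hz1 ζ h2).trans h1) (hnz ζ h3)) (hline ζ)
  obtain ⟨D, hD, hD2⟩ := expand (fun ζ => ∑ k ∈ G, u k (z + pis ν ζ)) (fun ζ => ∑ k ∈ G, h k ν (z + pis ν ζ))
    (fun ζ => ∑ k ∈ G, (u' k (z + pis ν ζ)).comp S) (- z ν) b (Mm K L ρ m) (K + L) hb hb1 (by linarith)
    (neg_ne_zero.mpr (hz0 ν)) (by
      intro ζ h2 h3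
      refine hA Hd m _ hm (hz1 ζ h2) (hnz ζ h3) ?_
      have := sum_add_le Hdᶜ z (pis ν ζ)
      have h4 := sum_single_le Hdᶜ ν ζ
      linarith) hder (by
      intro ζ h2 h3
      simp only [sum_apply, Finset.mul_sum, ← Finset.sum_add_distrib]
      refine Finset.sum_congr rfl fun k _ => ?_
      exact hu2 k _ ((hz1 ζ h2).trans h1) (hnz ζ h3) ν) (by
      intro ζ ζ' h2 h3
      refine (hB.2 _ _ ((hz1 ζ h2).trans h1) ((hz1 ζ' h3).trans h1) ν).trans ?_
      have e : z + pis ν ζ - (z + pis ν ζ') = pis ν (ζ - ζ') := by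
        rw [Pi.single_sub]; abel
      rw [e]
      have := sum_single_le Finset.univ ν (ζ - ζ')
      exact mul_le_mul (by linarith) this (Finset.sum_nonneg fun _ _ => norm_nonneg _) (by linarith)) (by
      simp only [Pi.single_zero, add_zero]
      exact (hB.1 z (by linarith) ν).trans (by linarith))
  have hzz : n1 z < 1 := by linarith
  refine ⟨D, ∑ k ∈ G, h k ν z, hD, hB.1 z hzz ν, hF ν z hzz, ?_⟩
  intro ζ hζ hζν
  simp only [Pi.single_zero, add_zero] at hD2
  have hζν' : ζ ≠ - z ν := fun h => hζν (by rw [h]; ring)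
  by_cases hne : ζ = 0
  · subst hne; simp
  have hc : ContinuousAt (fun ζ => ∑ k ∈ G, u k (z + pis ν ζ)) ζ := (hder ζ (by linarith) hζν').continuousAt
  have hlim : Tendsto (fun t : ℝ => ((1 + t : ℝ) : ℂ) * ζ) (𝓝[>] 0) (𝓝 ζ) := by
    have : Continuous (fun t : ℝ => ((1 + t : ℝ) : ℂ) * ζ) := by fun_prop
    have := (this.tendsto 0).mono_left (nhdsWithin_le_nhds (s := Ioi (0:ℝ)))
    simpa using this
  have hnr : ∀ᶠ t : ℝ in 𝓝[>] 0, ‖((1 + t : ℝ) : ℂ) * ζ‖ ≤ b / 4 ∧ ‖((1 + t : ℝ) : ℂ) * ζ‖ ≠ ‖- z ν‖ := by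
    have c1 : ∀ᶠ t : ℝ in 𝓝[>] 0, ‖((1 + t : ℝ) : ℂ) * ζ‖ ≤ b / 4 := by
      have := hlim.norm.eventually (gt_mem_nhds hζ)
      filter_upwards [this] with t ht using ht.le
    have hzpos : 0 < ‖ζ‖ := norm_pos_iff.mpr hne
    have c2 : ∀ᶠ t : ℝ in 𝓝[>] 0, t ≠ ‖z ν‖ / ‖ζ‖ - 1 := by
      by_cases h : ‖z ν‖ / ‖ζ‖ - 1 ≤ 0
      · filter_upwards [self_mem_nhdsWithin] with t ht
        exact (lt_of_le_of_lt h ht).ne'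
      · push Not at h
        filter_upwards [nhdsWithin_le_nhds (gt_mem_nhds h)] with t ht using ht.ne
    filter_upwards [c1, c2, self_mem_nhdsWithin] with t h2 h3 h4
    refine ⟨h2, fun h5 => h3 ?_⟩
    have h4' : (0:ℝ) < t := h4
    rw [norm_mul, Complex.norm_real, Real.norm_eq_abs, abs_of_pos (by linarith), norm_neg] at h5
    rw [← h5]; field_simp; ring
  have hl1 : Tendsto (fun w : ℂ => ‖∑ k ∈ G, u k (z + pis ν w) - ∑ k ∈ G, u k z - D * w - (∑ k ∈ G, h k ν z) * cj w‖) (𝓝 ζ)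
      (𝓝 ‖∑ k ∈ G, u k (z + pis ν ζ) - ∑ k ∈ G, u k z - D * ζ - (∑ k ∈ G, h k ν z) * cj ζ‖) := by
    have hc1 : Tendsto (fun w : ℂ => ∑ k ∈ G, u k (z + pis ν w)) (𝓝 ζ) (𝓝 (∑ k ∈ G, u k (z + pis ν ζ))) := hc
    have hc2 : Tendsto (fun w : ℂ => D * w) (𝓝 ζ) (𝓝 (D * ζ)) := (continuous_const.mul continuous_id).tendsto ζ
    have hc3 : Tendsto (fun w : ℂ => (∑ k ∈ G, h k ν z) * cj w) (𝓝 ζ) (𝓝 ((∑ k ∈ G, h k ν z) * cj ζ)) :=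
      (continuous_const.mul Complex.continuous_conj).tendsto ζ
    exact (((hc1.sub_const _).sub hc2).sub hc3).norm
  have hl2 : Tendsto (fun w : ℂ => Cm b K L ρ m * (‖w‖ * √‖w‖)) (𝓝 ζ) (𝓝 (Cm b K L ρ m * (‖ζ‖ * √‖ζ‖))) := by
    have : Continuous fun w : ℂ => Cm b K L ρ m * (‖w‖ * √‖w‖) := by fun_prop
    exact this.tendsto ζ
  refine le_of_tendsto_of_tendsto (hl1.comp hlim) (hl2.comp hlim) ?_
  filter_upwards [hnr] with t ht
  exact hD2 _ ht.1 ht.2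

lemma Lev.Cm0 {v : Cv ι → ℂ} {F : ι → Cv ι → ℂ} {K L ε ρ : ℝ} (hv : Lev v F K L ε ρ) (H : Finset ι) (m : ℕ) (z b)
    (ν : ι) (hm : H.card ≤ m) (hb : 0 < b) (hb1 : b ≤ 1) (hz0 : ∀ i, z i ≠ 0) (hz : n1 z + b ≤ ρ)
    (ht : ∑ i ∈ Hᶜ, ‖z i‖ + b ≤ dl ρ / 16) (ζ : ℂ) (hζ : ‖ζ‖ < b / 4) (hn : z ν + ζ ≠ 0) :
    ‖v (z + pis ν ζ) - v z‖ ≤ (2 * Cm b K L ρ m + K) * ‖ζ‖ := by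
  obtain ⟨D, φ, hD, hφ, _, h⟩ := hv.B H m z b ν hm hb hb1 hz0 hz ht
  have h1 := h ζ hζ hn
  have hC : 0 ≤ Cm b K L ρ m := (norm_nonneg _).trans hD
  have h2 : ‖ζ‖ * √‖ζ‖ ≤ ‖ζ‖ := by
    have : √‖ζ‖ ≤ 1 := Real.sqrt_le_one.mpr (by linarith)
    nlinarith [norm_nonneg ζ]
  have e : v (z + pis ν ζ) - v z = (v (z + pis ν ζ) - v z - D * ζ - φ * cj ζ) + D * ζ + φ * cj ζ := by ring
  rw [e]
  refine (norm_add₃_le).trans ?_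
  rw [norm_mul, norm_mul, RCLike.norm_conj]
  nlinarith [mul_le_mul_of_nonneg_left h2 hC, mul_le_mul_of_nonneg_right hD (norm_nonneg ζ), mul_le_mul_of_nonneg_right hφ (norm_nonneg ζ)]

lemma Lev.C {v : Cv ι → ℂ} {F : ι → Cv ι → ℂ} {K L ε ρ : ℝ} (hv : Lev v F K L ε ρ) (H : Finset ι) (m : ℕ) (z w b)
    (hm : H.card ≤ m) (hb : 0 < b) (hb1 : b ≤ 1) (hz0 : ∀ i, z i ≠ 0) (hw0 : ∀ i, w i ≠ 0)
    (hz : n1 z + n1 (w - z) + b ≤ ρ)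
    (ht : ∑ i ∈ Hᶜ, ‖z i‖ + n1 (w - z) + b ≤ dl ρ / 16) (hd : n1 (w - z) < b / 4) :
    ‖v w - v z‖ ≤ (2 * Cm b K L ρ m + K) * n1 (w - z) := by
  set mix : Finset ι → ι → ℂ := fun S i => if i ∈ S then w i else z i with hmix
  have key : ∀ S : Finset ι, ‖v (mix S) - v z‖ ≤ (2 * Cm b K L ρ m + K) * ∑ i ∈ S, ‖(w - z) i‖ := by
    intro S
    induction S using Finset.induction_on with
    | empty =>
      have : mix ∅ = z := by funext i; simp [hmix]
      rw [this]; simp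
    | insert a S ha ih =>
      have e : mix (insert a S) = mix S + pis a (w a - z a) := by
        funext i
        by_cases hi : i = a
        · subst hi; simp [hmix, ha]
        · simp [hmix, hi]
      have hd1 : ∀ i, ‖(mix S - z) i‖ ≤ ‖(w - z) i‖ := by
        intro i; simp only [hmix, Pi.sub_apply]
        split_ifs <;> simp
      have hmz : mix S = z + (mix S - z) := by abel
      have hn1 : n1 (mix S) ≤ n1 z + n1 (w - z) := by
        rw [hmz]
        exact (n1_add_le _ _).trans (by unfold n1; gcongr with i; exact hd1 i)
      have hn2 : ∑ i ∈ Hᶜ, ‖mix S i‖ ≤ ∑ i ∈ Hᶜ, ‖z i‖ + n1 (w - z) := by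
        nth_rewrite 1 [hmz]
        refine (sum_add_le _ _ _).trans (add_le_add le_rfl ?_)
        exact (Finset.sum_le_sum fun i _ => hd1 i).trans (Finset.sum_le_univ_sum_of_nonneg fun i => norm_nonneg _)
      have hma : mix S a = z a := by simp [hmix, ha]
      have hwa : ‖w a - z a‖ ≤ n1 (w - z) :=
        Finset.single_le_sum (f := fun i => ‖(w - z) i‖) (fun i _ => norm_nonneg _) (Finset.mem_univ a)
      have h1 := hv.Cm0 H m (mix S) b a hm hb hb1 (by intro i; simp only [hmix]; split_ifs; exacts [hw0 i, hz0 i])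
        (by linarith) (by linarith) (w a - z a) (by linarith) (by rw [hma]; simpa using hw0 a)
      rw [Finset.sum_insert ha, e, mul_add]
      have e2 : v (mix S + pis a (w a - z a)) - v z = (v (mix S + pis a (w a - z a)) - v (mix S)) + (v (mix S) - v z) := by ring
      rw [e2]
      exact (norm_add_le _ _).trans (add_le_add h1 ih)
  have h2 := key Finset.univ
  have e : mix Finset.univ = w := by funext i; simp [hmix]
  rw [e] at h2
  exact h2

end LevS

section L1S
open Complex MeasureTheory Filter Topology

def eL (i : ℕ) : L1 := lp.single 1 i (1:ℂ)

lemma eL_same (i : ℕ) : eL i i = 1 := by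
  unfold eL; rw [lp.single_apply]; exact Pi.single_eq_same i _

lemma eL_ne {i j : ℕ} (h : j ≠ i) : eL i j = 0 := by
  unfold eL; rw [lp.single_apply]; exact Pi.single_eq_of_ne h _

lemma L1_add_smul (z w : L1) (a : ℂ) (i : ℕ) : (z + a • w) i = z i + a * w i := rfl

lemma L1_hasSum (z : L1) : HasSum (fun i => ‖z i‖) ‖z‖ := by
  have := lp.hasSum_norm (p := 1) (by simp) z
  simpa using this

lemma eL_norm (i : ℕ) : ‖eL i‖ = 1 := by
  refine (L1_hasSum (eL i)).unique ?_
  have := hasSum_single (f := fun j => ‖eL i j‖) i (fun j hj => by simp [eL_ne hj])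
  simpa [eL_same] using this

lemma L1_apply_le (z : L1) (i : ℕ) : ‖z i‖ ≤ ‖z‖ :=
  le_hasSum (L1_hasSum z) i (fun _ _ => norm_nonneg _)

lemma L1_expand (z : L1) : HasSum (fun i => z i • eL i) z := by
  have := lp.hasSum_single (p := 1) (by simp) z
  have e : (fun i => z i • eL i) = fun i => lp.single 1 i (z i) := by
    funext i
    unfold eL
    rw [← lp.single_smul, smul_eq_mul, mul_one]
  rw [e]; exact this

lemma L1_sum_le (z : L1) (S : Finset ℕ) : ∑ i ∈ S, ‖z i‖ ≤ ‖z‖ :=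
  sum_le_hasSum S (fun _ _ => norm_nonneg _) (L1_hasSum z)

lemma L1_apply_cont (i : ℕ) : Continuous fun z : L1 => z i := by
  refine LipschitzWith.continuous (K := 1) (LipschitzWith.of_dist_le_mul fun z w => ?_)
  rw [dist_eq_norm, dist_eq_norm]
  simpa using L1_apply_le (z - w) i

def tl (H : Finset ℕ) (z : L1) : ℝ := ‖z‖ - ∑ i ∈ H, ‖z i‖

lemma tl_cont (H : Finset ℕ) : Continuous (tl H) := by
  have := L1_apply_cont
  unfold tl
  exact continuous_norm.sub (continuous_finset_sum _ fun i _ => (this i).norm)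

lemma tl_exists (z : L1) (c : ℝ) (hc : 0 < c) : ∃ N, tl (Finset.range N) z < c := by
  have := (L1_hasSum z).tendsto_sum_nat
  have := this.eventually (lt_mem_nhds (show ‖z‖ - c < ‖z‖ by linarith))
  obtain ⟨N, hN⟩ := this.exists
  exact ⟨N, by unfold tl; linarith⟩

def tau (i : ℕ) : ℝ := (1/2)^(i+1)

lemma tau_pos (i : ℕ) : 0 < tau i := by unfold tau; positivity

lemma tau_sum (S : Finset ℕ) : ∑ i ∈ S, tau i ≤ 1 := by
  have h : HasSum tau 1 := by
    have := (hasSum_geometric_two).mul_left (1/2)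
    have e : tau = fun i => 1/2 * (1/2:ℝ)^i := by
      funext i; unfold tau; rw [pow_succ]; ring
    rw [e]; simpa using this
  exact sum_le_hasSum S (fun i _ => (tau_pos i).le) h

def tr (N : ℕ) (s : ℝ) (z : L1) : Fin N → ℂ := fun i => z i + ((s * tau i : ℝ) : ℂ)

def embL (N : ℕ) : (Fin N → ℂ) →L[ℝ] L1 :=
  ∑ i : Fin N, ((ContinuousLinearMap.id ℝ ℂ).smulRight (eL i)).comp (ContinuousLinearMap.proj i)

lemma embL_apply (N : ℕ) (z : Fin N → ℂ) : embL N z = ∑ i, z i • eL i := by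
  simp [embL]

lemma embL_norm (N : ℕ) (z : Fin N → ℂ) : ‖embL N z‖ ≤ n1 z := by
  rw [embL_apply]
  refine (norm_sum_le _ _).trans (le_of_eq ?_)
  simp [n1, norm_smul, eL_norm]

lemma embL_single (N : ℕ) (i : Fin N) (a : ℂ) : embL N (pis i a) = a • eL i := by
  rw [embL_apply, Finset.sum_eq_single i]
  · simp
  · intro b _ hb; simp [hb]
  · simp

lemma tr_n1 (N : ℕ) (s : ℝ) (hs : 0 ≤ s) (z : L1) (S : Finset (Fin N)) (H : Finset ℕ) (hSH : ∀ i ∈ S, (i:ℕ) ∉ H) :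
    ∑ i ∈ S, ‖tr N s z i‖ ≤ tl H z + s := by
  have h1 : ∀ i ∈ S, ‖tr N s z i‖ ≤ ‖z (i:ℕ)‖ + s * tau i := by
    intro i _
    refine (norm_add_le _ _).trans ?_
    rw [Complex.norm_real, Real.norm_eq_abs, abs_of_nonneg (mul_nonneg hs (tau_pos i).le)]
  refine (Finset.sum_le_sum h1).trans ?_
  have h2 : ∀ g : ℕ → ℝ, ∑ i ∈ S, g i = ∑ i ∈ S.map Fin.valEmbedding, g i := by
    intro g; rw [Finset.sum_map]; rfl
  rw [h2 (fun i => ‖z i‖ + s * tau i), Finset.sum_add_distrib, ← Finset.mul_sum]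
  have h3 := mul_le_mul_of_nonneg_left (tau_sum (S.map Fin.valEmbedding)) hs
  have hdis : Disjoint H (S.map Fin.valEmbedding) := by
    rw [Finset.disjoint_left]
    intro a ha hb
    obtain ⟨i, hi, rfl⟩ := Finset.mem_map.mp hb
    exact hSH i hi ha
  have h4 := L1_sum_le z (H ∪ S.map Fin.valEmbedding)
  rw [Finset.sum_union hdis] at h4
  unfold tl; linarith

lemma tr_n1' (N : ℕ) (s : ℝ) (hs : 0 ≤ s) (z : L1) : n1 (tr N s z) ≤ ‖z‖ + s := by
  have := tr_n1 N s hs z Finset.univ ∅ (by simp)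
  simpa [tl, n1] using this

lemma tr_sub (N : ℕ) (s : ℝ) (z w : L1) : n1 (tr N s w - tr N s z) ≤ ‖w - z‖ := by
  have e : tr N s w - tr N s z = tr N 0 (w - z) := by
    funext i; simp [tr]
  rw [e]
  simpa using tr_n1' N 0 le_rfl (w - z)

lemma tr_add (N : ℕ) (s : ℝ) (z : L1) (ν : Fin N) (ζ : ℂ) : tr N s (z + ζ • eL ν) = tr N s z + pis ν ζ := by
  funext i
  by_cases hi : i = ν
  · subst hi; simp only [tr, L1_add_smul, eL_same, Pi.add_apply, Pi.single_eq_same]; ring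
  · have : (i:ℕ) ≠ ν := fun h => hi (Fin.ext h)
    simp only [tr, L1_add_smul, eL_ne this, Pi.add_apply, Pi.single_eq_of_ne hi]; ring

def HN (N : ℕ) (H : Finset ℕ) : Finset (Fin N) := Finset.univ.filter fun i => (i:ℕ) ∈ H

lemma HN_card (N : ℕ) (H : Finset ℕ) : (HN N H).card ≤ H.card :=
  Finset.card_le_card_of_injOn (fun i => (i:ℕ)) (fun i hi => by simpa [HN] using hi) (fun _ _ _ _ h => Fin.ext h)

lemma tr_tail (N : ℕ) (s : ℝ) (hs : 0 ≤ s) (z : L1) (H : Finset ℕ) :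
    ∑ i ∈ (HN N H)ᶜ, ‖tr N s z i‖ ≤ tl H z + s :=
  tr_n1 N s hs z _ H (fun i hi => by simpa [HN] using hi)

def cF : Filter (ℕ × ℝ) := (atTop : Filter ℕ).curry (𝓝[>] (0:ℝ))

instance : cF.NeBot := by
  refine ⟨fun h => ?_⟩
  have : ∀ᶠ p in cF, False := by rw [h]; exact Filter.eventually_bot
  unfold cF at this
  rw [eventually_curry_iff] at this
  exact this.exists.elim fun N hN => hN.exists.elim fun _ h => h

def uF : Ultrafilter (ℕ × ℝ) := Ultrafilter.of cF

lemma uF_ev {P : ℕ → ℝ → Prop} (h : ∀ᶠ N in atTop, ∀ᶠ s in 𝓝[>] (0:ℝ), P N s) : ∀ᶠ p in (uF : Filter (ℕ × ℝ)), P p.1 p.2 := by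
  have : ∀ᶠ p in cF, P p.1 p.2 := by
    unfold cF; rw [eventually_curry_iff]; exact h
  exact this.filter_mono (Ultrafilter.of_le cF)

lemma uF_lim (x : ℕ × ℝ → ℂ) (C : ℝ) (h : ∀ᶠ p in (uF : Filter (ℕ × ℝ)), ‖x p‖ ≤ C) :
    ∃ a, Tendsto x uF (𝓝 a) := by
  have hc := isCompact_closedBall (0:ℂ) C
  obtain ⟨a, _, ha⟩ := hc.ultrafilter_le_nhds (uF.map x) (by
    rw [le_principal_iff]
    change x ⁻¹' _ ∈ (uF : Filter (ℕ × ℝ))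
    filter_upwards [h] with p hp
    simpa using hp)
  exact ⟨a, ha⟩

lemma uF_s (c : ℝ) (hc : 0 < c) : ∀ᶠ p in (uF : Filter (ℕ × ℝ)), 0 < p.2 ∧ p.2 < c := by
  refine uF_ev (P := fun _ s => 0 < s ∧ s < c) (Eventually.of_forall fun N => ?_)
  exact Ioo_mem_nhdsGT hc

lemma uF_N (ν : ℕ) : ∀ᶠ p in (uF : Filter (ℕ × ℝ)), ν < p.1 :=
  uF_ev (P := fun N _ => ν < N) ((eventually_gt_atTop ν).mono fun N h => Eventually.of_forall fun _ => h)

lemma uF_ne (z : L1) : ∀ᶠ p in (uF : Filter (ℕ × ℝ)), ∀ i, tr p.1 p.2 z i ≠ 0 := by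
  refine uF_ev (P := fun N s => ∀ i, tr N s z i ≠ 0) (Eventually.of_forall fun N => ?_)
  rw [eventually_all]
  intro i
  by_cases hz : z (i:ℕ) = 0
  · filter_upwards [self_mem_nhdsWithin] with s hs
    have : s * tau i ≠ 0 := (mul_pos hs (tau_pos i)).ne'
    simp only [tr, hz, zero_add]
    exact_mod_cast this
  · have : Continuous fun s : ℝ => tr N s z i := by unfold tr; fun_prop
    have h0 : tr N 0 z i ≠ 0 := by simpa [tr] using hz
    exact nhdsWithin_le_nhds ((this.continuousAt).eventually_ne h0)

lemma uF_emb (z : L1) : Tendsto (fun p : ℕ × ℝ => embL p.1 (tr p.1 p.2 z)) uF (𝓝 z) := by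
  rw [Metric.tendsto_nhds]
  intro η hη
  have h1 := (L1_expand z).tendsto_sum_nat
  have h2 := (Metric.tendsto_nhds.mp h1) (η/2) (by linarith)
  refine uF_ev (P := fun N s => dist (embL N (tr N s z)) z < η) ?_
  filter_upwards [h2] with N hN
  filter_upwards [Ioo_mem_nhdsGT (show (0:ℝ) < η/2 by linarith)] with s hs
  have e : embL N (tr N s z) = ∑ i ∈ Finset.range N, z i • eL i + ∑ i ∈ Finset.range N, ((s * tau i : ℝ) : ℂ) • eL i := by
    rw [embL_apply, ← Finset.sum_add_distrib, ← Fin.sum_univ_eq_sum_range (fun i => z i • eL i + ((s * tau i : ℝ) : ℂ) • eL i)]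
    exact Finset.sum_congr rfl fun i _ => by rw [tr, add_smul]
  have h3 : ‖∑ i ∈ Finset.range N, ((s * tau i : ℝ) : ℂ) • eL i‖ ≤ s := by
    refine (norm_sum_le _ _).trans ?_
    have : ∀ i, ‖((s * tau i : ℝ) : ℂ) • eL i‖ = s * tau i := by
      intro i
      rw [norm_smul, eL_norm, Complex.norm_real, Real.norm_eq_abs, abs_of_nonneg (mul_nonneg hs.1.le (tau_pos i).le), mul_one]
    simp only [this]
    rw [← Finset.mul_sum]
    have := mul_le_mul_of_nonneg_left (tau_sum (Finset.range N)) hs.1.le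
    linarith
  rw [dist_eq_norm] at hN ⊢
  rw [e, add_sub_right_comm]
  refine (norm_add_le _ _).trans_lt ?_
  linarith [hs.2]

lemma uF_ε : Tendsto (fun p : ℕ × ℝ => 1 / ((p.1:ℝ) + 1)) uF (𝓝 0) := by
  rw [Metric.tendsto_nhds]
  intro η hη
  refine uF_ev (P := fun N _ => dist (1 / ((N:ℝ) + 1)) 0 < η) ?_
  have := (Metric.tendsto_nhds.mp (tendsto_one_div_add_atTop_nhds_zero_nat (𝕜 := ℝ))) η hη
  filter_upwards [this] with N hN using Eventually.of_forall fun _ => hN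

end L1S

section LimS
open Complex MeasureTheory Filter Topology

theorem limit (F : ℕ → L1 → ℂ) (K L ρ : ℝ) (h0 : 0 < ρ) (h1 : ρ < 1) (hK : 0 ≤ K)
    (hFl : ∀ ν z w, ‖z‖ < 1 → ‖w‖ < 1 → ‖F ν z - F ν w‖ ≤ L * ‖z - w‖)
    (v : ∀ N, (Fin N → ℂ) → ℂ) (hv : ∀ N, Lev (v N) (fun ν z => F ν (embL N z)) K L (1 / ((N:ℝ) + 1)) ρ) :
    ∃ u : L1 → ℂ, (∀ z H, ‖z‖ < ρ → tl H z < dl ρ / 16 → ‖u z‖ ≤ Mm K L ρ H.card) ∧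
      ∀ z0, ‖z0‖ < ρ → ∃ r C : ℝ, 0 < r ∧ 0 ≤ C ∧
        (∀ z w, ‖z - z0‖ < r → ‖w - z0‖ < r → ‖u w - u z‖ ≤ C * ‖w - z‖) ∧
        ∀ z, ‖z - z0‖ < r → ∀ ν, ∃ D : ℂ, ‖D‖ ≤ C ∧ ∀ ζ : ℂ, ‖ζ‖ < r →
          ‖u (z + ζ • eL ν) - u z - D * ζ - F ν z * cj ζ‖ ≤ C * (‖ζ‖ * √‖ζ‖) := by
  set W : L1 → ℕ × ℝ → ℂ := fun z p => v p.1 (tr p.1 p.2 z) with hW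
  have hdl : 0 < dl ρ := by unfold dl; linarith
  have hWb : ∀ z H, ‖z‖ < ρ → tl H z < dl ρ / 16 → ∀ᶠ p in (uF : Filter (ℕ × ℝ)), ‖W z p‖ ≤ Mm K L ρ H.card := by
    intro z H hz hH
    filter_upwards [uF_ne z, uF_s (min (ρ - ‖z‖) (dl ρ / 16 - tl H z)) (lt_min (by linarith) (by linarith))] with p hp hs
    have hs1 := hs.2.trans_le (min_le_left _ _)
    have hs2 := hs.2.trans_le (min_le_right _ _)
    exact (hv p.1).A (HN p.1 H) H.card _ (HN_card _ _) (by have := tr_n1' p.1 p.2 hs.1.le z; linarith) hp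
      (by have := tr_tail p.1 p.2 hs.1.le z H; linarith)
  have hex : ∀ z, ∃ a, ‖z‖ < ρ → Tendsto (W z) uF (𝓝 a) := by
    intro z
    by_cases hz : ‖z‖ < ρ
    · obtain ⟨N, hN⟩ := tl_exists z (dl ρ / 16) (by linarith)
      obtain ⟨a, ha⟩ := uF_lim (W z) _ (hWb z _ hz hN)
      exact ⟨a, fun _ => ha⟩
    · exact ⟨0, fun h => absurd h hz⟩
  choose u hu using hex
  refine ⟨u, ?_, ?_⟩
  · intro z H hz hH
    exact le_of_tendsto (hu z hz).norm (hWb z H hz hH)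
  intro z0 hz0
  obtain ⟨N0, hN0⟩ := tl_exists z0 (dl ρ / 64) (by linarith)
  set H := Finset.range N0 with hHd
  set m := H.card with hm
  obtain ⟨r0, hr0, hr0'⟩ := Metric.continuousAt_iff.mp ((tl_cont H).continuousAt (x := z0)) (dl ρ / 64) (by linarith)
  set b : ℝ := min 1 (min ((ρ - ‖z0‖) / 4) (dl ρ / 128)) with hb
  have hb0 : 0 < b := by
    refine lt_min one_pos (lt_min ?_ ?_) <;> linarith
  have hb1 : b ≤ 1 := min_le_left _ _
  have hb2 : b ≤ (ρ - ‖z0‖) / 4 := (min_le_right _ _).trans (min_le_left _ _)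
  have hb3 : b ≤ dl ρ / 128 := (min_le_right _ _).trans (min_le_right _ _)
  set r : ℝ := min r0 (b / 16) with hr
  have hrp : 0 < r := lt_min hr0 (by linarith)
  have hrb : r ≤ b / 16 := min_le_right _ _
  have htl : ∀ z, ‖z - z0‖ < r → tl H z < dl ρ / 32 := by
    intro z hz
    have := hr0' (x := z) (by rw [dist_eq_norm]; exact hz.trans_le (min_le_left _ _))
    rw [Real.dist_eq] at this
    have := (abs_lt.mp this).2
    linarith
  have hnz : ∀ z, ‖z - z0‖ < r → ‖z‖ < ‖z0‖ + r := by
    intro z hz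
    have : z = z0 + (z - z0) := by abel
    rw [this]
    exact (norm_add_le _ _).trans_lt (by linarith)
  have hball : ∀ z, ‖z - z0‖ < r → ‖z‖ < ρ := fun z hz => by have := hnz z hz; linarith
  set C := 2 * |Cm b K L ρ m| + K with hC
  have hCm : Cm b K L ρ m ≤ |Cm b K L ρ m| := le_abs_self _
  have hab := abs_nonneg (Cm b K L ρ m)
  refine ⟨r, C, hrp, by positivity, ?_, ?_⟩
  · intro z w hz hw
    refine le_of_tendsto ((hu w (hball w hw)).sub (hu z (hball z hz))).norm ?_
    have hd : ‖w - z‖ < 2 * r := by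
      have : w - z = (w - z0) - (z - z0) := by abel
      rw [this]
      exact (norm_sub_le _ _).trans_lt (by linarith)
    filter_upwards [uF_ne z, uF_ne w, uF_s b hb0] with p hp1 hp2 hs
    have k1 := tr_n1' p.1 p.2 hs.1.le z
    have k2 := tr_tail p.1 p.2 hs.1.le z H
    have k3 := tr_sub p.1 p.2 z w
    have k4 := hnz z hz
    have k5 := htl z hz
    have := (hv p.1).C (HN p.1 H) m (tr p.1 p.2 z) (tr p.1 p.2 w) b (HN_card _ _) hb0 hb1 hp1 hp2
      (by linarith) (by linarith) (by linarith)
    refine this.trans ?_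
    have hn : 0 ≤ n1 (tr p.1 p.2 w - tr p.1 p.2 z) := Finset.sum_nonneg fun _ _ => norm_nonneg _
    refine (mul_le_mul_of_nonneg_right (by linarith : 2 * Cm b K L ρ m + K ≤ C) hn).trans ?_
    exact mul_le_mul_of_nonneg_left k3 (by positivity)
  · intro z hz ν
    have hev : ∀ᶠ p in (uF : Filter (ℕ × ℝ)), ∃ Dφ : ℂ × ℂ, ‖Dφ.1‖ ≤ Cm b K L ρ m ∧
        ‖Dφ.2 - F ν (embL p.1 (tr p.1 p.2 z))‖ ≤ (K + L) * (1 / ((p.1:ℝ) + 1)) ∧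
        ∀ ζ : ℂ, ‖ζ‖ < b / 4 → (∀ i, tr p.1 p.2 (z + ζ • eL ν) i ≠ 0) →
          ‖W (z + ζ • eL ν) p - W z p - Dφ.1 * ζ - Dφ.2 * cj ζ‖ ≤ Cm b K L ρ m * (‖ζ‖ * √‖ζ‖) := by
      filter_upwards [uF_ne z, uF_s b hb0, uF_N ν] with p hp1 hs hN
      have k1 := tr_n1' p.1 p.2 hs.1.le z
      have k2 := tr_tail p.1 p.2 hs.1.le z H
      have k4 := hnz z hz
      have k5 := htl z hz
      obtain ⟨D, φ, hD, _, hφ, hE⟩ := (hv p.1).B (HN p.1 H) m (tr p.1 p.2 z) b ⟨ν, hN⟩ (HN_card _ _) hb0 hb1 hp1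
        (by linarith) (by linarith)
      refine ⟨(D, φ), hD, hφ, fun ζ hζ hne => ?_⟩
      have e := tr_add p.1 p.2 z ⟨ν, hN⟩ ζ
      simp only at e
      have hne' := hne ⟨ν, hN⟩
      rw [e] at hne'
      simp only [Pi.add_apply, Pi.single_eq_same] at hne'
      have := hE ζ hζ hne'
      rw [← e] at this
      exact this
    obtain ⟨Dφ, hDφ⟩ := hev.choice
    obtain ⟨D, hD⟩ := uF_lim (fun p => (Dφ p).1) (Cm b K L ρ m) (hDφ.mono fun p h => h.1)
    have hz1 : ‖z‖ < 1 := (hball z hz).trans h1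
    have hFc : Tendsto (fun p : ℕ × ℝ => F ν (embL p.1 (tr p.1 p.2 z))) uF (𝓝 (F ν z)) := by
      have hz' : ContinuousAt (F ν) z := by
        rw [Metric.continuousAt_iff']
        intro η hη
        have o1 : ∀ᶠ w in 𝓝 z, ‖w‖ < 1 := (isOpen_lt continuous_norm continuous_const).mem_nhds hz1
        have o2 : Tendsto (fun w => L * ‖w - z‖) (𝓝 z) (𝓝 0) := by
          have : Continuous fun w => L * ‖w - z‖ := by fun_prop
          simpa using this.tendsto z
        filter_upwards [o1, o2.eventually (gt_mem_nhds hη)] with w hw1 hw2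
        rw [dist_eq_norm]
        exact (hFl ν w z hw1 hz1).trans_lt hw2
      exact hz'.tendsto.comp (uF_emb z)
    have hφ : Tendsto (fun p => (Dφ p).2) uF (𝓝 (F ν z)) := by
      have e : (fun p => (Dφ p).2) = fun p => ((Dφ p).2 - F ν (embL p.1 (tr p.1 p.2 z))) + F ν (embL p.1 (tr p.1 p.2 z)) := by
        funext p; ring
      rw [e]
      have h2 : Tendsto (fun p => (Dφ p).2 - F ν (embL p.1 (tr p.1 p.2 z))) uF (𝓝 0) := by
        refine squeeze_zero_norm' (hDφ.mono fun p h => h.2.1) ?_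
        simpa using uF_ε.const_mul (K + L)
      simpa using h2.add hFc
    refine ⟨D, ?_, ?_⟩
    · exact (le_of_tendsto hD.norm (hDφ.mono fun p h => h.1)).trans (by linarith)
    · intro ζ hζ
      have hζz : ‖z + ζ • eL ν‖ < ρ := by
        refine (norm_add_le _ _).trans_lt ?_
        rw [norm_smul, eL_norm, mul_one]
        have := hnz z hz
        linarith
      have ht := ((((hu _ hζz).sub (hu z (hball z hz))).sub (hD.mul_const ζ)).sub (hφ.mul_const (cj ζ))).norm
      have : ‖u (z + ζ • eL ν) - u z - D * ζ - F ν z * cj ζ‖ ≤ Cm b K L ρ m * (‖ζ‖ * √‖ζ‖) := by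
        refine le_of_tendsto ht ?_
        filter_upwards [hDφ, uF_ne (z + ζ • eL ν)] with p h2 h3
        exact h2.2.2 ζ (by linarith) h3
      refine this.trans (mul_le_mul_of_nonneg_right (by linarith) (by positivity))

end LimS

section C1S
open Complex MeasureTheory Filter Topology

lemma hs_bound {f : ℕ → ℂ} {a : ℂ} (hf : HasSum f a) (ξ : L1) (η : ℝ) (h : ∀ ν, ‖f ν‖ ≤ η * ‖ξ ν‖) : ‖a‖ ≤ η * ‖ξ‖ :=
  hf.norm_le_of_bounded ((L1_hasSum ξ).mul_left η) h

lemma mkA (a b : ℕ → ℂ) (C : ℝ) (ha : ∀ ν, ‖a ν‖ ≤ C) (hb : ∀ ν, ‖b ν‖ ≤ C) :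
    ∃ A : L1 →L[ℝ] ℂ, ∀ ξ : L1, HasSum (fun ν => a ν * ξ ν + b ν * cj (ξ ν)) (A ξ) := by
  have hbd : ∀ (ξ : L1) ν, ‖a ν * ξ ν + b ν * cj (ξ ν)‖ ≤ (2 * C) * ‖ξ ν‖ := by
    intro ξ ν
    refine (norm_add_le _ _).trans ?_
    rw [norm_mul, norm_mul, RCLike.norm_conj]
    have := mul_le_mul_of_nonneg_right (ha ν) (norm_nonneg (ξ ν))
    have := mul_le_mul_of_nonneg_right (hb ν) (norm_nonneg (ξ ν))
    linarith
  have hs : ∀ ξ : L1, HasSum (fun ν => a ν * ξ ν + b ν * cj (ξ ν)) (∑' ν, (a ν * ξ ν + b ν * cj (ξ ν))) :=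
    fun ξ => (Summable.of_norm_bounded ((L1_hasSum ξ).summable.mul_left (2 * C)) (hbd ξ)).hasSum
  let A0 : L1 →ₗ[ℝ] ℂ :=
    { toFun := fun ξ => ∑' ν, (a ν * ξ ν + b ν * cj (ξ ν))
      map_add' := by
        intro ξ η
        refine (hs (ξ + η)).unique ?_
        convert (hs ξ).add (hs η) using 2 with ν
        have : (ξ + η : L1) ν = ξ ν + η ν := rfl
        rw [this, map_add]; ring
      map_smul' := by
        intro c ξ
        refine (hs (c • ξ)).unique ?_
        have := (hs ξ).mul_left (c : ℂ)
        rw [RingHom.id_apply, Complex.real_smul]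
        have e : (fun ν => a ν * (c • ξ : L1) ν + b ν * cj ((c • ξ : L1) ν)) =
            fun ν => (c:ℂ) * (a ν * ξ ν + b ν * cj (ξ ν)) := by
          funext ν
          have h1 : (c • ξ : L1) ν = (c:ℂ) * ξ ν := by
            have h2 : (c • ξ : L1) ν = c • ξ ν := rfl
            exact h2.trans Complex.real_smul
          have h3 : cj ((c • ξ : L1) ν) = (c:ℂ) * cj (ξ ν) := by
            refine (congrArg _ h1).trans ?_
            rw [map_mul, Complex.conj_ofReal]
          calc _ = a ν * ((c:ℂ) * ξ ν) + b ν * ((c:ℂ) * cj (ξ ν)) := congrArg₂ _ (congrArg _ h1) (congrArg _ h3)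
            _ = _ := by ring
        exact e ▸ this }
  exact ⟨A0.mkContinuous (2 * C) (fun ξ => hs_bound (hs ξ) ξ _ (hbd ξ)), fun ξ => hs ξ⟩

def trc (ξ : L1) (n : ℕ) : L1 := ∑ i ∈ Finset.range n, ξ i • eL i

lemma trc_norm (ξ : L1) (n : ℕ) : ‖trc ξ n‖ ≤ ‖ξ‖ := by
  refine (norm_sum_le _ _).trans ?_
  simp only [norm_smul, eL_norm, mul_one]
  exact L1_sum_le ξ _

theorem c1loc (F : ℕ → L1 → ℂ) (K L : ℝ) (hL : 0 ≤ L) (u : L1 → ℂ) (z0 : L1) (r C : ℝ) (hr : 0 < r) (hC : 0 ≤ C)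
    (hFb : ∀ ν z, ‖z - z0‖ < r → ‖F ν z‖ ≤ K)
    (hFl : ∀ ν z w, ‖z - z0‖ < r → ‖w - z0‖ < r → ‖F ν w - F ν z‖ ≤ L * ‖w - z‖)
    (hlip : ∀ z w, ‖z - z0‖ < r → ‖w - z0‖ < r → ‖u w - u z‖ ≤ C * ‖w - z‖)
    (hexp : ∀ z, ‖z - z0‖ < r → ∀ ν, ∃ D : ℂ, ‖D‖ ≤ C ∧ ∀ ζ : ℂ, ‖ζ‖ < r →
          ‖u (z + ζ • eL ν) - u z - D * ζ - F ν z * cj ζ‖ ≤ C * (‖ζ‖ * √‖ζ‖)) :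
    ∃ A : L1 → L1 →L[ℝ] ℂ, (∀ z, ‖z - z0‖ < r / 4 → HasFDerivAt u (A z) z) ∧ ContinuousAt A z0 ∧
      ∃ D : ℕ → ℂ, ∀ ξ : L1, HasSum (fun ν => D ν * ξ ν + F ν z0 * cj (ξ ν)) (A z0 ξ) := by
  choose! D hD hE using hexp
  have hA : ∀ z, ∃ A : L1 →L[ℝ] ℂ, ‖z - z0‖ < r → ∀ ξ : L1, HasSum (fun ν => D z ν * ξ ν + F ν z * cj (ξ ν)) (A ξ) := by
    intro z
    by_cases hz : ‖z - z0‖ < r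
    · obtain ⟨A, hA⟩ := mkA (D z) (fun ν => F ν z) (max C K) (fun ν => (hD z hz ν).trans (le_max_left _ _))
        (fun ν => (hFb ν z hz).trans (le_max_right _ _))
      exact ⟨A, fun _ => hA⟩
    · exact ⟨0, fun h => absurd h hz⟩
  choose A hA using hA
  have hU : ∀ η : ℝ, 0 < η → ∃ d : ℝ, 0 < d ∧ ∀ z w, ‖z - z0‖ < r / 2 → ‖w - z0‖ < r / 2 → ‖w - z‖ < d →
      ∀ ν, ‖D w ν - D z ν‖ + ‖F ν w - F ν z‖ ≤ η := by
    intro η hη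
    set q := η / (4 * (C + 1)) with hq
    have hq0 : 0 < q := by positivity
    set t := min (r / 4) (q ^ 2) with ht
    have ht0 : 0 < t := lt_min (by linarith) (by positivity)
    have htr : t ≤ r / 4 := min_le_left _ _
    have hst : √t ≤ q := by
      rw [← Real.sqrt_sq hq0.le]
      exact Real.sqrt_le_sqrt (min_le_right _ _)
    have h2C : 2 * C * √t ≤ η / 2 := by
      have h3 : 2 * C * √t ≤ 2 * C * q := mul_le_mul_of_nonneg_left hst (by linarith)
      have h4 : 2 * (C + 1) * q = η / 2 := by rw [hq]; field_simp; ring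
      nlinarith
    refine ⟨η / (2 * (2 * C / t + 2 * L + 1)), by positivity, ?_⟩
    intro z w hz hw hzw ν
    have hz' : ‖z - z0‖ < r := by linarith
    have hw' : ‖w - z0‖ < r := by linarith
    have htn : ‖(t:ℂ)‖ = t := by rw [Complex.norm_real, Real.norm_eq_abs, abs_of_pos ht0]
    have hb : ∀ y, ‖y - z0‖ < r / 2 → ‖y + (t:ℂ) • eL ν - z0‖ < r := by
      intro y hy
      have : y + (t:ℂ) • eL ν - z0 = (y - z0) + (t:ℂ) • eL ν := by abel
      rw [this]
      refine (norm_add_le _ _).trans_lt ?_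
      rw [norm_smul, eL_norm, htn]; linarith
    have e1 := hE z hz' ν (t:ℂ) (by rw [htn]; linarith)
    have e2 := hE w hw' ν (t:ℂ) (by rw [htn]; linarith)
    have e3 := hlip _ _ (hb z hz) (hb w hw)
    have e4 := hlip z w hz' hw'
    have e5 := hFl ν z w hz' hw'
    rw [add_sub_add_right_eq_sub] at e3
    rw [htn, Complex.conj_ofReal] at e1 e2
    have id : (t:ℂ) * (D w ν - D z ν) = (u (z + (t:ℂ) • eL ν) - u z - D z ν * t - F ν z * t)
        - (u (w + (t:ℂ) • eL ν) - u w - D w ν * t - F ν w * t) + (u (w + (t:ℂ) • eL ν) - u (z + (t:ℂ) • eL ν))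
        - (u w - u z) - t * (F ν w - F ν z) := by ring
    have hn : t * ‖D w ν - D z ν‖ ≤ 2 * C * (t * √t) + 2 * C * ‖w - z‖ + t * (L * ‖w - z‖) := by
      have : t * ‖D w ν - D z ν‖ = ‖(t:ℂ) * (D w ν - D z ν)‖ := by rw [norm_mul, htn]
      rw [this, id]
      refine (norm_sub_le _ _).trans ?_
      rw [norm_mul, htn]
      have g1 := norm_sub_le (u (z + (t:ℂ) • eL ν) - u z - D z ν * t - F ν z * t) (u (w + (t:ℂ) • eL ν) - u w - D w ν * t - F ν w * t)
      have g2 := norm_add_le ((u (z + (t:ℂ) • eL ν) - u z - D z ν * t - F ν z * t) - (u (w + (t:ℂ) • eL ν) - u w - D w ν * t - F ν w * t)) (u (w + (t:ℂ) • eL ν) - u (z + (t:ℂ) • eL ν))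
      have g3 := norm_sub_le ((u (z + (t:ℂ) • eL ν) - u z - D z ν * t - F ν z * t) - (u (w + (t:ℂ) • eL ν) - u w - D w ν * t - F ν w * t) + (u (w + (t:ℂ) • eL ν) - u (z + (t:ℂ) • eL ν))) (u w - u z)
      have g4 := mul_le_mul_of_nonneg_left e5 ht0.le
      linarith
    have hn2 : ‖D w ν - D z ν‖ ≤ 2 * C * √t + (2 * C / t + L) * ‖w - z‖ := by
      have : t * (2 * C * √t + (2 * C / t + L) * ‖w - z‖) = 2 * C * (t * √t) + 2 * C * ‖w - z‖ + t * (L * ‖w - z‖) := by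
        field_simp; ring
      rw [← this] at hn
      exact le_of_mul_le_mul_left hn ht0
    have hp : 0 < 2 * C / t + 2 * L + 1 := by positivity
    have hd2 : (2 * C / t + 2 * L) * ‖w - z‖ ≤ η / 2 := by
      rw [lt_div_iff₀ (by positivity)] at hzw
      nlinarith [norm_nonneg (w - z)]
    nlinarith
  refine ⟨A, ?_, ?_, D z0, hA z0 (by simpa using hr)⟩
  · intro z hz
    rw [hasFDerivAt_iff_isLittleO_nhds_zero, Asymptotics.isLittleO_iff]
    intro η hη
    obtain ⟨d, hd, hU'⟩ := hU (η / 2) (by linarith)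
    have o1 : ∀ᶠ ξ : L1 in 𝓝 0, ‖ξ‖ < min d (r / 4) := by
      have := Metric.ball_mem_nhds (0:L1) (lt_min hd (by linarith : 0 < r / 4))
      filter_upwards [this] with ξ h using by simpa using h
    have o2 : ∀ᶠ ξ : L1 in 𝓝 0, C * √‖ξ‖ < η / 2 := by
      have : Continuous fun ξ : L1 => C * √‖ξ‖ := by fun_prop
      have := this.tendsto 0
      simp only [norm_zero, Real.sqrt_zero, mul_zero] at this
      exact this.eventually (gt_mem_nhds (by linarith))
    filter_upwards [o1, o2] with ξ h1 h2
    have h1a := h1.trans_le (min_le_left _ _)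
    have h1b := h1.trans_le (min_le_right _ _)
    have hz' : ‖z - z0‖ < r := by linarith
    have hy : ∀ y : L1, ‖y‖ ≤ ‖ξ‖ → ‖z + y - z0‖ < r / 2 := by
      intro y hy
      have : z + y - z0 = (z - z0) + y := by abel
      rw [this]
      exact (norm_add_le _ _).trans_lt (by linarith)
    have key : ∀ n, ‖u (z + trc ξ n) - u z - ∑ j ∈ Finset.range n, (D z j * ξ j + F j z * cj (ξ j))‖ ≤
        η * ∑ j ∈ Finset.range n, ‖ξ j‖ := by
      intro n
      induction n with
      | zero => simp [trc]
      | succ n ih =>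
        have e : z + trc ξ (n+1) = (z + trc ξ n) + ξ n • eL n := by
          rw [trc, Finset.sum_range_succ, ← trc]; abel
        set y := z + trc ξ n with hyd
        have hyr := hy _ (trc_norm ξ n)
        have hξn := L1_apply_le ξ n
        have g1 := hE y (by linarith) n (ξ n) (by linarith)
        have g2 := hU' z y (by linarith) hyr (by rw [hyd, add_sub_cancel_left]; exact (trc_norm ξ n).trans_lt h1a) n
        rw [Finset.sum_range_succ, Finset.sum_range_succ, e, mul_add]
        have id : u (y + ξ n • eL n) - u z - (∑ j ∈ Finset.range n, (D z j * ξ j + F j z * cj (ξ j)) + (D z n * ξ n + F n z * cj (ξ n)))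
          = (u y - u z - ∑ j ∈ Finset.range n, (D z j * ξ j + F j z * cj (ξ j))) +
            (u (y + ξ n • eL n) - u y - D y n * ξ n - F n y * cj (ξ n)) +
            ((D y n - D z n) * ξ n + (F n y - F n z) * cj (ξ n)) := by ring
        rw [id]
        refine (norm_add₃_le).trans ?_
        have g3 : ‖(D y n - D z n) * ξ n + (F n y - F n z) * cj (ξ n)‖ ≤ η / 2 * ‖ξ n‖ := by
          refine (norm_add_le _ _).trans ?_
          rw [norm_mul, norm_mul, RCLike.norm_conj, ← add_mul]
          exact mul_le_mul_of_nonneg_right g2 (norm_nonneg _)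
        have g4 : C * (‖ξ n‖ * √‖ξ n‖) ≤ η / 2 * ‖ξ n‖ := by
          have : C * √‖ξ n‖ ≤ η / 2 := (mul_le_mul_of_nonneg_left (Real.sqrt_le_sqrt hξn) hC).trans h2.le
          have := mul_le_mul_of_nonneg_right this (norm_nonneg (ξ n))
          linarith
        linarith
    have t1 : Tendsto (fun n => z + trc ξ n) atTop (𝓝 (z + ξ)) := ((L1_expand ξ).tendsto_sum_nat).const_add z
    have hξb := hy ξ le_rfl
    have t2 : Tendsto (fun n => u (z + trc ξ n)) atTop (𝓝 (u (z + ξ))) := by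
      rw [tendsto_iff_norm_sub_tendsto_zero] at t1 ⊢
      refine squeeze_zero (fun _ => norm_nonneg _) (fun n => hlip _ _ (by linarith) (by linarith [hy _ (trc_norm ξ n)])) ?_
      simpa using t1.const_mul C
    have t3 := (hA z hz' ξ).tendsto_sum_nat
    refine le_of_tendsto ((t2.sub_const (u z)).sub t3).norm (Eventually.of_forall fun n => (key n).trans ?_)
    exact mul_le_mul_of_nonneg_left (L1_sum_le ξ _) hη.le
  · rw [Metric.continuousAt_iff]
    intro η hη
    obtain ⟨d, hd, hU'⟩ := hU (η / 2) (by linarith)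
    refine ⟨min d (r / 2), lt_min hd (by linarith), fun {w} hw => ?_⟩
    rw [dist_eq_norm] at hw ⊢
    have hw1 := hw.trans_le (min_le_left _ _)
    have hw2 := hw.trans_le (min_le_right _ _)
    have hz00 : ‖z0 - z0‖ < r / 2 := by simpa using hr
    have := hU' z0 w hz00 hw2 hw1
    refine lt_of_le_of_lt (ContinuousLinearMap.opNorm_le_bound _ (by linarith : 0 ≤ η / 2) fun ξ => ?_) (by linarith)
    rw [sub_apply]
    refine hs_bound ((hA w (by linarith) ξ).sub (hA z0 (by linarith) ξ)) ξ _ fun ν => ?_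
    have e : D w ν * ξ ν + F ν w * cj (ξ ν) - (D z0 ν * ξ ν + F ν z0 * cj (ξ ν)) =
      (D w ν - D z0 ν) * ξ ν + (F ν w - F ν z0) * cj (ξ ν) := by ring
    rw [e]
    refine (norm_add_le _ _).trans ?_
    rw [norm_mul, norm_mul, RCLike.norm_conj, ← add_mul]
    exact mul_le_mul_of_nonneg_right (this ν) (norm_nonneg _)

theorem c1 (F : ℕ → L1 → ℂ) (K L ρ : ℝ) (hL : 0 ≤ L) (h1 : ρ < 1) (u : L1 → ℂ)
    (hFb : ∀ ν z, ‖z‖ < 1 → ‖F ν z‖ ≤ K)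
    (hFl : ∀ ν z w, ‖z‖ < 1 → ‖w‖ < 1 → ‖F ν z - F ν w‖ ≤ L * ‖z - w‖)
    (hu : ∀ z0, ‖z0‖ < ρ → ∃ r C : ℝ, 0 < r ∧ 0 ≤ C ∧
        (∀ z w, ‖z - z0‖ < r → ‖w - z0‖ < r → ‖u w - u z‖ ≤ C * ‖w - z‖) ∧
        ∀ z, ‖z - z0‖ < r → ∀ ν, ∃ D : ℂ, ‖D‖ ≤ C ∧ ∀ ζ : ℂ, ‖ζ‖ < r →
          ‖u (z + ζ • eL ν) - u z - D * ζ - F ν z * cj ζ‖ ≤ C * (‖ζ‖ * √‖ζ‖)) :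
    ContDiffOn ℝ 1 u {z : L1 | ‖z‖ < ρ} ∧ ∀ z : L1, ‖z‖ < ρ → ∀ ξ : L1,
      HasSum (fun ν => F ν z * cj (ξ ν)) (dbar u z ξ) := by
  have hloc : ∀ z0 : L1, ‖z0‖ < ρ → ∃ A : L1 → L1 →L[ℝ] ℂ, (∀ᶠ z in 𝓝 z0, HasFDerivAt u (A z) z) ∧ ContinuousAt A z0 ∧
      ∃ D : ℕ → ℂ, ∀ ξ : L1, HasSum (fun ν => D ν * ξ ν + F ν z0 * cj (ξ ν)) (A z0 ξ) := by
    intro z0 hz0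
    obtain ⟨r, C, hr, hC, ha, hb⟩ := hu z0 hz0
    set r' := min r (1 - ‖z0‖) with hr'
    have hr'0 : 0 < r' := lt_min hr (by linarith)
    have hl : ∀ x : ℝ, x < r' → x < r := fun x h => h.trans_le (min_le_left _ _)
    have hin : ∀ z, ‖z - z0‖ < r' → ‖z‖ < 1 := by
      intro z hz
      have h2 := hz.trans_le (min_le_right _ _)
      have : z = z0 + (z - z0) := by abel
      rw [this]
      exact (norm_add_le _ _).trans_lt (by linarith)
    obtain ⟨A, hA1, hA2, hA3⟩ := c1loc F K L hL u z0 r' C hr'0 hC (fun ν z hz => hFb ν z (hin z hz))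
      (fun ν z w hz hw => hFl ν w z (hin w hw) (hin z hz))
      (fun z w hz hw => ha z w (hl _ hz) (hl _ hw))
      (fun z hz ν => by
        obtain ⟨D, h2, h3⟩ := hb z (hl _ hz) ν
        exact ⟨D, h2, fun ζ hζ => h3 ζ (hl _ hζ)⟩)
    refine ⟨A, ?_, hA2, hA3⟩
    filter_upwards [Metric.ball_mem_nhds z0 (by linarith : 0 < r' / 4)] with z hz
    exact hA1 z (by rwa [Metric.mem_ball, dist_eq_norm] at hz)
  have hop : IsOpen {z : L1 | ‖z‖ < ρ} := isOpen_lt continuous_norm continuous_const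
  constructor
  · rw [show (1 : WithTop ℕ∞) = 0 + 1 from rfl, contDiffOn_succ_iff_fderiv_of_isOpen hop]
    refine ⟨?_, by simp, ?_⟩
    · intro z hz
      obtain ⟨A, hA, _⟩ := hloc z hz
      exact hA.self_of_nhds.differentiableAt.differentiableWithinAt
    · rw [contDiffOn_zero]
      intro z hz
      obtain ⟨A, hA, hAc, _⟩ := hloc z hz
      refine ContinuousAt.continuousWithinAt ?_
      refine hAc.congr ?_
      filter_upwards [hA] with w hw using hw.fderiv.symm
  · intro z hz ξ
    obtain ⟨A, hA, _, D, hD⟩ := hloc z hz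
    have hf := hA.self_of_nhds.fderiv
    have hd : dbar u z ξ = (A z ξ + I * A z (I • ξ)) / 2 :=
      congrArg (fun B : L1 →L[ℝ] ℂ => (B ξ + I * B (I • ξ)) / 2) hf
    have := ((hD ξ).add ((hD (I • ξ)).mul_left I)).div_const 2
    have e : (fun ν => F ν z * cj (ξ ν)) = fun ν => (D ν * ξ ν + F ν z * cj (ξ ν) + I * (D ν * (I • ξ : L1) ν + F ν z * cj ((I • ξ : L1) ν))) / 2 := by
      funext ν
      have h1 : (I • ξ : L1) ν = I * ξ ν := rfl
      have h3 : cj ((I • ξ : L1) ν) = -I * cj (ξ ν) := by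
        refine (congrArg _ h1).trans ?_
        rw [map_mul, Complex.conj_I]
      have h4 : D ν * (I • ξ : L1) ν + F ν z * cj ((I • ξ : L1) ν) = D ν * (I * ξ ν) + F ν z * (-I * cj (ξ ν)) :=
        congrArg₂ _ (congrArg _ h1) (congrArg _ h3)
      refine Eq.trans ?_ (congrArg (fun t => (D ν * ξ ν + F ν z * cj (ξ ν) + I * t) / 2) h4.symm)
      have h5 : I * I = -1 := Complex.I_mul_I
      generalize cj (ξ ν) = c
      linear_combination (F ν z * c / 2 - D ν * ξ ν / 2) * h5
    rw [hd]
    exact e ▸ this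

end C1S

section ASM
open Complex MeasureTheory Filter Topology

lemma asm_bound (ρ : ℝ) (h0 : 0 < ρ) (h1 : ρ < 1) (Q : ℝ) (hQ1 : 1 ≤ Q) (hQ : CH ρ ≤ Q * (dl ρ / (32 * ρ)))
    (K L : ℝ) (hK : 0 ≤ K) (hL : 0 ≤ L) (w : L1) (hw : ‖w‖ < ρ) (c : ℝ)
    (hu : ∀ H : Finset ℕ, tl H w < dl ρ / 16 → c ≤ Mm K L ρ H.card) :
    c ≤ 300 * (K + L) * Delta (Q : ℂ) (fun ν => w ν / (ρ : ℂ)) := by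
  classical
  have hd : 0 < dl ρ := by unfold dl; linarith
  obtain ⟨N, hN⟩ := tl_exists w (dl ρ / 64) (by linarith)
  have hex : ∃ m, ∃ H ⊆ Finset.range N, H.card = m ∧ ∑ ν ∈ Finset.range N \ H, ‖w ν‖ < dl ρ / 32 :=
    ⟨_, Finset.range N, Finset.Subset.refl _, rfl, by simp; linarith⟩
  obtain ⟨H, hH, hHc, hHs⟩ := Nat.find_spec hex
  have hmin : ∀ H' ⊆ Finset.range N, H'.card < Nat.find hex → dl ρ / 32 ≤ ∑ ν ∈ Finset.range N \ H', ‖w ν‖ := by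
    intro H' h1' h2'
    by_contra hcon
    push Not at hcon
    exact Nat.find_min hex h2' ⟨H', h1', rfl, hcon⟩
  have htl : tl H w < dl ρ / 16 := by
    have := Finset.sum_sdiff (f := fun ν => ‖w ν‖) hH
    unfold tl at *
    linarith
  refine (hu H htl).trans ?_
  rw [hHc]
  have hnorm : ∀ ν, ‖w ν / (ρ : ℂ)‖ = ‖w ν‖ / ρ := by
    intro ν
    rw [norm_div, Complex.norm_real, Real.norm_of_nonneg h0.le]
  have hs : HasSum (fun ν => ‖w ν / (ρ : ℂ)‖) (‖w‖ / ρ) := by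
    simp only [hnorm]
    exact (L1_hasSum w).div_const ρ
  have hD := Delta_lower Q hQ1 (fun ν => w ν / (ρ : ℂ)) hs.summable
    (by rw [hs.tsum_eq, div_lt_one h0]; exact hw) (Finset.range N) (Nat.find hex) (dl ρ / (32 * ρ)) (by positivity)
    (by
      intro H' a b
      simp only [hnorm]
      rw [← Finset.sum_div, ← div_div]
      exact div_le_div_of_nonneg_right (hmin H' a b) h0.le)
  have hC := CH_ge (ρ := ρ) h0 h1
  have := (pow_le_pow_left₀ (by linarith) hQ (Nat.find hex)).trans hD
  unfold Mm
  exact mul_le_mul_of_nonneg_left this (by positivity)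

lemma form_c1 {Ω : Set L1} {f : L1 → L1 → ℂ} (hf : IsForm01 1 Ω f) (ξ : L1) : ContDiffOn ℝ 1 (fun w => f w ξ) Ω := by
  have h : ContDiffOn ℝ 1 (fun p : L1 × L1 => f p.1 p.2) (Ω ×ˢ (univ : Set L1)) := hf.2.2
  exact h.comp (g := fun p : L1 × L1 => f p.1 p.2) (f := fun w : L1 => (w, ξ))
    (contDiff_id.prodMk contDiff_const).contDiffOn (fun w hw => ⟨hw, mem_univ _⟩)

lemma form_hasSum {Ω : Set L1} {f : L1 → L1 → ℂ} (hf : IsForm01 1 Ω f) (z : L1) (hz : z ∈ Ω) (ξ : L1) :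
    HasSum (fun ν => f z (eL ν) * cj (ξ ν)) (f z ξ) := by
  have hc : Continuous (f z) := by
    have h : ContinuousOn (fun p : L1 × L1 => f p.1 p.2) (Ω ×ˢ (univ : Set L1)) := hf.2.2.continuousOn
    rw [← continuousOn_univ]
    exact h.comp (g := fun p : L1 × L1 => f p.1 p.2) (f := fun w : L1 => (z, w))
      (by fun_prop) (fun w _ => ⟨hz, mem_univ _⟩)
  let φ : L1 →+ ℂ := AddMonoidHom.mk' (f z) (hf.1 z hz)
  have h := (L1_expand ξ).map φ hc
  have e : (fun ν => f z (eL ν) * cj (ξ ν)) = φ ∘ (fun i => ξ i • eL i) := by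
    funext ν
    exact (mul_comm _ _).trans (hf.2.1 z hz (ξ ν) (eL ν)).symm
  rw [e]
  exact h

lemma form_bd {A : Set L1} {f : L1 → L1 → ℂ} (hf : LipschitzForm f A) (z : L1) (hz : z ∈ A) (ν : ℕ) :
    ‖f z (eL ν)‖ ≤ formNorm0 f A :=
  le_csSup hf.1 ⟨z, hz, eL ν, (eL_norm ν).le, rfl⟩

lemma form_lip {A : Set L1} {f : L1 → L1 → ℂ} (hf : LipschitzForm f A) (z w : L1) (hz : z ∈ A) (hw : w ∈ A) (ν : ℕ) :
    ‖f z (eL ν) - f w (eL ν)‖ ≤ formNorm1 f A * ‖z - w‖ := by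
  by_cases h : z = w
  · subst h; simp
  · have hp : 0 < ‖z - w‖ := norm_pos_iff.2 (sub_ne_zero.2 h)
    rw [← div_le_iff₀ hp]
    exact le_csSup hf.2 ⟨z, hz, w, hw, h, eL ν, (eL_norm ν).le, rfl⟩

lemma fn0 {A : Set L1} {f : L1 → L1 → ℂ} : 0 ≤ formNorm0 f A := by
  refine Real.sSup_nonneg ?_
  rintro x ⟨z, _, ξ, _, rfl⟩
  exact norm_nonneg _

lemma fn1 {A : Set L1} {f : L1 → L1 → ℂ} : 0 ≤ formNorm1 f A := by
  refine Real.sSup_nonneg ?_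
  rintro x ⟨z, _, w, _, _, ξ, _, rfl⟩
  positivity

lemma asm_ax1 (a b c d r : ℂ) (h : (a + I * b) / 2 = (c + I * d) / 2) :
    r * (r * a) + I * (r * (r * b)) = r * (r * c) + I * (r * (r * d)) := by
  linear_combination 2 * r ^ 2 * h

lemma asm_ax2 (a b r : ℂ) : (r * a + I * (r * b)) / 2 = r * ((a + I * b) / 2) := by ring

lemma asm_FF (R : ℝ) (hR : 0 < R) (f : L1 → L1 → ℂ) (hf : IsForm01 1 {z : L1 | ‖z‖ < R} f)
    (hc : DbarClosed {z : L1 | ‖z‖ < R} f) (K L : ℝ) (hK : 0 ≤ K) (hL : 0 ≤ L)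
    (hb : ∀ (ν : ℕ) (z : L1), ‖z‖ < 1 → ‖(R:ℂ) * f (R • z) (eL ν)‖ ≤ K)
    (hl : ∀ (ν : ℕ) (z w : L1), ‖z‖ < 1 → ‖w‖ < 1 → ‖(R:ℂ) * f (R • z) (eL ν) - (R:ℂ) * f (R • w) (eL ν)‖ ≤ L * ‖z - w‖) (N : ℕ) :
    FF (fun (ν : Fin N) (z : Fin N → ℂ) => (R:ℂ) * f (R • embL N z) (eL ν))
      (fun (ν : Fin N) z => (R:ℂ) • ((fderiv ℝ (fun w => f w (eL ν)) (R • embL N z)).comp (R • embL N))) K L := by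
  have hop : IsOpen {z : L1 | ‖z‖ < R} := isOpen_lt continuous_norm continuous_const
  have hin1 : ∀ z : Fin N → ℂ, n1 z < 1 → ‖embL N z‖ < 1 := fun z hz => (embL_norm N z).trans_lt hz
  have hin : ∀ z : Fin N → ℂ, n1 z < 1 → R • embL N z ∈ {z : L1 | ‖z‖ < R} := by
    intro z hz
    have := hin1 z hz
    show ‖R • embL N z‖ < R
    rw [norm_smul, Real.norm_of_nonneg hR.le]
    nlinarith
  have hcd := fun ν : Fin N => form_c1 hf (eL ν)
  refine ⟨hK, hL, ?_, ?_, ?_, ?_, ?_⟩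
  · intro ν z hz
    have h1 : HasFDerivAt (fun w => f w (eL ν)) (fderiv ℝ (fun w => f w (eL ν)) ((R • embL N) z)) ((R • embL N) z) :=
      ((((hcd ν).differentiableOn one_ne_zero) _ (hin z hz)).differentiableAt (hop.mem_nhds (hin z hz))).hasFDerivAt
    exact (h1.comp z (R • embL N).hasFDerivAt).const_mul (R:ℂ)
  · intro ν
    have h1 : ContinuousOn (fderiv ℝ (fun w => f w (eL ν))) {z : L1 | ‖z‖ < R} :=
      (hcd ν).continuousOn_fderiv_of_isOpen hop le_rfl
    have h2 : ContinuousOn (fun z : Fin N → ℂ => fderiv ℝ (fun w => f w (eL ν)) (R • embL N z)) {z | n1 z < 1} :=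
      h1.comp ((embL N).continuous.const_smul R).continuousOn (fun z hz => hin z hz)
    exact (h2.clm_comp continuousOn_const).const_smul (R:ℂ)
  · intro μ ν z hz
    have h := hc _ (hin z hz) (eL ν) (eL μ)
    have key : ∀ (B : L1 →L[ℝ] ℂ) (i : Fin N) (a : ℂ), ((R:ℂ) • (B.comp (R • embL N))) (pis i a) = (R:ℂ) * ((R:ℂ) * B (a • eL i)) := by
      intro B i a
      show (R:ℂ) • (B (R • embL N (pis i a))) = _
      rw [embL_single, map_smul, Complex.real_smul, smul_eq_mul]
    rw [key, key, key, key, one_smul, one_smul]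
    exact asm_ax1 _ _ _ _ _ h
  · intro ν z hz
    exact hb ν _ (hin1 z hz)
  · intro ν z z' hz hz'
    refine (hl ν _ _ (hin1 z hz) (hin1 z' hz')).trans ?_
    rw [← map_sub]
    exact mul_le_mul_of_nonneg_left (embL_norm N _) hL

end ASM

/-- For every `ρ ∈ (0,1)` there is `Q > 1`, depending only on `ρ`, such that
for every `0 < R < ∞` and every `∂̄`-closed `(0,1)`-form `f` of class `C¹` on `B(R) ⊆ l¹`,
Lipschitz continuous on `B(R)`, there is a continuously differentiable `u` on `B(ρR)` with
`∂̄u = f` there and `|u(z)| ≤ 2RQ·Δ(Q, z/(ρR))·(|f|₀ + R|f|₁)` for `z ∈ B(ρR)`. -/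
theorem statement13 (ρ : ℝ) (hρ0 : 0 < ρ) (hρ1 : ρ < 1) :
    ∃ Q : ℝ, 1 < Q ∧
      ∀ (R : ℝ), 0 < R → ∀ f : L1 → L1 → ℂ,
        IsForm01 1 {z : L1 | ‖z‖ < R} f →
        DbarClosed {z : L1 | ‖z‖ < R} f →
        LipschitzForm f {z : L1 | ‖z‖ < R} →
        ∃ u : L1 → ℂ,
          ContDiffOn ℝ 1 u {z : L1 | ‖z‖ < ρ * R} ∧
          (∀ z : L1, ‖z‖ < ρ * R → ∀ ξ : L1, dbar u z ξ = f z ξ) ∧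
          ∀ z : L1, ‖z‖ < ρ * R →
            ‖u z‖ ≤ 2 * R * Q * Delta (Q : ℂ) (fun ν => z ν / ((ρ * R : ℝ) : ℂ)) *
              (formNorm0 f {z : L1 | ‖z‖ < R} + R * formNorm1 f {z : L1 | ‖z‖ < R}) := by
  have hd : 0 < dl ρ := by unfold dl; linarith
  have hC := CH_ge hρ0 hρ1
  have hq0 : 0 ≤ CH ρ / (dl ρ / (32 * ρ)) := by positivity
  refine ⟨150 + CH ρ / (dl ρ / (32 * ρ)), by linarith, ?_⟩
  set Q : ℝ := 150 + CH ρ / (dl ρ / (32 * ρ)) with hQdef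
  have hQ : CH ρ ≤ Q * (dl ρ / (32 * ρ)) := by
    have : 0 < dl ρ / (32 * ρ) := by positivity
    rw [hQdef, add_mul, div_mul_cancel₀ _ this.ne']
    linarith
  intro R hR f hf hc hL
  set A : Set L1 := {z : L1 | ‖z‖ < R} with hA
  set K0 := formNorm0 f A with hK0
  set K1 := formNorm1 f A with hK1
  have hK0n : 0 ≤ K0 := fn0
  have hK1n : 0 ≤ K1 := fn1
  have hin : ∀ z : L1, ‖z‖ < 1 → R • z ∈ A := by
    intro z hz
    show ‖R • z‖ < R
    rw [norm_smul, Real.norm_of_nonneg hR.le]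
    nlinarith
  have hb : ∀ (ν : ℕ) (z : L1), ‖z‖ < 1 → ‖(R:ℂ) * f (R • z) (eL ν)‖ ≤ R * K0 := by
    intro ν z hz
    rw [norm_mul, Complex.norm_real, Real.norm_of_nonneg hR.le]
    exact mul_le_mul_of_nonneg_left (form_bd hL _ (hin z hz) ν) hR.le
  have hl : ∀ (ν : ℕ) (z w : L1), ‖z‖ < 1 → ‖w‖ < 1 →
      ‖(R:ℂ) * f (R • z) (eL ν) - (R:ℂ) * f (R • w) (eL ν)‖ ≤ (R ^ 2 * K1) * ‖z - w‖ := by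
    intro ν z w hz hw
    rw [← mul_sub, norm_mul, Complex.norm_real, Real.norm_of_nonneg hR.le]
    have h := form_lip hL _ _ (hin z hz) (hin w hw) ν
    rw [← smul_sub, norm_smul, Real.norm_of_nonneg hR.le] at h
    calc _ ≤ R * (K1 * (R * ‖z - w‖)) := mul_le_mul_of_nonneg_left h hR.le
      _ = _ := by ring
  have hKn : 0 ≤ R * K0 := by positivity
  have hLn : 0 ≤ R ^ 2 * K1 := by positivity
  have hlev := fun N : ℕ => (asm_FF R hR f hf hc _ _ hKn hLn hb hl N).lev (1 / ((N:ℝ) + 1)) (by positivity) ρ hρ0 hρ1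
  choose v hv using hlev
  obtain ⟨u, hu1, hu2⟩ := limit (fun ν z => (R:ℂ) * f (R • z) (eL ν)) (R * K0) (R ^ 2 * K1) ρ hρ0 hρ1 hKn hl v hv
  obtain ⟨hc1, hc2⟩ := c1 (fun ν z => (R:ℂ) * f (R • z) (eL ν)) (R * K0) (R ^ 2 * K1) ρ hLn hρ1 u hb hl hu2
  have hsc : ∀ z : L1, ‖z‖ < ρ * R → ‖R⁻¹ • z‖ < ρ := by
    intro z hz
    rw [norm_smul, Real.norm_of_nonneg (inv_nonneg.2 hR.le), ← div_eq_inv_mul, div_lt_iff₀ hR]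
    exact hz
  have hop : IsOpen {z : L1 | ‖z‖ < ρ} := isOpen_lt continuous_norm continuous_const
  have hRR : ∀ z : L1, R • (R⁻¹ • z) = z := fun z => smul_inv_smul₀ hR.ne' z
  refine ⟨fun z => u (R⁻¹ • z), ?_, ?_, ?_⟩
  · exact hc1.comp (contDiff_id.const_smul R⁻¹).contDiffOn (fun z hz => hsc z hz)
  · intro z hz ξ
    let T : L1 →L[ℝ] L1 := R⁻¹ • ContinuousLinearMap.id ℝ L1
    have hdu : HasFDerivAt u (fderiv ℝ u (T z)) (T z) :=
      (((hc1.differentiableOn one_ne_zero) _ (hsc z hz)).differentiableAt (hop.mem_nhds (hsc z hz))).hasFDerivAt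
    have hch : fderiv ℝ (fun z : L1 => u (R⁻¹ • z)) z = (fderiv ℝ u (T z)).comp T :=
      (hdu.comp z T.hasFDerivAt).fderiv
    have e1 : dbar (fun z : L1 => u (R⁻¹ • z)) z ξ = (R:ℂ)⁻¹ * dbar u (R⁻¹ • z) ξ := by
      have e2 : ∀ η : L1, fderiv ℝ (fun z : L1 => u (R⁻¹ • z)) z η = (R:ℂ)⁻¹ * fderiv ℝ u (R⁻¹ • z) η := by
        intro η
        refine (DFunLike.congr_fun hch η).trans ?_
        show fderiv ℝ u (R⁻¹ • z) (R⁻¹ • η) = _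
        rw [map_smul, Complex.real_smul, Complex.ofReal_inv]
      refine (congrArg₂ (fun a b => (a + Complex.I * b) / 2) (e2 ξ) (e2 (Complex.I • ξ))).trans ?_
      exact asm_ax2 _ _ _
    have hzA : z ∈ A := by
      show ‖z‖ < R
      nlinarith
    have h1 := (hc2 _ (hsc z hz) ξ).mul_left ((R:ℂ)⁻¹)
    have h2 := form_hasSum hf z hzA ξ
    rw [e1]
    refine h1.unique ?_
    have hRc : (R:ℂ) ≠ 0 := by exact_mod_cast hR.ne'
    have e : (fun ν => (R:ℂ)⁻¹ * ((R:ℂ) * f (R • (R⁻¹ • z)) (eL ν) * cj (ξ ν))) = fun ν => f z (eL ν) * cj (ξ ν) := by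
      funext ν
      rw [hRR, mul_assoc, inv_mul_cancel_left₀ hRc]
    exact e ▸ h2
  · intro z hz
    have h := asm_bound ρ hρ0 hρ1 Q (by linarith) hQ _ _ hKn hLn (R⁻¹ • z) (hsc z hz) ‖u (R⁻¹ • z)‖
      (fun H hH => hu1 _ H (hsc z hz) hH)
    have e : (fun ν => (R⁻¹ • z : L1) ν / (ρ : ℂ)) = fun ν => z ν / ((ρ * R : ℝ) : ℂ) := by
      funext ν
      have h1 : (R⁻¹ • z : L1) ν = (R:ℂ)⁻¹ * z ν := by
        have h2 : (R⁻¹ • z : L1) ν = R⁻¹ • z ν := rfl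
        refine h2.trans ?_
        rw [Complex.real_smul, Complex.ofReal_inv]
      refine (congrArg (fun t => t / (ρ:ℂ)) h1).trans ?_
      push_cast
      have hRc : (R:ℂ) ≠ 0 := by exact_mod_cast hR.ne'
      have hρc : (ρ:ℂ) ≠ 0 := by exact_mod_cast hρ0.ne'
      field_simp
    rw [e] at h
    set D := Delta (Q:ℂ) (fun ν => z ν / ((ρ * R : ℝ) : ℂ)) with hD
    have hD0 : 0 ≤ D := by
      refine tsum_nonneg fun k => ?_
      unfold DeltaTerm nn kk
      positivity
    refine h.trans ?_
    have h3 : 300 * (R * (K0 + R * K1) * D) ≤ (2 * Q) * (R * (K0 + R * K1) * D) :=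
      mul_le_mul_of_nonneg_right (by linarith) (by positivity)
    calc _ = 300 * (R * (K0 + R * K1) * D) := by ring
      _ ≤ _ := h3
      _ = _ := by ring
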